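/- Let X ⊂ P³(K) be a smooth surface of degree d ≥ 3 over an algebraically closed field K of characteristic 0 or of characteristic p > d. Then the set of lines contained in X is finite, and its cardinality ℓ(X) satisfies ℓ(X) ≤ 11d² − 30d + 18. -/

import Mathlib

open MvPolynomial

/-- The restriction of the polynomial `g` to the line through `[u]` spanned by `u` and `v`,
under the linear parametrization `t ↦ u + t • v`. -/
noncomputable def restrictLine {K : Type*} [CommSemiring K] {n : ℕ}
    (g : MvPolynomial (Fin n) K) (u v : Fin n → K) : Polynomial K :=
  MvPolynomial.aeval (fun i => Polynomial.C (u i) + Polynomial.X * Polynomial.C (v i)) g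

/-- `ordGE g u v k` means: the order of vanishing at the point `P = [u]` of the restriction
of `g` to the line spanned by `u` and `v` is at least `k` (this includes the case of the
identically vanishing restriction, i.e. order `∞`). -/
def ordGE {K : Type*} [CommSemiring K] {n : ℕ}
    (g : MvPolynomial (Fin n) K) (u v : Fin n → K) (k : ℕ) : Prop :=
  ∀ j < k, (restrictLine g u v).coeff j = 0

/-- `f` defines a smooth surface of degree `d` in `ℙ³(K)`: `f` is homogeneous of degree `d`
and its four partial derivatives have no common zero in `ℙ³(K)`. -/
def IsSmoothSurfaceOfDegree {K : Type*} [CommSemiring K]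
    (f : MvPolynomial (Fin 4) K) (d : ℕ) : Prop :=
  f.IsHomogeneous d ∧
    ∀ w : Fin 4 → K, w ≠ 0 → ∃ i : Fin 4, MvPolynomial.eval w (MvPolynomial.pderiv i f) ≠ 0

/-- A line in `ℙ³(K)` (the projectivization of a 2-dimensional linear subspace `W` of `K⁴`)
that is contained in the surface `{f = 0}`. -/
def IsLineInSurface {K : Type*} [Field K]
    (f : MvPolynomial (Fin 4) K) (W : Submodule K (Fin 4 → K)) : Prop :=
  Module.finrank K W = 2 ∧ ∀ v ∈ W, MvPolynomial.eval v f = 0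

section DirectionalDerivatives

variable {K A : Type*} [CommRing K] [CommRing A] [Algebra K A]

/-- The derivative of `f` at `P` in the direction `v`. -/
noncomputable def dir1 (f : MvPolynomial (Fin 4) K) (P v : Fin 4 → A) : A :=
  ∑ i, v i * aeval P (pderiv i f)

/-- The second derivative of `f` at `P` in the directions `v`, `w`. -/
noncomputable def dir2 (f : MvPolynomial (Fin 4) K) (P v w : Fin 4 → A) : A :=
  ∑ i, v i * dir1 (pderiv i f) P w

/-- The third derivative of `f` at `P` in the directions `u`, `v`, `w`. -/
noncomputable def dir3 (f : MvPolynomial (Fin 4) K) (P u v w : Fin 4 → A) : A :=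
  ∑ i, u i * dir2 (pderiv i f) P v w

variable (f : MvPolynomial (Fin 4) K) (P u v w x : Fin 4 → A) (a : A)

lemma pderiv_swap (i j : Fin 4) : pderiv i (pderiv j f) = pderiv j (pderiv i f) := by
  have h : ⁅(pderiv i : Derivation K (MvPolynomial (Fin 4) K) (MvPolynomial (Fin 4) K)),
      (pderiv j : Derivation K (MvPolynomial (Fin 4) K) (MvPolynomial (Fin 4) K))⁆ = 0 := by
    apply MvPolynomial.derivation_ext
    intro k
    rw [Derivation.commutator_apply]
    simp [pderiv_X, Pi.single_apply]
    split_ifs <;> simp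
  have h2 := congrArg (fun D => D f) h
  simpa [Derivation.commutator_apply, sub_eq_zero] using h2

lemma dir1_add : dir1 f P (u + v) = dir1 f P u + dir1 f P v := by
  simp [dir1, add_mul, Finset.sum_add_distrib]

lemma dir1_smul : dir1 f P (a • v) = a * dir1 f P v := by
  simp [dir1, Finset.mul_sum, mul_assoc]

lemma dir2_add_left : dir2 f P (u + v) w = dir2 f P u w + dir2 f P v w := by
  simp [dir2, add_mul, Finset.sum_add_distrib]

lemma dir2_smul_left : dir2 f P (a • v) w = a * dir2 f P v w := by
  simp [dir2, Finset.mul_sum, mul_assoc]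

lemma dir2_comm : dir2 f P v w = dir2 f P w v := by
  simp only [dir2, dir1, Finset.mul_sum]
  rw [Finset.sum_comm]
  refine Finset.sum_congr rfl fun i _ => Finset.sum_congr rfl fun j _ => ?_
  rw [pderiv_swap]; ring

lemma dir2_add_right : dir2 f P w (u + v) = dir2 f P w u + dir2 f P w v := by
  simp [dir2_comm f P w, dir2_add_left]

lemma dir2_smul_right : dir2 f P w (a • v) = a * dir2 f P w v := by
  simp [dir2_comm f P w, dir2_smul_left]

lemma dir3_add_left : dir3 f P (u + v) w x = dir3 f P u w x + dir3 f P v w x := by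
  simp [dir3, add_mul, Finset.sum_add_distrib]

lemma dir3_smul_left : dir3 f P (a • v) w x = a * dir3 f P v w x := by
  simp [dir3, Finset.mul_sum, mul_assoc]

lemma dir3_comm_right : dir3 f P u v w = dir3 f P u w v := by
  simp only [dir3]
  refine Finset.sum_congr rfl fun i _ => ?_
  rw [dir2_comm]

lemma dir3_comm_left : dir3 f P u v w = dir3 f P v u w := by
  simp only [dir3, dir2, Finset.mul_sum]
  rw [Finset.sum_comm]
  refine Finset.sum_congr rfl fun i _ => Finset.sum_congr rfl fun j _ => ?_
  rw [pderiv_swap]; ring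

lemma dir3_add_mid : dir3 f P w (u + v) x = dir3 f P w u x + dir3 f P w v x := by
  simp only [dir3_comm_left f P w, dir3_add_left]

lemma dir3_smul_mid : dir3 f P w (a • v) x = a * dir3 f P w v x := by
  simp only [dir3_comm_left f P w, dir3_smul_left]

lemma dir3_add_right : dir3 f P w x (u + v) = dir3 f P w x u + dir3 f P w x v := by
  simp only [dir3_comm_right f P w x, dir3_add_mid]

lemma dir3_smul_right : dir3 f P w x (a • v) = a * dir3 f P w x v := by
  simp only [dir3_comm_right f P w x, dir3_smul_mid]

lemma dir1_zero : dir1 f P 0 = 0 := by simp [dir1]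

lemma dir2_zero_left : dir2 f P 0 v = 0 := by simp [dir2]

lemma dir2_zero_right : dir2 f P v 0 = 0 := by rw [dir2_comm, dir2_zero_left]

variable {f} {d : ℕ}

lemma aeval_smul_of_isHomogeneous (hf : f.IsHomogeneous d) :
    aeval (a • P) f = a ^ d * aeval P f := by
  rw [f.as_sum]
  simp only [map_sum, Finset.mul_sum]
  refine Finset.sum_congr rfl fun m hm => ?_
  have h : m.sum (fun _ k => k) = d := by
    have := hf (mem_support_iff.1 hm)
    simpa [Finsupp.weight_apply, Finsupp.sum] using this
  rw [aeval_monomial, aeval_monomial]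
  simp only [Pi.smul_apply, smul_eq_mul, mul_pow, Finsupp.prod_mul]
  rw [← h]
  simp only [Finsupp.prod, Finsupp.sum, Finset.prod_pow_eq_pow_sum]
  ring

lemma dir1_self (hf : f.IsHomogeneous d) : dir1 f P P = d * aeval P f := by
  have h := congrArg (aeval P) hf.sum_X_mul_pderiv
  simpa [dir1, map_sum] using h

lemma dir2_self (hf : f.IsHomogeneous d) : dir2 f P P w = ((d - 1 : ℕ) : A) * dir1 f P w := by
  rw [dir2_comm]
  rw [dir2, dir1, Finset.mul_sum]
  refine Finset.sum_congr rfl fun i _ => ?_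
  rw [dir1_self _ hf.pderiv]; ring

lemma dir3_self (hf : f.IsHomogeneous d) :
    dir3 f P P v w = ((d - 2 : ℕ) : A) * dir2 f P v w := by
  rw [dir3_comm_left]
  rw [dir3, dir2, Finset.mul_sum]
  refine Finset.sum_congr rfl fun i _ => ?_
  rw [dir2_self _ _ hf.pderiv, Nat.sub_sub]; ring

lemma derivation_aeval {M : Type*} [AddCommGroup M] [Module A M] [Module K M]
    [IsScalarTower K A M] (D : Derivation K A M) (f : MvPolynomial (Fin 4) K) :
    D (aeval P f) = ∑ i, aeval P (pderiv i f) • D (P i) := by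
  induction f using MvPolynomial.induction_on with
  | C a => simp
  | add p q hp hq => simp [hp, hq, add_smul, Finset.sum_add_distrib]
  | mul_X p i hp =>
    simp [hp, add_smul, Finset.sum_add_distrib, pderiv_X, Pi.single_apply, Finset.smul_sum,
      smul_smul, apply_ite (aeval P), ite_smul, mul_ite]

lemma derivation_aeval' (D : Derivation K A A) (f : MvPolynomial (Fin 4) K) :
    D (aeval P f) = dir1 f P (fun i => D (P i)) := by
  rw [derivation_aeval, dir1]
  exact Finset.sum_congr rfl fun i _ => by simp [mul_comm]

lemma derivation_dir1 (D : Derivation K A A) (f : MvPolynomial (Fin 4) K) :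
    D (dir1 f P v) = dir2 f P (fun i => D (P i)) v + dir1 f P (fun i => D (v i)) := by
  rw [dir2_comm, dir1, dir2, dir1, map_sum, ← Finset.sum_add_distrib]
  refine Finset.sum_congr rfl fun i _ => ?_
  rw [Derivation.leibniz, derivation_aeval']
  simp [mul_comm]

lemma derivation_dir2 (D : Derivation K A A) (f : MvPolynomial (Fin 4) K) :
    D (dir2 f P v w) = dir3 f P (fun i => D (P i)) v w + dir2 f P (fun i => D (v i)) w
      + dir2 f P v (fun i => D (w i)) := by
  rw [dir3_comm_left, dir2, dir3, dir2, dir2, map_sum, ← Finset.sum_add_distrib,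
    ← Finset.sum_add_distrib]
  refine Finset.sum_congr rfl fun i _ => ?_
  rw [Derivation.leibniz, derivation_dir1]
  simp [mul_comm]; ring

section Functoriality

variable {B : Type*} [CommRing B] [Algebra K B] (ψ : A →ₐ[K] B)

lemma map_aeval_point (f : MvPolynomial (Fin 4) K) :
    ψ (aeval P f) = aeval (fun i => ψ (P i)) f := by
  rw [← AlgHom.comp_apply, comp_aeval]

lemma map_dir1 (f : MvPolynomial (Fin 4) K) :
    ψ (dir1 f P v) = dir1 f (fun i => ψ (P i)) (fun i => ψ (v i)) := by
  simp [dir1, map_aeval_point]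

lemma map_dir2 (f : MvPolynomial (Fin 4) K) :
    ψ (dir2 f P v w) = dir2 f (fun i => ψ (P i)) (fun i => ψ (v i)) (fun i => ψ (w i)) := by
  simp [dir2, map_dir1]

lemma map_dir3 (f : MvPolynomial (Fin 4) K) :
    ψ (dir3 f P u v w) =
      dir3 f (fun i => ψ (P i)) (fun i => ψ (u i)) (fun i => ψ (v i)) (fun i => ψ (w i)) := by
  simp [dir3, map_dir2]

end Functoriality

end DirectionalDerivatives

section FlecnodalInvariant

variable {A : Type*} [CommRing A]

/-- A joint invariant of a quadratic form `h` and a cubic form `T`, both in four variables. -/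
def flecInvariant (h : Matrix (Fin 4) (Fin 4) A) (T : Fin 4 → Matrix (Fin 4) (Fin 4) A) : A :=
  4 * ∑ i, ∑ l, h.adjugate i l * (T i * h.adjugate * (T l * h.adjugate)).trace
    - 3 * ∑ i, ∑ l, h.adjugate i l * ((T i * h.adjugate).trace * (T l * h.adjugate).trace)

lemma sum_congruence (U B : Matrix (Fin 4) (Fin 4) A) (q : Fin 4 → Fin 4 → A) :
    ∑ i, ∑ l, U i l * (∑ a, ∑ b, B a i * B b l * q a b) =
      ∑ a, ∑ b, (B * U * B.transpose) a b * q a b := by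
  simp only [Matrix.mul_apply, Matrix.transpose_apply, Fin.sum_univ_four]
  ring

lemma flecInvariant_congruence (h B : Matrix (Fin 4) (Fin 4) A)
    (T : Fin 4 → Matrix (Fin 4) (Fin 4) A) :
    flecInvariant (B.transpose * h * B) (fun i => ∑ a, B a i • (B.transpose * T a * B)) =
      B.det ^ 6 * flecInvariant h T := by
  set U := h.adjugate with hU
  have hadj : (B.transpose * h * B).adjugate = B.adjugate * U * B.adjugate.transpose := by
    rw [Matrix.adjugate_mul_distrib, Matrix.adjugate_mul_distrib, Matrix.adjugate_transpose,
      Matrix.mul_assoc]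
  have hBt : B.adjugate.transpose * B.transpose = B.det • 1 := by
    rw [← Matrix.transpose_mul, Matrix.mul_adjugate, Matrix.transpose_smul, Matrix.transpose_one]
  have hB := Matrix.mul_adjugate B
  have hcong : B * (B.adjugate * U * B.adjugate.transpose) * B.transpose = B.det ^ 2 • U := by
    calc _ = (B * B.adjugate) * U * (B.adjugate.transpose * B.transpose) := by
          simp only [Matrix.mul_assoc]
      _ = _ := by rw [hB, hBt]; simp [smul_smul, pow_two]
  have hTU : ∀ a, B.transpose * T a * B * (B.adjugate * U * B.adjugate.transpose) =
      B.det • (B.transpose * (T a * U) * B.adjugate.transpose) := fun a => by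
    calc _ = B.transpose * T a * (B * B.adjugate) * U * B.adjugate.transpose := by
          simp only [Matrix.mul_assoc]
      _ = _ := by rw [hB]; simp [Matrix.mul_assoc]
  have htr : ∀ M : Matrix (Fin 4) (Fin 4) A,
      (B.transpose * M * B.adjugate.transpose).trace = B.det * M.trace := fun M => by
    rw [Matrix.mul_assoc, Matrix.trace_mul_comm, Matrix.mul_assoc, hBt]; simp
  have htr2 : ∀ a b, (B.transpose * (T a * U) * B.adjugate.transpose *
      (B.transpose * (T b * U) * B.adjugate.transpose)).trace =
      B.det ^ 2 * (T a * U * (T b * U)).trace := fun a b => by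
    have : B.transpose * (T a * U) * B.adjugate.transpose *
      (B.transpose * (T b * U) * B.adjugate.transpose) =
      B.det • (B.transpose * ((T a * U) * (T b * U)) * B.adjugate.transpose) := by
      calc _ = B.transpose * (T a * U) * (B.adjugate.transpose * B.transpose) *
            ((T b * U) * B.adjugate.transpose) := by simp only [Matrix.mul_assoc]
        _ = _ := by rw [hBt]; simp [Matrix.mul_assoc]
    rw [this, Matrix.trace_smul, htr, smul_eq_mul]; ring
  have h1 : ∀ i, ((∑ a, B a i • (B.transpose * T a * B)) *
      (B.adjugate * U * B.adjugate.transpose)) =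
      ∑ a, (B a i * B.det) • (B.transpose * (T a * U) * B.adjugate.transpose) := fun i => by
    rw [Finset.sum_mul]
    exact Finset.sum_congr rfl fun a _ => by rw [Matrix.smul_mul, hTU, smul_smul]
  have e1 : ∀ i, ((∑ a, B a i • (B.transpose * T a * B)) *
      (B.adjugate * U * B.adjugate.transpose)).trace = ∑ a, B a i * (B.det ^ 2 * (T a * U).trace) :=
    fun i => by
      rw [h1, Matrix.trace_sum]
      exact Finset.sum_congr rfl fun a _ => by rw [Matrix.trace_smul, htr, smul_eq_mul]; ring
  have e2 : ∀ i l, ((∑ a, B a i • (B.transpose * T a * B)) *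
      (B.adjugate * U * B.adjugate.transpose) * ((∑ a, B a l • (B.transpose * T a * B)) *
      (B.adjugate * U * B.adjugate.transpose))).trace =
      ∑ a, ∑ b, B a i * B b l * (B.det ^ 4 * (T a * U * (T b * U)).trace) := fun i l => by
    rw [h1, h1, Finset.sum_mul, Matrix.trace_sum]
    refine Finset.sum_congr rfl fun a _ => ?_
    rw [Finset.mul_sum, Matrix.trace_sum]
    refine Finset.sum_congr rfl fun b _ => ?_
    rw [Matrix.smul_mul, Matrix.mul_smul, smul_smul, Matrix.trace_smul, htr2, smul_eq_mul]; ring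
  have e3 : ∀ i l, (∑ a, B a i * (B.det ^ 2 * (T a * U).trace)) *
      (∑ a, B a l * (B.det ^ 2 * (T a * U).trace)) =
      ∑ a, ∑ b, B a i * B b l * (B.det ^ 4 * ((T a * U).trace * (T b * U).trace)) := fun i l => by
    rw [Finset.sum_mul_sum]
    exact Finset.sum_congr rfl fun a _ => Finset.sum_congr rfl fun b _ => by ring
  simp only [flecInvariant, hadj, e1, e2, e3, sum_congruence, hcong, ← hU]
  simp only [Matrix.smul_apply, smul_eq_mul, Finset.mul_sum]
  rw [mul_sub]
  simp only [Finset.mul_sum]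
  congr 1 <;>
  exact Finset.sum_congr rfl fun a _ => Finset.sum_congr rfl fun b _ => by ring

lemma adjugate_null_frame (ν μ a b z : A) :
    (!![0, 0, 0, ν; 0, 0, μ, a; 0, μ, 0, b; ν, a, b, z] : Matrix (Fin 4) (Fin 4) A).adjugate =
    !![2 * a * b * μ - z * μ ^ 2, - (b * μ * ν), - (a * μ * ν), μ ^ 2 * ν;
      - (b * μ * ν), 0, μ * ν ^ 2, 0; - (a * μ * ν), μ * ν ^ 2, 0, 0; μ ^ 2 * ν, 0, 0, 0] := by
  ext i j
  rw [Matrix.adjugate_fin_succ_eq_det_submatrix, Matrix.det_fin_three]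
  fin_cases i <;> fin_cases j <;> simp [Matrix.submatrix, Fin.succAbove] <;> ring

set_option maxHeartbeats 4000000 in
lemma flecInvariant_null_frame (ν μ a b z c t111 t112 t113 t122 t123 t133 t222 t223 t233 t333 : A) :
    flecInvariant !![0, 0, 0, ν; 0, 0, μ, a; 0, μ, 0, b; ν, a, b, z]
      ![c • !![0, 0, 0, ν; 0, 0, μ, a; 0, μ, 0, b; ν, a, b, z],
        !![0, 0, c * μ, c * a; 0, t111, t112, t113; c * μ, t112, t122, t123;
          c * a, t113, t123, t133],
        !![0, c * μ, 0, c * b; c * μ, t112, t122, t123; 0, t122, t222, t223;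
          c * b, t123, t223, t233],
        !![c * ν, c * a, c * b, c * z; c * a, t113, t123, t133; c * b, t123, t223, t233;
          c * z, t133, t233, t333]] = 8 * μ ^ 3 * ν ^ 6 * t111 * t222 := by
  rw [flecInvariant, adjugate_null_frame]
  simp only [Fin.sum_univ_four, Matrix.trace, Matrix.mul_apply, Matrix.diag_apply]
  simp [-mul_eq_mul_left_iff, -mul_eq_mul_right_iff]
  ring

end FlecnodalInvariant

section Flecnodal

variable {K A : Type*} [CommRing K] [CommRing A] [Algebra K A]

/-- The Hessian matrix of `f` at `P`. -/
noncomputable def hessMatrix (f : MvPolynomial (Fin 4) K) (P : Fin 4 → A) :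
    Matrix (Fin 4) (Fin 4) A :=
  Matrix.of fun i j => aeval P (pderiv i (pderiv j f))

/-- The matrices of third derivatives of `f` at `P`. -/
noncomputable def thirdMatrix (f : MvPolynomial (Fin 4) K) (P : Fin 4 → A) (a : Fin 4) :
    Matrix (Fin 4) (Fin 4) A :=
  Matrix.of fun i j => aeval P (pderiv a (pderiv i (pderiv j f)))

/-- The flecnodal polynomial of `f`. -/
noncomputable def flecnodal (f : MvPolynomial (Fin 4) K) : MvPolynomial (Fin 4) K :=
  flecInvariant (hessMatrix f X) (thirdMatrix f X)

lemma aeval_flecnodal (f : MvPolynomial (Fin 4) K) (P : Fin 4 → A) :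
    aeval P (flecnodal f) = flecInvariant (hessMatrix f P) (thirdMatrix f P) := by
  have hh : (hessMatrix f X).adjugate.map (aeval P : MvPolynomial (Fin 4) K →ₐ[K] A) =
      (hessMatrix f P).adjugate := by
    refine (AlgHom.map_adjugate (aeval P : MvPolynomial (Fin 4) K →ₐ[K] A) _).trans ?_
    congr 1
    ext i j
    simp [hessMatrix]
  have hU : ∀ i j, aeval P ((hessMatrix f (X : Fin 4 → MvPolynomial (Fin 4) K)).adjugate i j) =
      (hessMatrix f P).adjugate i j :=
    fun i j => by rw [← hh]; rfl
  have hT : ∀ a i j, aeval P (thirdMatrix f (X : Fin 4 → MvPolynomial (Fin 4) K) a i j) =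
      thirdMatrix f P a i j := fun a i j => by
    simp [thirdMatrix, aeval_X_left_apply]
  simp only [flecnodal, flecInvariant, map_sub, map_mul, map_sum, hU, hT, map_ofNat,
    Matrix.trace, Matrix.mul_apply, Matrix.diag_apply]

lemma isHomogeneous_det {n c : ℕ} (M : Matrix (Fin n) (Fin n) (MvPolynomial (Fin 4) K))
    (hM : ∀ i j, (M i j).IsHomogeneous c) : M.det.IsHomogeneous (n * c) := by
  rw [Matrix.det_apply]
  refine IsHomogeneous.sum _ _ _ fun σ _ => ?_
  have h : (∏ i, M (σ i) i).IsHomogeneous (∑ _i : Fin n, c) :=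
    IsHomogeneous.prod _ _ _ fun i _ => hM _ _
  simp only [Finset.sum_const, Finset.card_univ, Fintype.card_fin, smul_eq_mul] at h
  rcases Int.units_eq_one_or (Equiv.Perm.sign σ) with hs | hs <;> rw [hs]
  · simpa using h
  · simpa using h.neg

lemma flecnodal_isHomogeneous {f : MvPolynomial (Fin 4) K} {d : ℕ} (hd : 3 ≤ d)
    (hf : f.IsHomogeneous d) : (flecnodal f).IsHomogeneous (11 * d - 24) := by
  have hh : ∀ i j, (hessMatrix f (X : Fin 4 → MvPolynomial (Fin 4) K) i j).IsHomogeneous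
      (d - 2) := fun i j => by
    have h := (hf.pderiv (i := j)).pderiv (i := i)
    simpa [hessMatrix, Nat.sub_sub] using h
  have hU : ∀ i j, ((hessMatrix f (X : Fin 4 → MvPolynomial (Fin 4) K)).adjugate i j).IsHomogeneous
      (3 * (d - 2)) := fun i j => by
    rw [Matrix.adjugate_fin_succ_eq_det_submatrix]
    have h := isHomogeneous_det
      ((hessMatrix f (X : Fin 4 → MvPolynomial (Fin 4) K)).submatrix j.succAbove i.succAbove)
      (fun _ _ => hh _ _)
    rcases neg_one_pow_eq_or (MvPolynomial (Fin 4) K) (j + i : ℕ) with hs | hs <;> rw [hs]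
    · simpa using h
    · simpa using h.neg
  have hT : ∀ a i j, (thirdMatrix f (X : Fin 4 → MvPolynomial (Fin 4) K) a i j).IsHomogeneous
      (d - 3) := fun a i j => by
    have h := ((hf.pderiv (i := j)).pderiv (i := i)).pderiv (i := a)
    simpa [thirdMatrix, Nat.sub_sub] using h
  have hTU : ∀ a i j, ((thirdMatrix f (X : Fin 4 → MvPolynomial (Fin 4) K) a *
      (hessMatrix f (X : Fin 4 → MvPolynomial (Fin 4) K)).adjugate) i j).IsHomogeneous
      (d - 3 + 3 * (d - 2)) := fun a i j => by
    rw [Matrix.mul_apply]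
    exact IsHomogeneous.sum _ _ _ fun k _ => (hT _ _ _).mul (hU _ _)
  have htr1 : ∀ a, ((thirdMatrix f (X : Fin 4 → MvPolynomial (Fin 4) K) a *
      (hessMatrix f (X : Fin 4 → MvPolynomial (Fin 4) K)).adjugate).trace).IsHomogeneous
      (d - 3 + 3 * (d - 2)) := fun a => IsHomogeneous.sum _ _ _ fun k _ => hTU _ _ _
  have htr2 : ∀ a b, ((thirdMatrix f (X : Fin 4 → MvPolynomial (Fin 4) K) a *
      (hessMatrix f (X : Fin 4 → MvPolynomial (Fin 4) K)).adjugate *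
      (thirdMatrix f (X : Fin 4 → MvPolynomial (Fin 4) K) b *
      (hessMatrix f (X : Fin 4 → MvPolynomial (Fin 4) K)).adjugate)).trace).IsHomogeneous
      (d - 3 + 3 * (d - 2) + (d - 3 + 3 * (d - 2))) := fun a b =>
    IsHomogeneous.sum _ _ _ fun k _ => by
      rw [Matrix.diag_apply, Matrix.mul_apply]
      exact IsHomogeneous.sum _ _ _ fun k _ => (hTU _ _ _).mul (hTU _ _ _)
  have hdeg : 11 * d - 24 = 0 + (3 * (d - 2) + (d - 3 + 3 * (d - 2) + (d - 3 + 3 * (d - 2)))) := by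
    omega
  rw [hdeg, flecnodal, flecInvariant]
  refine IsHomogeneous.sub (IsHomogeneous.mul (isHomogeneous_C _ (4 : K)) ?_)
    (IsHomogeneous.mul (isHomogeneous_C _ (3 : K)) ?_)
  · exact IsHomogeneous.sum _ _ _ fun i _ => IsHomogeneous.sum _ _ _ fun l _ =>
      (hU _ _).mul (htr2 _ _)
  · exact IsHomogeneous.sum _ _ _ fun i _ => IsHomogeneous.sum _ _ _ fun l _ =>
      (hU _ _).mul ((htr1 _).mul (htr1 _))

/-- The matrix with columns `P`, `u`, `v`, `n`. -/
def frameMatrix (P u v n : Fin 4 → A) : Matrix (Fin 4) (Fin 4) A :=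
  Matrix.of fun i j => ![P, u, v, n] j i

variable {f : MvPolynomial (Fin 4) K} {P u v n : Fin 4 → A} {d : ℕ}

lemma hessMatrix_congruence (B : Matrix (Fin 4) (Fin 4) A) :
    B.transpose * hessMatrix f P * B =
      Matrix.of fun i j => dir2 f P (fun a => B a i) (fun a => B a j) := by
  ext i j
  simp only [Matrix.mul_apply, Matrix.transpose_apply, hessMatrix, Matrix.of_apply, dir2, dir1,
    Fin.sum_univ_four]
  rw [pderiv_swap _ 1 0, pderiv_swap _ 2 0, pderiv_swap _ 3 0, pderiv_swap _ 2 1, pderiv_swap _ 3 1,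
    pderiv_swap _ 3 2]
  ring

lemma thirdMatrix_congruence (B : Matrix (Fin 4) (Fin 4) A) (i : Fin 4) :
    ∑ a, B a i • (B.transpose * thirdMatrix f P a * B) =
      Matrix.of fun j k => dir3 f P (fun a => B a i) (fun a => B a j) (fun a => B a k) := by
  have h : ∀ a, B.transpose * thirdMatrix f P a * B =
      Matrix.of fun j k => dir2 (pderiv a f) P (fun a => B a j) (fun a => B a k) := fun a => by
    rw [← hessMatrix_congruence]
    congr 2
    ext i j
    simp only [thirdMatrix, hessMatrix, Matrix.of_apply]
    rw [pderiv_swap _ a i, pderiv_swap _ a j]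
  simp only [h]
  ext j k
  simp [dir3, Matrix.sum_apply]

lemma null_frame (hf : f.IsHomogeneous d) (h0 : aeval P f = 0)
    (hu : dir1 f P u = 0) (hv : dir1 f P v = 0) (huu : dir2 f P u u = 0) (hvv : dir2 f P v v = 0) :
    (frameMatrix P u v n).det ^ 6 * aeval P (flecnodal f) =
      8 * dir2 f P u v ^ 3 * dir2 f P P n ^ 6 * dir3 f P u u u * dir3 f P v v v ∧
    (frameMatrix P u v n).det ^ 2 * (hessMatrix f P).det =
      dir2 f P u v ^ 2 * dir2 f P P n ^ 2 := by
  have hPP : dir2 f P P P = 0 := by rw [dir2_self _ _ hf, dir1_self _ hf, h0]; simp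
  have hPu : dir2 f P P u = 0 := by rw [dir2_self _ _ hf, hu, mul_zero]
  have hPv : dir2 f P P v = 0 := by rw [dir2_self _ _ hf, hv, mul_zero]
  have huP := hPu; rw [dir2_comm] at huP
  have hvP := hPv; rw [dir2_comm] at hvP
  have hB : ∀ i, (fun a => frameMatrix P u v n a i) = ![P, u, v, n] i := fun i => rfl
  have hh : (frameMatrix P u v n).transpose * hessMatrix f P * frameMatrix P u v n =
      !![0, 0, 0, dir2 f P P n; 0, 0, dir2 f P u v, dir2 f P u n;
        0, dir2 f P u v, 0, dir2 f P v n;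
        dir2 f P P n, dir2 f P u n, dir2 f P v n, dir2 f P n n] := by
    rw [hessMatrix_congruence]
    simp only [hB]
    ext i j
    fin_cases i <;> fin_cases j <;>
      simp [hPP, hPu, hPv, huP, hvP, huu, hvv, dir2_comm f P n, dir2_comm f P v u]
  constructor
  · rw [aeval_flecnodal, ← flecInvariant_congruence, hh,
      ← flecInvariant_null_frame _ _ (dir2 f P u n) (dir2 f P v n) (dir2 f P n n) ((d - 2 : ℕ) : A)
        _ (dir3 f P u u v) (dir3 f P u u n) (dir3 f P u v v) (dir3 f P u v n) (dir3 f P u n n)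
        _ (dir3 f P v v n) (dir3 f P v n n) (dir3 f P n n n)]
    congr 1
    funext i
    rw [thirdMatrix_congruence]
    simp only [hB]
    ext j k
    have t1 : ∀ x y, dir3 f P x P y = dir3 f P P x y := fun x y => dir3_comm_left ..
    have t2 : ∀ x y, dir3 f P x y P = dir3 f P P x y := fun x y => by
      rw [dir3_comm_right, t1]
    fin_cases i <;> fin_cases j <;> fin_cases k <;>
      simp [t1, t2, dir3_self _ _ _ hf, hPP, hPu, hPv, huP, hvP, huu, hvv,
        dir2_comm f P n, dir2_comm f P v u, dir3_comm_left f P v u, dir3_comm_left f P n u,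
        dir3_comm_left f P n v, dir3_comm_right f P _ n, dir3_comm_right f P _ v u]
  · have := congrArg Matrix.det hh
    rw [Matrix.det_mul, Matrix.det_mul, Matrix.det_transpose] at this
    rw [show (frameMatrix P u v n).det ^ 2 * (hessMatrix f P).det =
      (frameMatrix P u v n).det * (hessMatrix f P).det * (frameMatrix P u v n).det by ring, this]
    simp [Matrix.det_succ_row_zero, Fin.sum_univ_succ, Fin.succAbove]
    ring

end Flecnodal

section Lines

variable {K : Type*} [Field K]

/-- The generic point `e₀ + s e₁` of a line. -/
noncomputable def linePoint (e₀ e₁ : Fin 4 → K) : Fin 4 → Polynomial K :=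
  fun i => Polynomial.C (e₀ i) + Polynomial.X * Polynomial.C (e₁ i)

/-- A vector over `K`, seen as a vector over `K[X]`. -/
noncomputable def constVec (v : Fin 4 → K) : Fin 4 → Polynomial K :=
  fun i => Polynomial.C (v i)

lemma aeval_linePoint (e₀ e₁ : Fin 4 → K) (s : K) :
    (fun i => Polynomial.aeval s (linePoint e₀ e₁ i)) = e₀ + s • e₁ := by
  funext i; simp [linePoint, mul_comm s]

lemma aeval_constVec (v : Fin 4 → K) (s : K) :
    (fun i => Polynomial.aeval s (constVec v i)) = v := by
  funext i; simp [constVec]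

lemma derivative_linePoint (e₀ e₁ : Fin 4 → K) :
    (fun i => Polynomial.derivative' (R := K) (linePoint e₀ e₁ i)) = constVec e₁ := by
  funext i; simp [linePoint, constVec, Polynomial.derivative']

lemma derivative_constVec (v : Fin 4 → K) :
    (fun i => Polynomial.derivative' (R := K) (constVec v i)) = 0 := by
  funext i; simp [constVec, Polynomial.derivative']

/-- A line on a smooth surface of degree `d`, spanned by `e₀` and `e₁`, together with two vectors
spanning a complement. -/
structure IsLineFrame (f : MvPolynomial (Fin 4) K) (d : ℕ) (e₀ e₁ w₂ w₃ : Fin 4 → K) : Prop where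
  three_le : 3 ≤ d
  natCast_ne_zero : ∀ k : ℕ, 0 < k → k ≤ d → (k : K) ≠ 0
  smooth : IsSmoothSurfaceOfDegree f d
  indep : LinearIndependent K ![e₀, e₁, w₂, w₃]
  vanish : ∀ x y : K, aeval (x • e₀ + y • e₁) f = 0

section General

variable {A : Type*} [CommRing A] [Algebra K A]

/-- The vector `β w₂ - α w₃` tangent to the surface, where `α`, `β` are the derivatives of `f`
in the directions `w₂`, `w₃`. -/
noncomputable def tangentVec (f : MvPolynomial (Fin 4) K) (P w₂ w₃ : Fin 4 → A) : Fin 4 → A :=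
  dir1 f P w₃ • w₂ + (-dir1 f P w₂) • w₃

lemma dir1_tangentVec (f : MvPolynomial (Fin 4) K) (P w₂ w₃ : Fin 4 → A) :
    dir1 f P (tangentVec f P w₂ w₃) = 0 := by
  rw [tangentVec, dir1_add, dir1_smul, dir1_smul]; ring

/-- Up to a factor, the third derivative of `f` in the direction of the second asymptotic
tangent, where `u` spans the first one and `l` is another tangent vector. -/
noncomputable def inflection (f : MvPolynomial (Fin 4) K) (P u l : Fin 4 → A) : A :=
  4 * dir2 f P u l ^ 2 * dir3 f P l l l - 6 * dir2 f P u l * dir2 f P l l * dir3 f P u l l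
    + 3 * dir2 f P l l ^ 2 * dir3 f P u u l

/-- A vector spanning the second asymptotic tangent. -/
noncomputable def asymptoticVec (f : MvPolynomial (Fin 4) K) (P u l : Fin 4 → A) : Fin 4 → A :=
  (2 * dir2 f P u l) • l + (-dir2 f P l l) • u

variable {f : MvPolynomial (Fin 4) K} {P u l : Fin 4 → A}

lemma dir1_asymptoticVec (hu : dir1 f P u = 0) (hl : dir1 f P l = 0) :
    dir1 f P (asymptoticVec f P u l) = 0 := by
  rw [asymptoticVec, dir1_add, dir1_smul, dir1_smul, hu, hl]; ring

lemma dir2_asymptoticVec (huu : dir2 f P u u = 0) :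
    dir2 f P u (asymptoticVec f P u l) = 2 * dir2 f P u l ^ 2 := by
  rw [asymptoticVec, dir2_add_right, dir2_smul_right, dir2_smul_right, huu]; ring

lemma dir2_asymptoticVec_self (huu : dir2 f P u u = 0) :
    dir2 f P (asymptoticVec f P u l) (asymptoticVec f P u l) = 0 := by
  simp only [asymptoticVec, dir2_add_right, dir2_smul_right, dir2_add_left, dir2_smul_left, huu,
    dir2_comm f P l u]
  ring

lemma dir3_asymptoticVec (huuu : dir3 f P u u u = 0) :
    dir3 f P (asymptoticVec f P u l) (asymptoticVec f P u l) (asymptoticVec f P u l) =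
      2 * dir2 f P u l * inflection f P u l := by
  simp only [asymptoticVec, dir3_add_right, dir3_smul_right, dir3_add_mid, dir3_smul_mid,
    dir3_add_left, dir3_smul_left, dir3_comm_left f P l u, dir3_comm_right f P _ l u, huuu,
    inflection]
  ring

end General

lemma exists_dir1_ne_zero {f : MvPolynomial (Fin 4) K} {d : ℕ} (hf : IsSmoothSurfaceOfDegree f d)
    {P : Fin 4 → K} (hP : P ≠ 0) : ∃ v : Fin 4 → K, dir1 f P v ≠ 0 := by
  obtain ⟨i, hi⟩ := hf.2 P hP
  refine ⟨Pi.single i 1, ?_⟩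
  rw [dir1, Finset.sum_eq_single i]
  · simpa [aeval_eq_eval] using hi
  · intro j _ hj; simp [hj]
  · simp

lemma exists_coords_of_indep {e₀ e₁ w₂ w₃ : Fin 4 → K}
    (h : LinearIndependent K ![e₀, e₁, w₂, w₃]) (v : Fin 4 → K) :
    ∃ a b c d : K, v = a • e₀ + b • e₁ + c • w₂ + d • w₃ := by
  let B := basisOfLinearIndependentOfCardEqFinrank h (by simp)
  refine ⟨B.repr v 0, B.repr v 1, B.repr v 2, B.repr v 3, ?_⟩
  have := B.sum_repr v
  rw [Fin.sum_univ_four] at this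
  simpa [B] using this.symm

namespace IsLineFrame

variable {f : MvPolynomial (Fin 4) K} {d : ℕ} {e₀ e₁ w₂ w₃ : Fin 4 → K}

lemma point_ne_zero (h : IsLineFrame f d e₀ e₁ w₂ w₃) (s : K) : e₀ + s • e₁ ≠ 0 := by
  intro h0
  have := Fintype.linearIndependent_iff.1 h.indep ![1, s, 0, 0]
    (by simp [Fin.sum_univ_four, h0]) 0
  simp at this

lemma right_ne_zero (h : IsLineFrame f d e₀ e₁ w₂ w₃) : e₁ ≠ 0 := by
  have := h.indep.ne_zero 1
  simpa using this

lemma dir2_e₁_constVec (e₀ e₁ v : Fin 4 → K) :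
    dir2 f (linePoint e₀ e₁) (constVec e₁) (constVec v) =
      Polynomial.derivative (dir1 f (linePoint e₀ e₁) (constVec v)) := by
  have := derivation_dir1 (linePoint e₀ e₁) (constVec v) (Polynomial.derivative' (R := K)) f
  rw [derivative_linePoint, derivative_constVec] at this
  rw [dir1_zero, add_zero] at this
  exact this.symm

lemma dir3_e₁_constVec (e₀ e₁ v w : Fin 4 → K) :
    dir3 f (linePoint e₀ e₁) (constVec e₁) (constVec v) (constVec w) =
      Polynomial.derivative (dir2 f (linePoint e₀ e₁) (constVec v) (constVec w)) := by
  have := derivation_dir2 (linePoint e₀ e₁) (constVec v) (constVec w)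
    (Polynomial.derivative' (R := K)) f
  rw [derivative_linePoint, derivative_constVec] at this
  rw [derivative_constVec, dir2_zero_left, dir2_zero_right, add_zero, add_zero] at this
  exact this.symm

variable [IsAlgClosed K]

lemma aeval_linePoint_eq_zero (h : IsLineFrame f d e₀ e₁ w₂ w₃) :
    aeval (linePoint e₀ e₁) f = 0 := by
  refine Polynomial.funext fun s => ?_
  rw [← Polynomial.coe_aeval_eq_eval, map_aeval_point, aeval_linePoint]
  simpa using h.vanish 1 s

lemma dir1_e₁ (h : IsLineFrame f d e₀ e₁ w₂ w₃) :
    dir1 f (linePoint e₀ e₁) (constVec e₁) = 0 := by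
  have := derivation_aeval' (linePoint e₀ e₁) (Polynomial.derivative' (R := K)) f
  rw [h.aeval_linePoint_eq_zero, map_zero, derivative_linePoint] at this
  exact this.symm

lemma dir1_linePoint (h : IsLineFrame f d e₀ e₁ w₂ w₃) :
    dir1 f (linePoint e₀ e₁) (linePoint e₀ e₁) = 0 := by
  rw [dir1_self _ h.smooth.1, h.aeval_linePoint_eq_zero, mul_zero]

lemma dir2_e₁ (h : IsLineFrame f d e₀ e₁ w₂ w₃) :
    dir2 f (linePoint e₀ e₁) (constVec e₁) (constVec e₁) = 0 := by
  have := derivation_dir1 (linePoint e₀ e₁) (constVec e₁) (Polynomial.derivative' (R := K)) f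
  rw [h.dir1_e₁, map_zero, derivative_linePoint, derivative_constVec] at this
  simpa [dir1] using this.symm

lemma dir3_e₁ (h : IsLineFrame f d e₀ e₁ w₂ w₃) :
    dir3 f (linePoint e₀ e₁) (constVec e₁) (constVec e₁) (constVec e₁) = 0 := by
  have := derivation_dir2 (linePoint e₀ e₁) (constVec e₁) (constVec e₁)
    (Polynomial.derivative' (R := K)) f
  rw [h.dir2_e₁, map_zero, derivative_linePoint, derivative_constVec] at this
  simpa [dir1, dir2] using this.symm

/-- No point of the line is singular. -/
lemma dir1_ne_zero_or (h : IsLineFrame f d e₀ e₁ w₂ w₃) (s : K) :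
    dir1 f (e₀ + s • e₁) w₂ ≠ 0 ∨ dir1 f (e₀ + s • e₁) w₃ ≠ 0 := by
  by_contra! hc
  obtain ⟨v, hv⟩ := exists_dir1_ne_zero h.smooth (h.point_ne_zero s)
  obtain ⟨a, b, c, c', hv'⟩ := exists_coords_of_indep h.indep v
  have h1 := congrArg (Polynomial.aeval s) h.dir1_e₁
  rw [map_dir1, aeval_linePoint, aeval_constVec, map_zero] at h1
  have h0 := congrArg (Polynomial.aeval s) h.dir1_linePoint
  rw [map_dir1, aeval_linePoint, map_zero, dir1_add, dir1_smul, h1, mul_zero, add_zero] at h0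
  apply hv
  simp [hv', dir1_add, dir1_smul, h0, h1, hc.1, hc.2]

end IsLineFrame
end Lines

section SquareZero

variable {K A : Type*} [CommRing K] [CommRing A] [Algebra K A] {ε : A}

lemma aeval_add_smul_of_sq_zero (hε : ε * ε = 0) (f : MvPolynomial (Fin 4) K) (P w : Fin 4 → A) :
    aeval (P + ε • w) f = aeval P f + ε * dir1 f P w := by
  induction f using MvPolynomial.induction_on with
  | C a => simp [dir1]
  | add p q hp hq =>
    simp only [map_add, hp, hq, dir1, mul_add, Finset.sum_add_distrib]; ring
  | mul_X p i hp =>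
    have : dir1 (p * X i) P w = w i * aeval P p + P i * dir1 p P w := by
      simp only [dir1, Derivation.leibniz, pderiv_X, smul_eq_mul, map_add, map_mul, aeval_X,
        mul_add, Finset.sum_add_distrib, Finset.mul_sum]
      congr 1
      · rw [Finset.sum_eq_single i]
        · simp
        · intro j _ hj; simp [hj.symm]
        · simp
      · exact Finset.sum_congr rfl fun j _ => by ring
    rw [map_mul, map_mul, hp, this, aeval_X, aeval_X, Pi.add_apply, Pi.smul_apply, smul_eq_mul]
    linear_combination dir1 p P w * w i * hε

lemma dir1_add_smul_point_of_sq_zero (hε : ε * ε = 0) (f : MvPolynomial (Fin 4) K)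
    (P w u : Fin 4 → A) : dir1 f (P + ε • w) u = dir1 f P u + ε * dir2 f P w u := by
  rw [dir2_comm]
  simp only [dir1, dir2, aeval_add_smul_of_sq_zero hε, mul_add, Finset.sum_add_distrib,
    Finset.mul_sum]
  congr 1
  exact Finset.sum_congr rfl fun j _ => Finset.sum_congr rfl fun j _ => by ring

lemma dir2_add_smul_point_of_sq_zero (hε : ε * ε = 0) (f : MvPolynomial (Fin 4) K)
    (P w u v : Fin 4 → A) : dir2 f (P + ε • w) u v = dir2 f P u v + ε * dir3 f P w u v := by
  rw [dir3_comm_left, dir2, dir2, dir3, Finset.mul_sum, ← Finset.sum_add_distrib]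
  refine Finset.sum_congr rfl fun j _ => ?_
  rw [dir1_add_smul_point_of_sq_zero hε]; ring

lemma dir1_add_smul_of_sq_zero (hε : ε * ε = 0) (f : MvPolynomial (Fin 4) K)
    (P w u u' : Fin 4 → A) : dir1 f (P + ε • w) (u + ε • u') =
      dir1 f P u + ε * (dir2 f P w u + dir1 f P u') := by
  rw [dir1_add_smul_point_of_sq_zero hε, dir1_add, dir1_smul, dir2_add_right, dir2_smul_right]
  linear_combination dir2 f P w u' * hε

lemma dir2_add_smul_of_sq_zero (hε : ε * ε = 0) (f : MvPolynomial (Fin 4) K)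
    (P w u u' : Fin 4 → A) : dir2 f (P + ε • w) (u + ε • u') (u + ε • u') =
      dir2 f P u u + ε * (dir3 f P w u u + 2 * dir2 f P u' u) := by
  rw [dir2_add_smul_point_of_sq_zero hε]
  simp only [dir2_add_right, dir2_add_left, dir2_smul_right, dir2_smul_left, dir3_add_right,
    dir3_smul_right, dir3_add_mid, dir3_smul_mid, dir2_comm f P u u']
  linear_combination (dir2 f P u' u' + dir3 f P w u' u + dir3 f P w u u' +
    ε * dir3 f P w u' u') * hε

lemma dir3_add_smul_of_sq_zero (hε : ε * ε = 0) (f : MvPolynomial (Fin 4) K)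
    (P w u u' : Fin 4 → A) : ∃ r, dir3 f (P + ε • w) (u + ε • u') (u + ε • u') (u + ε • u') =
      dir3 f P u u u + ε * r := by
  have h : ∀ x y z, dir3 f (P + ε • w) x y z =
      dir3 f P x y z + ε * (∑ i, x i * dir3 (pderiv i f) P w y z) := fun x y z => by
    rw [dir3, dir3, Finset.mul_sum, ← Finset.sum_add_distrib]
    refine Finset.sum_congr rfl fun j _ => ?_
    rw [dir2_add_smul_point_of_sq_zero hε]; ring
  rw [h]
  simp only [dir3_add_right, dir3_smul_right, dir3_add_mid, dir3_smul_mid, dir3_add_left,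
    dir3_smul_left]
  generalize (∑ x : Fin 4, _ : A) = S
  exact ⟨dir3 f P u' u u + (dir3 f P u u' u + ε * dir3 f P u' u' u) +
    (dir3 f P u u u' + ε * dir3 f P u' u u' + ε * (dir3 f P u u' u' + ε * dir3 f P u' u' u')) + S,
    by ring⟩

end SquareZero

section SecondKind

variable {K A : Type*} [CommRing K] [CommRing A] [IsDomain A] [Algebra K A]
  {f : MvPolynomial (Fin 4) K} {d : ℕ} {P u v n w : Fin 4 → A}

open TrivSqZeroExt in
/-- If both asymptotic tangents at `P` have contact of order four, then the flecnodal polynomial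
vanishes to second order at `P` on the surface. -/
lemma dir1_flecnodal_eq_zero (hf : f.IsHomogeneous d) (h0 : aeval P f = 0)
    (hu : dir1 f P u = 0) (hv : dir1 f P v = 0) (huu : dir2 f P u u = 0) (hvv : dir2 f P v v = 0)
    (huuu : dir3 f P u u u = 0) (hvvv : dir3 f P v v v = 0) (h2 : (2 : A) ≠ 0)
    (huv : dir2 f P u v ≠ 0) (hn : dir1 f P n ≠ 0) (hPn : dir2 f P P n ≠ 0)
    (hw : dir1 f P w = 0) : dir1 (flecnodal f) P w = 0 := by
  let ι : A →ₐ[K] DualNumber A := inlAlgHom K A A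
  let π : DualNumber A →ₐ[K] A := fstHom K A A
  let ε : DualNumber A := DualNumber.eps
  have hε : ε * ε = 0 := DualNumber.eps_mul_eps
  have hπι : ∀ a, π (ι a) = a := fun a => rfl
  have hπε : π ε = 0 := rfl
  let lift : (Fin 4 → A) → Fin 4 → DualNumber A := fun x i => ι (x i)
  have m1 : ∀ g : MvPolynomial (Fin 4) K, ∀ x y, dir1 g (lift x) (lift y) = ι (dir1 g x y) :=
    fun g x y => (map_dir1 x y ι g).symm
  have m2 : ∀ x y z, dir2 f (lift x) (lift y) (lift z) = ι (dir2 f x y z) :=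
    fun x y z => (map_dir2 x y z ι f).symm
  have m3 : ∀ x y z t, dir3 f (lift x) (lift y) (lift z) (lift t) = ι (dir3 f x y z t) :=
    fun x y z t => (map_dir3 x y z t ι f).symm
  have m0 : ∀ g : MvPolynomial (Fin 4) K, ∀ x, aeval (lift x) g = ι (aeval x g) :=
    fun g x => (map_aeval_point x ι g).symm
  set μ := dir2 f P u v with hμ
  set ν := dir1 f P n with hν
  -- lift the null frame to the dual numbers
  have key : ∀ a b : Fin 4 → A, dir1 f P a = 0 → dir1 f P b = 0 → dir2 f P a a = 0 →
      dir3 f P a a a = 0 → dir2 f P a b = μ → ∃ a' : Fin 4 → A,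
      dir1 f (lift P + ε • lift w) (lift ((2 * μ * ν) • a) + ε • lift a') = 0 ∧
      dir2 f (lift P + ε • lift w) (lift ((2 * μ * ν) • a) + ε • lift a')
        (lift ((2 * μ * ν) • a) + ε • lift a') = 0 ∧
      ∃ r, dir3 f (lift P + ε • lift w) (lift ((2 * μ * ν) • a) + ε • lift a')
        (lift ((2 * μ * ν) • a) + ε • lift a') (lift ((2 * μ * ν) • a) + ε • lift a') = ε * r := by
    intro a b ha hb haa haaa hab
    refine ⟨(-(2 * μ * dir2 f P w a)) • n +
      (-(dir3 f P w a a * ν) + 2 * dir2 f P w a * dir2 f P n a) • b, ?_, ?_, ?_⟩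
    · rw [dir1_add_smul_of_sq_zero hε, m1, m1, m2, dir1_smul, ha, dir1_add, dir1_smul, dir1_smul,
        hb, dir2_smul_right, ← map_add, ← hν]
      ring_nf
      simp
    · rw [dir2_add_smul_of_sq_zero hε, m2, m2, m3]
      simp only [dir2_smul_left, dir2_smul_right, dir3_smul_right, dir3_smul_mid, haa,
        dir2_add_left]
      rw [dir2_comm f P b a, hab, ← map_ofNat ι 2, ← map_mul, ← map_add]
      ring_nf
      simp
    · obtain ⟨r, hr⟩ := dir3_add_smul_of_sq_zero hε f (lift P) (lift w) (lift ((2 * μ * ν) • a))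
        (lift ((-(2 * μ * dir2 f P w a)) • n +
      (-(dir3 f P w a a * ν) + 2 * dir2 f P w a * dir2 f P n a) • b))
      refine ⟨r, ?_⟩
      rw [hr, m3]
      simp [dir3_smul_left, dir3_smul_right, dir3_smul_mid, haaa]
  obtain ⟨u', hu1, hu2, r, hu3⟩ := key u v hu hv huu huuu rfl
  obtain ⟨v', hv1, hv2, r', hv3⟩ := key v u hv hu hvv hvvv (dir2_comm ..)
  have hP0 : aeval (lift P + ε • lift w) f = 0 := by
    rw [aeval_add_smul_of_sq_zero hε, m0, m1, h0, hw]; simp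
  obtain ⟨n1, n2⟩ := null_frame (n := lift n) hf hP0 hu1 hv1 hu2 hv2
  rw [hu3, hv3] at n1
  set δ := (frameMatrix (lift P + ε • lift w) (lift ((2 * μ * ν) • u) + ε • lift u')
    (lift ((2 * μ * ν) • v) + ε • lift v') (lift n)).det with hδ
  have hπ : ∀ x y : Fin 4 → A, (fun i => π ((lift x + ε • lift y) i)) = x := fun x y => by
    funext i; simp [lift, hπι, hπε]
  have hπ' : ∀ x : Fin 4 → A, (fun i => π (lift x i)) = x := fun x => rfl
  have hδ0 : π δ ≠ 0 := by
    intro h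
    have := congrArg π n2
    rw [map_mul, map_pow, h, map_mul, map_pow, map_pow, map_dir2, map_dir2, hπ, hπ, hπ, hπ',
      dir2_smul_left, dir2_smul_right, ← hμ] at this
    simp [h2, huv, hn, hPn] at this
  rw [aeval_add_smul_of_sq_zero hε, m0, m1] at n1
  have n3 : δ ^ 6 * (ι (aeval P (flecnodal f)) + ε * ι (dir1 (flecnodal f) P w)) = 0 := by
    rw [n1]
    generalize dir2 f (lift P + ε • lift w) (lift P + ε • lift w) (lift n) = y
    generalize dir2 f (lift P + ε • lift w) _ _ = x
    linear_combination (8 * x ^ 3 * y ^ 6 * r * r') * hε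
  have h1 := congrArg π n3
  simp only [map_mul, map_pow, map_add, hπι, hπε, map_zero, zero_mul, add_zero] at h1
  have h2 : aeval P (flecnodal f) = 0 := by simpa [hδ0] using h1
  rw [h2, map_zero, zero_add] at n3
  have h3 := congrArg TrivSqZeroExt.snd n3
  have h4 : δ ^ 6 * (ε * ι (dir1 (flecnodal f) P w)) = ε * (δ ^ 6 * ι (dir1 (flecnodal f) P w)) :=
    by ring
  rw [h4] at h3
  have h5 : ∀ z : DualNumber A, (ε * z).snd = π z := fun z => by
    rw [DualNumber.snd_mul, DualNumber.fst_eps, DualNumber.snd_eps, zero_mul, zero_add, one_mul]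
    rfl
  rw [h5, map_mul, map_pow, hπι] at h3
  simpa [hδ0] using h3

end SecondKind

section DegreeBounds

variable {K : Type*} [Field K] {f : MvPolynomial (Fin 4) K} {d a b c : ℕ}
  {P u v w : Fin 4 → Polynomial K}

lemma natDegree_aeval_le_of_isHomogeneous (hf : f.IsHomogeneous d)
    (hP : ∀ i, (P i).natDegree ≤ 1) : (aeval P f).natDegree ≤ d := by
  have := MvPolynomial.aeval_natDegree_le f hf.totalDegree_le P hP
  simpa using this

lemma natDegree_dir1_le (hf : f.IsHomogeneous d) (hP : ∀ i, (P i).natDegree ≤ 1)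
    (hv : ∀ i, (v i).natDegree ≤ a) : (dir1 f P v).natDegree ≤ a + (d - 1) :=
  Polynomial.natDegree_sum_le_of_forall_le _ _ fun i _ =>
    Polynomial.natDegree_mul_le.trans
      (add_le_add (hv i) (natDegree_aeval_le_of_isHomogeneous hf.pderiv hP))

lemma natDegree_dir2_le (hf : f.IsHomogeneous d) (hP : ∀ i, (P i).natDegree ≤ 1)
    (hu : ∀ i, (u i).natDegree ≤ a) (hv : ∀ i, (v i).natDegree ≤ b) :
    (dir2 f P u v).natDegree ≤ a + b + (d - 2) := by
  rw [add_assoc]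
  exact Polynomial.natDegree_sum_le_of_forall_le _ _ fun i _ =>
    Polynomial.natDegree_mul_le.trans
      (add_le_add (hu i) (by simpa [Nat.sub_sub] using natDegree_dir1_le hf.pderiv hP hv))

lemma natDegree_dir3_le (hf : f.IsHomogeneous d) (hP : ∀ i, (P i).natDegree ≤ 1)
    (hu : ∀ i, (u i).natDegree ≤ a) (hv : ∀ i, (v i).natDegree ≤ b)
    (hw : ∀ i, (w i).natDegree ≤ c) :
    (dir3 f P u v w).natDegree ≤ a + b + c + (d - 3) := by
  rw [add_assoc, add_assoc, ← add_assoc b]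
  exact Polynomial.natDegree_sum_le_of_forall_le _ _ fun i _ =>
    Polynomial.natDegree_mul_le.trans
      (add_le_add (hu i) (by simpa [Nat.sub_sub] using natDegree_dir2_le hf.pderiv hP hv hw))

lemma natDegree_linePoint_le (e₀ e₁ : Fin 4 → K) (i : Fin 4) :
    (linePoint e₀ e₁ i).natDegree ≤ 1 := by
  unfold linePoint; compute_degree

lemma natDegree_constVec_le (v : Fin 4 → K) (i : Fin 4) : (constVec v i).natDegree ≤ 0 := by
  simp [constVec]

lemma natDegree_tangentVec_le (hf : f.IsHomogeneous d) (hP : ∀ i, (P i).natDegree ≤ 1)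
    (hu : ∀ i, (u i).natDegree ≤ 0) (hv : ∀ i, (v i).natDegree ≤ 0) (i : Fin 4) :
    (tangentVec f P u v i).natDegree ≤ d - 1 := by
  have h1 := natDegree_dir1_le hf hP hu
  have h2 := natDegree_dir1_le hf hP hv
  rw [zero_add] at h1 h2
  simp only [tangentVec, Pi.add_apply, Pi.smul_apply, smul_eq_mul]
  refine Polynomial.natDegree_add_le_of_degree_le ?_ ?_
  · exact Polynomial.natDegree_mul_le.trans ((add_le_add h2 (hu i)).trans (by simp))
  · refine Polynomial.natDegree_mul_le.trans ?_
    rw [Polynomial.natDegree_neg]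
    exact (add_le_add h1 (hv i)).trans (by simp)

end DegreeBounds

section Extension

variable {K : Type*} [Field K] [IsAlgClosed K] {q : MvPolynomial (Fin 4) K} {m : ℕ}

/-- If a form restricts to a constant on the affine part of a line and has positive degree, or
to zero, then it vanishes at the point at infinity. -/
lemma aeval_eq_zero_of_aeval_linePoint_eq_C (hq : q.IsHomogeneous m) {e₀ e₁ : Fin 4 → K} {c : K}
    (hm : m = 0 → c = 0)
    (h : aeval (linePoint e₀ e₁) q = Polynomial.C c) : aeval e₁ q = 0 := by
  have key : Polynomial.X * (aeval (linePoint e₁ e₀) q - Polynomial.C c * Polynomial.X ^ m) =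
      0 := by
    refine Polynomial.funext fun s => ?_
    rw [Polynomial.eval_mul, Polynomial.eval_X, Polynomial.eval_zero]
    rcases eq_or_ne s 0 with rfl | hs
    · simp
    · have h1 := congrArg (Polynomial.aeval s⁻¹) h
      rw [map_aeval_point, aeval_linePoint] at h1
      have h2 : e₁ + s • e₀ = s • (e₀ + s⁻¹ • e₁) := by
        rw [smul_add, smul_smul, mul_inv_cancel₀ hs, one_smul, add_comm]
      rw [Polynomial.eval_sub, ← Polynomial.coe_aeval_eq_eval, map_aeval_point, aeval_linePoint,
        h2, aeval_smul_of_isHomogeneous _ _ hq, h1]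
      simp only [Polynomial.aeval_C, Algebra.algebraMap_self, RingHom.id_apply, map_mul,
        map_pow, Polynomial.aeval_X]
      ring
  have h1 := (mul_eq_zero.1 key).resolve_left Polynomial.X_ne_zero
  have h2 := congrArg (Polynomial.aeval (0 : K)) (sub_eq_zero.1 h1)
  rw [map_aeval_point, aeval_linePoint, zero_smul, add_zero] at h2
  rw [h2]
  rcases Nat.eq_zero_or_pos m with rfl | hm'
  · simp [hm rfl]
  · simp [hm'.ne']

lemma aeval_eq_zero_of_aeval_linePoint_eq_zero (hq : q.IsHomogeneous m) {e₀ e₁ : Fin 4 → K}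
    (h : aeval (linePoint e₀ e₁) q = 0) (x y : K) : aeval (x • e₀ + y • e₁) q = 0 := by
  rcases eq_or_ne x 0 with rfl | hx
  · rw [zero_smul, zero_add, aeval_smul_of_isHomogeneous _ _ hq,
      aeval_eq_zero_of_aeval_linePoint_eq_C (c := 0) hq (fun _ => rfl) (by simpa using h), mul_zero]
  · have h2 : x • e₀ + y • e₁ = x • (e₀ + (x⁻¹ * y) • e₁) := by
      rw [smul_add, smul_smul, ← mul_assoc, mul_inv_cancel₀ hx, one_mul]
    have h1 := congrArg (Polynomial.aeval (x⁻¹ * y)) h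
    rw [map_aeval_point, aeval_linePoint, map_zero] at h1
    rw [h2, aeval_smul_of_isHomogeneous _ _ hq, h1, mul_zero]

end Extension

namespace IsLineFrame

variable {K : Type*} [Field K] [IsAlgClosed K] {f : MvPolynomial (Fin 4) K} {d : ℕ}
  {e₀ e₁ w₂ w₃ : Fin 4 → K}

lemma swap (h : IsLineFrame f d e₀ e₁ w₂ w₃) : IsLineFrame f d e₁ e₀ w₂ w₃ where
  three_le := h.three_le
  natCast_ne_zero := h.natCast_ne_zero
  smooth := h.smooth
  indep := by
    have : ![e₁, e₀, w₂, w₃] = ![e₀, e₁, w₂, w₃] ∘ Equiv.swap (0 : Fin 4) 1 := by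
      funext i; fin_cases i <;> rfl
    rw [this]
    exact h.indep.comp _ (Equiv.injective _)
  vanish x y := by rw [add_comm]; exact h.vanish y x

lemma two_ne_zero (h : IsLineFrame f d e₀ e₁ w₂ w₃) : (2 : K) ≠ 0 := by
  have := h.natCast_ne_zero 2 (by norm_num) (by have := h.three_le; omega)
  exact_mod_cast this

/-- The two normal derivatives of `f` along a line are coprime. -/
lemma isCoprime (h : IsLineFrame f d e₀ e₁ w₂ w₃) :
    IsCoprime (dir1 f (linePoint e₀ e₁) (constVec w₂))
      (dir1 f (linePoint e₀ e₁) (constVec w₃)) := by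
  rw [Polynomial.isCoprime_iff_aeval_ne_zero_of_isAlgClosed K K]
  intro s
  rw [map_dir1, map_dir1, aeval_linePoint, aeval_constVec, aeval_constVec]
  exact h.dir1_ne_zero_or s

lemma eq_C_of_derivative_eq_zero (h : IsLineFrame f d e₀ e₁ w₂ w₃) {p : Polynomial K}
    (hp : p.natDegree ≤ d) (hp' : Polynomial.derivative p = 0) : p = Polynomial.C (p.coeff 0) := by
  ext k
  rw [Polynomial.coeff_C]
  split_ifs with hk
  · rw [hk]
  · by_cases hkd : k ≤ d
    · have h1 := congrArg (fun q => q.coeff (k - 1)) hp'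
      simp only [Polynomial.coeff_derivative, Polynomial.coeff_zero] at h1
      rw [Nat.sub_add_cancel (Nat.pos_of_ne_zero hk)] at h1
      have h2 := h.natCast_ne_zero k (Nat.pos_of_ne_zero hk) hkd
      have h3 : ((k - 1 : ℕ) : K) + 1 = (k : K) := by
        exact_mod_cast congrArg (Nat.cast (R := K)) (Nat.sub_add_cancel (Nat.pos_of_ne_zero hk))
      rw [h3] at h1
      exact (mul_eq_zero.1 h1).resolve_right h2
    · exact Polynomial.coeff_eq_zero_of_natDegree_lt (by omega)

lemma dir1_eq_zero_of_derivative_eq_zero (h : IsLineFrame f d e₀ e₁ w₂ w₃) (w : Fin 4 → K)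
    (hw : Polynomial.derivative (dir1 f (linePoint e₀ e₁) (constVec w)) = 0) :
    dir1 f e₁ w = 0 := by
  have h1 := natDegree_dir1_le h.smooth.1 (natDegree_linePoint_le e₀ e₁) (natDegree_constVec_le w)
  have h2 := h.eq_C_of_derivative_eq_zero (by omega) hw
  let q : MvPolynomial (Fin 4) K := ∑ i, C (w i) * pderiv i f
  have hq : q.IsHomogeneous (d - 1) := by
    refine IsHomogeneous.sum _ _ _ fun i _ => ?_
    simpa using (isHomogeneous_C (Fin 4) (w i)).mul (h.smooth.1.pderiv (i := i))
  have hq1 : ∀ (P : Fin 4 → K), aeval P q = dir1 f P w := fun P => by simp [q, dir1]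
  have hq2 : aeval (linePoint e₀ e₁) q = dir1 f (linePoint e₀ e₁) (constVec w) := by
    simp [q, dir1, constVec, Polynomial.algebraMap_eq]
  rw [← hq1]
  have := h.three_le
  exact aeval_eq_zero_of_aeval_linePoint_eq_C hq (fun _ => by omega) (hq2.trans h2)

lemma dir2_e₁_tangentVec :
    dir2 f (linePoint e₀ e₁) (constVec e₁)
      (tangentVec f (linePoint e₀ e₁) (constVec w₂) (constVec w₃)) =
    dir1 f (linePoint e₀ e₁) (constVec w₃) *
      Polynomial.derivative (dir1 f (linePoint e₀ e₁) (constVec w₂)) -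
    dir1 f (linePoint e₀ e₁) (constVec w₂) *
      Polynomial.derivative (dir1 f (linePoint e₀ e₁) (constVec w₃)) := by
  rw [tangentVec, dir2_add_right, dir2_smul_right, dir2_smul_right, dir2_e₁_constVec,
    dir2_e₁_constVec]
  ring

/-- The Gauss map is not constant along a line. -/
lemma dir2_e₁_tangentVec_ne_zero (h : IsLineFrame f d e₀ e₁ w₂ w₃) :
    dir2 f (linePoint e₀ e₁) (constVec e₁)
      (tangentVec f (linePoint e₀ e₁) (constVec w₂) (constVec w₃)) ≠ 0 := by
  rw [dir2_e₁_tangentVec]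
  intro h0
  have hc := h.isCoprime
  have aux : ∀ p q : Polynomial K, IsCoprime p q →
      q * Polynomial.derivative p - p * Polynomial.derivative q = 0 →
      Polynomial.derivative p = 0 := by
    intro p q hpq hz
    have hd : p ∣ Polynomial.derivative p :=
      hpq.dvd_of_dvd_mul_left ⟨_, sub_eq_zero.1 hz⟩
    rcases eq_or_ne p 0 with rfl | hp
    · simp
    · exact Polynomial.eq_zero_of_dvd_of_degree_lt hd (Polynomial.degree_derivative_lt hp)
  have h1 := aux _ _ hc h0
  have h2 := aux _ _ hc.symm (by linear_combination -h0)
  have h3 := h.swap.dir1_ne_zero_or 0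
  rw [zero_smul, add_zero] at h3
  exact h3.elim (fun h3 => h3 (h.dir1_eq_zero_of_derivative_eq_zero _ h1))
    (fun h3 => h3 (h.dir1_eq_zero_of_derivative_eq_zero _ h2))

lemma natCast_polynomial_ne_zero (h : IsLineFrame f d e₀ e₁ w₂ w₃) {k : ℕ} (h0 : 0 < k)
    (hk : k ≤ d) : (k : Polynomial K) ≠ 0 := by
  rw [← Polynomial.C_eq_natCast, Ne, Polynomial.C_eq_zero]
  exact h.natCast_ne_zero k h0 hk

/-- A vector along which the derivative of `f` does not vanish on the line. -/
lemma exists_normal (h : IsLineFrame f d e₀ e₁ w₂ w₃) : ∃ n : Fin 4 → Polynomial K,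
    dir1 f (linePoint e₀ e₁) n ≠ 0 ∧ dir2 f (linePoint e₀ e₁) (linePoint e₀ e₁) n ≠ 0 := by
  have : ∃ n : Fin 4 → Polynomial K, dir1 f (linePoint e₀ e₁) n ≠ 0 := by
    by_contra! hc
    have h0 := h.isCoprime
    rw [hc, hc] at h0
    exact not_isCoprime_zero_zero h0
  obtain ⟨n, hn⟩ := this
  refine ⟨n, hn, ?_⟩
  rw [dir2_self _ _ h.smooth.1]
  have := h.three_le
  exact mul_ne_zero (h.natCast_polynomial_ne_zero (by omega) (by omega)) hn

lemma frame_identities (h : IsLineFrame f d e₀ e₁ w₂ w₃) :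
    aeval (linePoint e₀ e₁) (flecnodal f) = 0 ∧ (hessMatrix f (linePoint e₀ e₁)).det ≠ 0 := by
  obtain ⟨n, hn, hPn⟩ := h.exists_normal
  set l := tangentVec f (linePoint e₀ e₁) (constVec w₂) (constVec w₃) with hl
  have hκ := h.dir2_e₁_tangentVec_ne_zero
  rw [← hl] at hκ
  obtain ⟨h1, h2⟩ := null_frame (n := n) h.smooth.1 h.aeval_linePoint_eq_zero h.dir1_e₁
    (dir1_asymptoticVec h.dir1_e₁ (dir1_tangentVec f (linePoint e₀ e₁) (constVec w₂) (constVec w₃)))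
    h.dir2_e₁ (dir2_asymptoticVec_self h.dir2_e₁)
  rw [← hl] at h1 h2
  rw [h.dir3_e₁, mul_zero, zero_mul] at h1
  rw [dir2_asymptoticVec h.dir2_e₁] at h2
  have h3 : (2 * dir2 f (linePoint e₀ e₁) (constVec e₁) l ^ 2) ^ 2 *
      dir2 f (linePoint e₀ e₁) (linePoint e₀ e₁) n ^ 2 ≠ 0 := by
    have h2' : (2 : Polynomial K) ≠ 0 := by
      exact_mod_cast h.natCast_polynomial_ne_zero (k := 2) (by norm_num)
        (by have := h.three_le; omega)
    exact mul_ne_zero (pow_ne_zero _ (mul_ne_zero h2' (pow_ne_zero _ hκ))) (pow_ne_zero _ hPn)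
  rw [← h2] at h3
  exact ⟨(mul_eq_zero.1 h1).resolve_left (pow_ne_zero _ fun h0 => h3 (by rw [h0]; ring)),
    right_ne_zero_of_mul h3⟩

lemma dir1_flecnodal_eq_zero (h : IsLineFrame f d e₀ e₁ w₂ w₃)
    (hV : inflection f (linePoint e₀ e₁) (constVec e₁)
      (tangentVec f (linePoint e₀ e₁) (constVec w₂) (constVec w₃)) = 0)
    {w : Fin 4 → Polynomial K} (hw : dir1 f (linePoint e₀ e₁) w = 0) :
    dir1 (flecnodal f) (linePoint e₀ e₁) w = 0 := by
  obtain ⟨n, hn, hPn⟩ := h.exists_normal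
  have h2' : (2 : Polynomial K) ≠ 0 := by
    exact_mod_cast h.natCast_polynomial_ne_zero (k := 2) (by norm_num)
      (by have := h.three_le; omega)
  refine _root_.dir1_flecnodal_eq_zero (n := n) h.smooth.1 h.aeval_linePoint_eq_zero h.dir1_e₁
    (dir1_asymptoticVec h.dir1_e₁ (dir1_tangentVec f (linePoint e₀ e₁) (constVec w₂) (constVec w₃)))
    h.dir2_e₁ (dir2_asymptoticVec_self h.dir2_e₁) h.dir3_e₁ ?_ h2' ?_ hn hPn hw
  · rw [dir3_asymptoticVec h.dir3_e₁, hV, mul_zero]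
  · rw [dir2_asymptoticVec h.dir2_e₁]
    exact mul_ne_zero h2' (pow_ne_zero _ h.dir2_e₁_tangentVec_ne_zero)

lemma aeval_minor_eq_zero (h : IsLineFrame f d e₀ e₁ w₂ w₃)
    (hV : inflection f (linePoint e₀ e₁) (constVec e₁)
      (tangentVec f (linePoint e₀ e₁) (constVec w₂) (constVec w₃)) = 0) (i j : Fin 4) (x y : K) :
    aeval (x • e₀ + y • e₁) (pderiv i (flecnodal f) * pderiv j f -
      pderiv j (flecnodal f) * pderiv i f) = 0 := by
  have hd1 : ∀ (g : MvPolynomial (Fin 4) K) (k : Fin 4) (c : Polynomial K),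
      dir1 g (linePoint e₀ e₁) (Pi.single k c) = c * aeval (linePoint e₀ e₁) (pderiv k g) := by
    intro g k c
    rw [dir1, Finset.sum_eq_single k]
    · simp
    · intro l _ hl; simp [hl]
    · simp
  have hw := h.dir1_flecnodal_eq_zero hV
    (w := Pi.single i (aeval (linePoint e₀ e₁) (pderiv j f)) +
      Pi.single j (-aeval (linePoint e₀ e₁) (pderiv i f)))
    (by rw [dir1_add, hd1, hd1]; ring)
  rw [dir1_add, hd1, hd1] at hw
  have hφ := flecnodal_isHomogeneous h.three_le h.smooth.1
  refine aeval_eq_zero_of_aeval_linePoint_eq_zero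
    (((hφ.pderiv (i := i)).mul (h.smooth.1.pderiv (i := j))).sub
      ((hφ.pderiv (i := j)).mul (h.smooth.1.pderiv (i := i)))) ?_ x y
  rw [map_sub, map_mul, map_mul]
  linear_combination hw

end IsLineFrame

section MonomialFactors

variable {R : Type*} [CommRing R] [IsDomain R]

lemma Polynomial.exists_eq_C_mul_X_pow_of_mul {p q : Polynomial R} {a : R} {n : ℕ} (ha : a ≠ 0)
    (h : p * q = Polynomial.C a * Polynomial.X ^ n) :
    ∃ b m, p = Polynomial.C b * Polynomial.X ^ m := by
  have hne : p * q ≠ 0 := by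
    rw [h]; exact mul_ne_zero (by simpa using ha) (pow_ne_zero _ Polynomial.X_ne_zero)
  have hp := left_ne_zero_of_mul hne
  have hq := right_ne_zero_of_mul hne
  have h1 := congrArg Polynomial.natDegree h
  have h2 := congrArg Polynomial.natTrailingDegree h
  rw [Polynomial.natDegree_mul hp hq, Polynomial.natDegree_C_mul_X_pow _ _ ha] at h1
  rw [Polynomial.natTrailingDegree_mul hp hq, Polynomial.C_mul_X_pow_eq_monomial,
    Polynomial.natTrailingDegree_monomial ha] at h2
  have h3 := Polynomial.natTrailingDegree_le_natDegree p
  have h4 := Polynomial.natTrailingDegree_le_natDegree q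
  refine ⟨p.coeff p.natDegree, p.natDegree, ?_⟩
  ext k
  rw [Polynomial.coeff_C_mul_X_pow]
  split_ifs with hk
  · rw [hk]
  · rcases lt_or_gt_of_ne hk with hk | hk
    · exact Polynomial.coeff_eq_zero_of_lt_natTrailingDegree (by omega)
    · exact Polynomial.coeff_eq_zero_of_natDegree_lt hk

end MonomialFactors

section HomogeneousFactors

variable {K : Type*} [Field K]

/-- Multiply the variable `X i` by `t ^ w i`. -/
noncomputable def weightHom (w : Fin 4 → ℕ) :
    MvPolynomial (Fin 4) K →ₐ[K] Polynomial (MvPolynomial (Fin 4) K) :=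
  aeval fun i => Polynomial.C (X i) * Polynomial.X ^ w i

lemma weightHom_monomial (w : Fin 4 → ℕ) (m : Fin 4 →₀ ℕ) (c : K) :
    weightHom w (monomial m c) = Polynomial.monomial (Finsupp.weight w m) (monomial m c) := by
  rw [weightHom, aeval_monomial, ← Polynomial.C_mul_X_pow_eq_monomial, monomial_eq,
    Finsupp.prod_fintype _ _ (by simp), Finsupp.prod_fintype _ _ (by simp), Finsupp.weight_apply,
    Finsupp.sum_fintype _ _ (by simp), IsScalarTower.algebraMap_apply K (MvPolynomial (Fin 4) K),
    ← Finset.prod_pow_eq_pow_sum, map_mul, map_prod, mul_assoc, ← Finset.prod_mul_distrib]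
  simp only [mul_pow, ← pow_mul, map_pow, smul_eq_mul, mul_comm (m _)]
  rfl

lemma coeff_weightHom (w : Fin 4 → ℕ) (p : MvPolynomial (Fin 4) K) (k : ℕ) :
    (weightHom w p).coeff k = weightedHomogeneousComponent w k p := by
  induction p using MvPolynomial.induction_on' with
  | monomial m c =>
    rw [weightHom_monomial, Polynomial.coeff_monomial]
    split_ifs with h
    · rw [weightedHomogeneousComponent_of_mem (isWeightedHomogeneous_monomial _ _ _ h), if_pos rfl]
    · rw [weightedHomogeneousComponent_of_mem (isWeightedHomogeneous_monomial _ _ _ rfl),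
        if_neg (Ne.symm h)]
  | add p q hp hq => rw [map_add, Polynomial.coeff_add, hp, hq, map_add]

lemma eval_one_weightHom (w : Fin 4 → ℕ) (p : MvPolynomial (Fin 4) K) :
    (weightHom w p).eval 1 = p := by
  have : ((Polynomial.aeval (1 : MvPolynomial (Fin 4) K)).restrictScalars K).comp (weightHom w) =
      AlgHom.id K _ := by
    ext i; simp [weightHom]
  have h := congrArg (fun φ => φ p) this
  simpa [Polynomial.coe_aeval_eq_eval] using h

lemma weightHom_one_of_isHomogeneous {f : MvPolynomial (Fin 4) K} {d : ℕ}
    (hf : f.IsHomogeneous d) :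
    weightHom 1 f = Polynomial.C f * Polynomial.X ^ d := by
  ext k : 1
  rw [coeff_weightHom, Polynomial.coeff_C_mul_X_pow, weightedHomogeneousComponent_of_mem hf]

lemma isHomogeneous_of_mul {f p q : MvPolynomial (Fin 4) K} {d : ℕ} (hf : f.IsHomogeneous d)
    (hf0 : f ≠ 0) (h : f = p * q) : ∃ m, p.IsHomogeneous m := by
  have h1 := weightHom_one_of_isHomogeneous hf
  rw [h, map_mul, ← h] at h1
  obtain ⟨b, m, hb⟩ := Polynomial.exists_eq_C_mul_X_pow_of_mul hf0 h1
  have h2 : b = p := by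
    have := eval_one_weightHom 1 p
    rw [hb] at this
    simpa using this
  refine ⟨m, ?_⟩
  have h3 : p = homogeneousComponent m p := by
    have := coeff_weightHom 1 p m
    rw [hb, Polynomial.coeff_C_mul_X_pow, if_pos rfl, h2] at this
    exact this
  rw [h3]
  exact homogeneousComponent_isHomogeneous m p

end HomogeneousFactors

namespace IsLineFrame

variable {K : Type*} [Field K] [IsAlgClosed K] {f : MvPolynomial (Fin 4) K} {d : ℕ}
  {e₀ e₁ w₂ w₃ : Fin 4 → K}

lemma polynomial_ne_zero (h : IsLineFrame f d e₀ e₁ w₂ w₃) : f ≠ 0 := by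
  rintro rfl
  obtain ⟨i, hi⟩ := h.smooth.2 e₁ h.right_ne_zero
  simp at hi

lemma exists_common_zero (h : IsLineFrame f d e₀ e₁ w₂ w₃) {q : MvPolynomial (Fin 4) K} {m : ℕ}
    (hq : q.IsHomogeneous m) (hm : m ≠ 0) :
    ∃ x y : K, x • e₀ + y • e₁ ≠ 0 ∧ aeval (x • e₀ + y • e₁) q = 0 := by
  by_cases hdeg : (aeval (linePoint e₀ e₁) q).degree = 0
  · obtain hc := Polynomial.eq_C_of_degree_eq_zero hdeg
    refine ⟨0, 1, ?_, ?_⟩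
    · simpa using h.right_ne_zero
    · simpa using aeval_eq_zero_of_aeval_linePoint_eq_C hq (fun h => absurd h hm) hc
  · obtain ⟨s, hs⟩ := IsAlgClosed.exists_root _ hdeg
    refine ⟨1, s, ?_, ?_⟩
    · simpa using h.point_ne_zero s
    · have := hs
      rw [Polynomial.IsRoot, ← Polynomial.coe_aeval_eq_eval, map_aeval_point,
        aeval_linePoint] at this
      simpa using this

lemma not_aeval_linePoint_eq_zero_of_mul (h : IsLineFrame f d e₀ e₁ w₂ w₃)
    {p q : MvPolynomial (Fin 4) K} {m n : ℕ} (hp : p.IsHomogeneous m) (hq : q.IsHomogeneous n)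
    (hn : n ≠ 0) (hpq : f = p * q) : aeval (linePoint e₀ e₁) p ≠ 0 := by
  intro h0
  obtain ⟨x, y, hxy, hz⟩ := h.exists_common_zero hq hn
  obtain ⟨i, hi⟩ := h.smooth.2 _ hxy
  have hpz := aeval_eq_zero_of_aeval_linePoint_eq_zero hp h0 x y
  apply hi
  rw [aeval_eq_eval] at hpz hz
  rw [hpq, Derivation.leibniz]
  simp [hpz, hz]

/-- A smooth surface containing a line is irreducible. -/
lemma irreducible (h : IsLineFrame f d e₀ e₁ w₂ w₃) : Irreducible f := by
  have hf := h.smooth.1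
  have hd := h.three_le
  have unit : ∀ p : MvPolynomial (Fin 4) K, p.IsHomogeneous 0 → p ≠ 0 → IsUnit p := by
    intro p hp hp0
    have h1 := totalDegree_eq_zero_iff_eq_C.1 ((totalDegree_zero_iff_isHomogeneous _).2 hp)
    rw [h1] at hp0 ⊢
    refine IsUnit.map C (IsUnit.mk0 _ fun h2 => hp0 ?_)
    rw [h2, map_zero]
  refine ⟨fun hu => ?_, fun p q hpq => ?_⟩
  · obtain ⟨c, -, hc⟩ := MvPolynomial.isUnit_iff_eq_C_of_isReduced.1 hu
    have h1 := hf.totalDegree h.polynomial_ne_zero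
    rw [hc, totalDegree_C] at h1
    omega
  · obtain ⟨m, hp⟩ := isHomogeneous_of_mul hf h.polynomial_ne_zero hpq
    obtain ⟨n, hq⟩ := isHomogeneous_of_mul hf h.polynomial_ne_zero (hpq.trans (mul_comm p q))
    have hp0 : p ≠ 0 := by rintro rfl; exact h.polynomial_ne_zero (by simpa using hpq)
    have hq0 : q ≠ 0 := by rintro rfl; exact h.polynomial_ne_zero (by simpa using hpq)
    rcases eq_or_ne m 0 with rfl | hm
    · exact Or.inl (unit p hp hp0)
    rcases eq_or_ne n 0 with rfl | hn
    · exact Or.inr (unit q hq hq0)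
    have h1 := h.aeval_linePoint_eq_zero
    rw [hpq, map_mul] at h1
    rcases mul_eq_zero.1 h1 with h1 | h1
    · exact absurd h1 (h.not_aeval_linePoint_eq_zero_of_mul hp hq hn hpq)
    · exact absurd h1 (h.not_aeval_linePoint_eq_zero_of_mul hq hp hm (hpq.trans (mul_comm p q)))

end IsLineFrame

section CoefficientDerivation

variable {K 𝕃 : Type*} [Field K] [Field 𝕃] [Algebra K 𝕃]

/-- The derivation of `𝕃[X]` that applies `D` to every coefficient. -/
noncomputable def coeffDerivation (D : Derivation K 𝕃 𝕃) :
    Derivation K (Polynomial 𝕃) (Polynomial 𝕃) :=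
  (PolynomialModule.equivPolynomialSelf (R := 𝕃)).toLinearMap.compDer D.mapCoeffs

lemma coeff_coeffDerivation (D : Derivation K 𝕃 𝕃) (p : Polynomial 𝕃) (k : ℕ) :
    (coeffDerivation D p).coeff k = D (p.coeff k) := rfl

lemma coeffDerivation_linePoint (D : Derivation K 𝕃 𝕃) (P v : Fin 4 → 𝕃) (i : Fin 4) :
    coeffDerivation D (linePoint P v i) =
      linePoint (fun i => D (P i)) (fun i => D (v i)) i := by
  ext k
  rw [coeff_coeffDerivation]
  simp only [linePoint, Polynomial.coeff_add, map_add, Polynomial.coeff_C, Polynomial.X_mul_C,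
    Polynomial.coeff_C_mul_X, apply_ite D, map_zero]

end CoefficientDerivation

section Nullstellensatz

variable {K Ω : Type*} [Field K] [IsAlgClosed K] [Field Ω] [Algebra K Ω]

/-- A smooth surface has no singular points over extension fields. -/
lemma eq_zero_of_aeval_pderiv_eq_zero {f : MvPolynomial (Fin 4) K} {d : ℕ}
    (hf : IsSmoothSurfaceOfDegree f d) {Q : Fin 4 → Ω}
    (hQ : ∀ i, aeval Q (pderiv i f) = 0) : Q = 0 := by
  let I : Ideal (MvPolynomial (Fin 4) K) := Ideal.span (Set.range fun i => pderiv i f)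
  funext j
  have h1 : (X j : MvPolynomial (Fin 4) K) ∈ I.radical := by
    rw [← vanishingIdeal_zeroLocus_eq_radical (K := K)]
    intro x hx
    have hx0 : x = 0 := by
      by_contra hne
      obtain ⟨i, hi⟩ := hf.2 x hne
      exact hi (by simpa [aeval_eq_eval] using hx _ (Ideal.subset_span ⟨i, rfl⟩))
    simp [hx0]
  obtain ⟨N, hN⟩ := h1
  have h2 : I ≤ RingHom.ker (aeval Q : MvPolynomial (Fin 4) K →ₐ[K] Ω) := by
    rw [Ideal.span_le]
    rintro _ ⟨i, rfl⟩
    exact hQ i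
  have h3 := h2 hN
  rw [RingHom.mem_ker, map_pow, aeval_X] at h3
  exact eq_zero_of_pow_eq_zero h3

end Nullstellensatz

section LeadingCoefficient

variable {K 𝕃 : Type*} [Field K] [Field 𝕃] [Algebra K 𝕃] {q : MvPolynomial (Fin 4) K} {m : ℕ}

lemma coeff_aeval_linePoint (hq : q.IsHomogeneous m) (P v : Fin 4 → 𝕃) :
    (aeval (linePoint P v) q).coeff m = aeval v q := by
  rw [aeval_def, aeval_def, eval₂_eq', eval₂_eq', Polynomial.finsetSum_coeff]
  refine Finset.sum_congr rfl fun s hs => ?_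
  have hs' : ∑ i, s i = m := by
    have := hq (mem_support_iff.1 hs)
    rw [Finsupp.weight_apply, Finsupp.sum_fintype _ _ (by simp)] at this
    simpa using this
  have hc : ∀ i, (linePoint P v i).coeff 1 = v i := fun i => by simp [linePoint, Polynomial.coeff_C]
  have hp : ∀ i, ((linePoint P v i) ^ s i).natDegree ≤ s i := fun i =>
    (Polynomial.natDegree_pow_le_of_le _ (natDegree_linePoint_le P v i)).trans (by simp)
  have hk : ∀ i, ((linePoint P v i) ^ s i).coeff (s i) = v i ^ s i := fun i => by
    have := Polynomial.coeff_pow_of_natDegree_le (m := s i) (natDegree_linePoint_le P v i)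
    rwa [mul_one, hc] at this
  rw [Polynomial.algebraMap_apply, Polynomial.coeff_C_mul, Fin.prod_univ_four, Fin.prod_univ_four,
    ← hs', Fin.sum_univ_four]
  congr 1
  have h01 := Polynomial.natDegree_mul_le_of_le (hp 0) (hp 1)
  have h02 := Polynomial.natDegree_mul_le_of_le h01 (hp 2)
  rw [Polynomial.coeff_mul_add_eq_of_natDegree_le h02 (hp 3),
    Polynomial.coeff_mul_add_eq_of_natDegree_le h01 (hp 2),
    Polynomial.coeff_mul_add_eq_of_natDegree_le (hp 0) (hp 1), hk, hk, hk, hk]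

end LeadingCoefficient

section AsymptoticCurve

lemma linePoint_eq_add {𝕃 : Type*} [Field 𝕃] (P v : Fin 4 → 𝕃) :
    linePoint P v = constVec P + (Polynomial.X : Polynomial 𝕃) • constVec v := by
  funext i; simp [linePoint, constVec]

variable {K 𝕃 : Type*} [Field K] [Field 𝕃] [Algebra K 𝕃] {f : MvPolynomial (Fin 4) K} {d : ℕ}

lemma derivative_aeval_linePoint (f : MvPolynomial (Fin 4) K) (P v : Fin 4 → 𝕃) :
    Polynomial.derivative (aeval (linePoint P v) f) = dir1 f (linePoint P v) (constVec v) := by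
  have h1 := derivation_aeval' (linePoint P v)
    ((Polynomial.derivative' (R := 𝕃)).restrictScalars K) f
  have h2 : (fun i => (Polynomial.derivative' (R := 𝕃)).restrictScalars K (linePoint P v i)) =
      constVec v := by
    funext i; simp [linePoint, constVec, Polynomial.derivative']
  rw [h2] at h1
  exact h1

/-- If the second asymptotic direction has contact of order four along the generic point `P`,
then the asymptotic line lies on the surface. -/
lemma aeval_linePoint_eq_zero_of_derivation (hf : f.IsHomogeneous d)
    (hk : ∀ k : ℕ, 0 < k → k ≤ d → (k : K) ≠ 0) {P v : Fin 4 → 𝕃} (h0 : aeval P f = 0)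
    {D : Derivation K 𝕃 𝕃} (hD : ∀ i, D (P i) = v i) {a b : 𝕃}
    (hv : ∀ i, D (v i) = a * v i + b * P i) : aeval (linePoint P v) f = 0 := by
  set F := aeval (linePoint P v) f with hF
  have hF' : Polynomial.derivative F = dir1 f (linePoint P v) (constVec v) :=
    derivative_aeval_linePoint f P v
  have hdF : dir1 f (linePoint P v) (constVec P) =
      (d : Polynomial 𝕃) * F - Polynomial.X * Polynomial.derivative F := by
    have h1 := dir1_self (linePoint P v) hf
    have h2 := linePoint_eq_add P v
    nth_rewrite 2 [h2] at h1
    rw [dir1_add, dir1_smul, ← hF', ← hF] at h1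
    rw [← h1]; ring
  have hDF : coeffDerivation D F = Polynomial.derivative F
      + Polynomial.C a * (Polynomial.derivative F * Polynomial.X)
      + Polynomial.C b * (((d : Polynomial 𝕃) * F - Polynomial.X * Polynomial.derivative F)
          * Polynomial.X) := by
    rw [hF, derivation_aeval', ← hdF]
    have h1 : (fun i => coeffDerivation D (linePoint P v i)) =
        constVec v + ((Polynomial.C a * Polynomial.X) • constVec v
          + (Polynomial.C b * Polynomial.X) • constVec P) := by
      funext i
      rw [coeffDerivation_linePoint]
      simp only [linePoint, constVec, hD, hv, Pi.add_apply, Pi.smul_apply, smul_eq_mul, map_add,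
        map_mul]
      ring
    rw [h1, dir1_add, dir1_add, dir1_smul, dir1_smul, ← hF, ← hF']
    ring
  have hc : ∀ k, k ≤ d → ∀ j ≤ k, F.coeff j = 0 := by
    intro k
    induction k with
    | zero =>
      intro _ j hj
      obtain rfl : j = 0 := by omega
      have := congrArg (Polynomial.aeval (0 : 𝕃)) hF
      rw [Polynomial.coeff_zero_eq_aeval_zero, this]
      have h2 := map_aeval_point (linePoint P v) ((Polynomial.aeval (0 : 𝕃)).restrictScalars K) f
      simp only [AlgHom.restrictScalars_apply, aeval_linePoint, zero_smul, add_zero, h0] at h2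
      exact h2
    | succ k ih =>
      intro hkd j hj
      have ih := ih (by omega)
      rcases Nat.lt_or_ge j (k + 1) with hj' | hj'
      · exact ih j (by omega)
      obtain rfl : j = k + 1 := by omega
      have h1 := congrArg (fun p => p.coeff k) hDF
      have h2 : (k : 𝕃) + 1 ≠ 0 := by
        have := (map_ne_zero (algebraMap K 𝕃)).2 (hk (k + 1) (by omega) hkd)
        simpa using this
      simp only [coeff_coeffDerivation, ih k le_rfl, map_zero, Polynomial.coeff_add,
        Polynomial.coeff_C_mul, Polynomial.coeff_derivative] at h1
      cases k with
      | zero => simpa using h1.symm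
      | succ k =>
        have e2 : (((d : Polynomial 𝕃) * F - Polynomial.X * Polynomial.derivative F)
          * Polynomial.X).coeff (k + 1) = 0 := by
          rw [Polynomial.coeff_mul_X, Polynomial.coeff_sub, ← Polynomial.C_eq_natCast,
            Polynomial.coeff_C_mul, ih k (by omega)]
          cases k with
          | zero => simp
          | succ k =>
            rw [Polynomial.coeff_X_mul, Polynomial.coeff_derivative, ih (k + 1) (by omega)]
            simp
        rw [e2, Polynomial.coeff_mul_X, Polynomial.coeff_derivative, ih (k + 1) le_rfl] at h1
        simp only [zero_mul, mul_zero, add_zero] at h1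
        exact (mul_eq_zero.1 h1.symm).resolve_right h2
  ext j
  rw [Polynomial.coeff_zero]
  rcases Nat.lt_or_ge d j with hj | hj
  · refine Polynomial.coeff_eq_zero_of_natDegree_lt (lt_of_le_of_lt ?_ hj)
    have h1 := natDegree_aeval_le_of_isHomogeneous (hf.map (algebraMap K 𝕃))
      (natDegree_linePoint_le P v)
    rwa [aeval_map_algebraMap] at h1
  · exact hc d le_rfl j hj

end AsymptoticCurve

section RuledSurface

variable {K 𝕃 : Type*} [Field K] [IsAlgClosed K] [Field 𝕃] [Algebra K 𝕃]
  {f : MvPolynomial (Fin 4) K} {d : ℕ}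

lemma coeff_dir1_linePoint (hf : f.IsHomogeneous d) (P v x : Fin 4 → 𝕃) :
    (dir1 f (linePoint P v) (constVec x)).coeff (d - 1) = dir1 f v x := by
  simp only [dir1, Polynomial.finsetSum_coeff, constVec, Polynomial.coeff_C_mul,
    coeff_aeval_linePoint hf.pderiv]

lemma dir1_single (P : Fin 4 → 𝕃) (i : Fin 4) (f : MvPolynomial (Fin 4) K) :
    dir1 f P (Pi.single i 1) = aeval P (pderiv i f) := by
  rw [dir1, Finset.sum_eq_single i (fun j _ hj => by simp [Pi.single_eq_of_ne hj]) (by simp)]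
  simp

lemma dir1_constVec_single (P : Fin 4 → Polynomial 𝕃) (i : Fin 4) (f : MvPolynomial (Fin 4) K) :
    dir1 f P (constVec (Pi.single i (1 : 𝕃))) = aeval P (pderiv i f) := by
  rw [dir1, Finset.sum_eq_single i
    (fun j _ hj => by rw [constVec, Pi.single_eq_of_ne hj, map_zero, zero_mul]) (by simp)]
  rw [constVec, Pi.single_eq_same, map_one, one_mul]

lemma isCoprime_dir1_linePoint (hf : IsSmoothSurfaceOfDegree f d) {P v : Fin 4 → 𝕃}
    (hPv : LinearIndependent 𝕃 ![P, v]) {γu γn : Polynomial 𝕃}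
    (hγ : ∀ x : Fin 4 → 𝕃, ∃ c e : 𝕃, dir1 f (linePoint P v) (constVec x) =
      Polynomial.C c * γu + Polynomial.C e * γn) : IsCoprime γu γn := by
  rw [Polynomial.isCoprime_iff_aeval_ne_zero_of_isAlgClosed 𝕃 (AlgebraicClosure 𝕃)]
  intro τ
  by_contra hcon
  push Not at hcon
  have hQ : (fun i => Polynomial.aeval τ (linePoint P v i)) = 0 := by
    refine eq_zero_of_aeval_pderiv_eq_zero hf fun i => ?_
    obtain ⟨c, e, hce⟩ := hγ (Pi.single i 1)
    rw [dir1_constVec_single] at hce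
    have h1 := congrArg (Polynomial.aeval τ) hce
    rw [map_add, map_mul, map_mul, hcon.1, hcon.2, mul_zero, mul_zero, add_zero] at h1
    have h2 := map_aeval_point (linePoint P v) ((Polynomial.aeval τ).restrictScalars K)
      (pderiv i f)
    simp only [AlgHom.restrictScalars_apply] at h2
    rw [← h2, h1]
  have hτ : ∀ i, algebraMap 𝕃 (AlgebraicClosure 𝕃) (P i)
      + τ * algebraMap 𝕃 (AlgebraicClosure 𝕃) (v i) = 0 := by
    intro i
    have := congrFun hQ i
    rw [mul_comm]
    simpa [linePoint] using this
  have hv0 : v ≠ 0 := by simpa using hPv.ne_zero 1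
  obtain ⟨j, hj⟩ := Function.ne_iff.1 hv0
  rw [Pi.zero_apply] at hj
  have hrel : v j • P + (-P j) • v = 0 := by
    funext i
    apply (algebraMap 𝕃 (AlgebraicClosure 𝕃)).injective
    simp only [Pi.add_apply, Pi.smul_apply, smul_eq_mul, map_add, map_mul, map_neg, Pi.zero_apply,
      map_zero]
    linear_combination algebraMap 𝕃 (AlgebraicClosure 𝕃) (v j) * hτ i
      - algebraMap 𝕃 (AlgebraicClosure 𝕃) (v i) * hτ j
  exact hj ((LinearIndependent.pair_iff.1 hPv _ _ hrel).1)

/-- A smooth surface of degree at least three is not ruled: the generic point does not move along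
an asymptotic direction with contact of order four. -/
lemma false_of_asymptotic (hd : 3 ≤ d) (hk : ∀ k : ℕ, 0 < k → k ≤ d → (k : K) ≠ 0)
    (hf : IsSmoothSurfaceOfDegree f d) {P u v n : Fin 4 → 𝕃} (h0 : aeval P f = 0)
    (hu : dir1 f P u = 0) (hv : dir1 f P v = 0) (huv : dir2 f P u v ≠ 0)
    (hvv : dir2 f P v v = 0) (hvvv : dir3 f P v v v = 0) (hn : dir1 f P n ≠ 0)
    (hspan : ∀ x : Fin 4 → 𝕃, ∃ a b c e : 𝕃, x = a • P + (b • v + (c • u + e • n)))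
    (hPv : LinearIndependent 𝕃 ![P, v])
    (hD : ∀ w : Fin 4 → 𝕃, dir1 f P w = 0 → ∃ D : Derivation K 𝕃 𝕃, ∀ i, D (P i) = w i) :
    False := by
  have hP : dir1 f P P = 0 := by rw [dir1_self P hf.1, h0, mul_zero]
  have hF : aeval (linePoint P v) f = 0 := by
    obtain ⟨D, hDv⟩ := hD v hv
    have hDv' : (fun i => D (P i)) = v := funext hDv
    obtain ⟨a, b, c, e, hx⟩ := hspan fun i => D (v i)
    have h1 := derivation_dir1 P v D f
    rw [hv, map_zero, hDv', hvv, zero_add, hx, dir1_add, dir1_add, dir1_add, dir1_smul, dir1_smul,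
      dir1_smul, dir1_smul, hP, hu, hv, mul_zero, mul_zero, mul_zero, zero_add, zero_add,
      zero_add] at h1
    have he : e = 0 := (mul_eq_zero.1 h1.symm).resolve_right hn
    have h2 := derivation_dir2 P v v D f
    have h2' : (2 : 𝕃) ≠ 0 := by
      have := (map_ne_zero (algebraMap K 𝕃)).2 (hk 2 (by omega) (by omega))
      rwa [map_natCast, Nat.cast_two] at this
    rw [hvv, map_zero, hDv', hvvv, zero_add, dir2_comm f P v, ← two_mul, hx, dir2_add_left,
      dir2_add_left, dir2_add_left, dir2_smul_left, dir2_smul_left, dir2_smul_left, dir2_smul_left,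
      dir2_self P v hf.1, hv, hvv, he] at h2
    simp only [mul_zero, zero_mul, zero_add, add_zero] at h2
    have hc : c = 0 := (mul_eq_zero.1 ((mul_eq_zero.1 h2.symm).resolve_left h2')).resolve_right huv
    refine aeval_linePoint_eq_zero_of_derivation hf.1 hk h0 hDv (a := b) (b := a) fun i => ?_
    have := congrFun hx i
    simp only [hc, he, Pi.add_apply, Pi.smul_apply, smul_eq_mul, zero_mul, add_zero] at this
    rw [this]; ring
  have hγv : dir1 f (linePoint P v) (constVec v) = 0 := by
    rw [← derivative_aeval_linePoint, hF, Polynomial.derivative_zero]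
  have hγP : dir1 f (linePoint P v) (constVec P) = 0 := by
    have h1 := dir1_self (linePoint P v) hf.1
    have h2 := linePoint_eq_add P v
    nth_rewrite 2 [h2] at h1
    rwa [dir1_add, dir1_smul, hγv, mul_zero, add_zero, hF, mul_zero] at h1
  set γu := dir1 f (linePoint P v) (constVec u) with hγu
  set γn := dir1 f (linePoint P v) (constVec n) with hγn
  have hγ : ∀ x : Fin 4 → 𝕃, ∃ c e : 𝕃, dir1 f (linePoint P v) (constVec x) =
      Polynomial.C c * γu + Polynomial.C e * γn := by
    intro x
    obtain ⟨a, b, c, e, rfl⟩ := hspan x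
    refine ⟨c, e, ?_⟩
    have : constVec (a • P + (b • v + (c • u + e • n))) = Polynomial.C a • constVec P +
        (Polynomial.C b • constVec v + (Polynomial.C c • constVec u
          + Polynomial.C e • constVec n)) := by
      funext i; simp [constVec]
    rw [this, dir1_add, dir1_add, dir1_add, dir1_smul, dir1_smul, dir1_smul, dir1_smul, hγv, hγP]
    simp [hγu, hγn]
  have hcop : IsCoprime γu γn := isCoprime_dir1_linePoint hf hPv hγ
  obtain ⟨y, z, hyz⟩ : ∃ y z : 𝕃, (1 + Polynomial.C z * Polynomial.X) * γu
      = -(Polynomial.C y * Polynomial.X * γn) := by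
    obtain ⟨D, hDu⟩ := hD u hu
    obtain ⟨a, b, z, y, hx⟩ := hspan fun i => D (v i)
    refine ⟨y, z, ?_⟩
    have h1 := derivation_aeval' (linePoint P v) (coeffDerivation D) f
    rw [hF, map_zero] at h1
    have h2 : (fun i => coeffDerivation D (linePoint P v i)) =
        constVec u + (Polynomial.X : Polynomial 𝕃) •
          (Polynomial.C a • constVec P + (Polynomial.C b • constVec v
          + (Polynomial.C z • constVec u + Polynomial.C y • constVec n))) := by
      funext i
      rw [coeffDerivation_linePoint, hx, linePoint_eq_add, funext hDu]
      simp only [constVec, Pi.add_apply, Pi.smul_apply, smul_eq_mul, map_add, map_mul]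
    rw [h2, dir1_add, dir1_smul, dir1_add, dir1_add, dir1_add, dir1_smul, dir1_smul, dir1_smul,
      dir1_smul, hγv, hγP, ← hγu, ← hγn] at h1
    linear_combination -h1
  have hz : (1 + Polynomial.C z * Polynomial.X : Polynomial 𝕃) ≠ 0 := by
    intro h
    have := congrArg (Polynomial.eval 0) h
    simp at this
  have hz1 : (1 + Polynomial.C z * Polynomial.X : Polynomial 𝕃).natDegree ≤ 1 := by
    compute_degree
  have hn1 : γn.natDegree ≤ 1 := by
    have : γn ∣ 1 + Polynomial.C z * Polynomial.X :=
      hcop.symm.dvd_of_dvd_mul_right (hyz ▸ (dvd_mul_left _ _).neg_right)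
    exact (Polynomial.natDegree_le_of_dvd this hz).trans hz1
  have hu1 : γu.natDegree ≤ 1 := by
    rcases eq_or_ne y 0 with rfl | hy
    · rw [map_zero, zero_mul, zero_mul, neg_zero] at hyz
      simp [(mul_eq_zero.1 hyz).resolve_left hz]
    · have h1 : γu ∣ Polynomial.C y * Polynomial.X :=
        hcop.dvd_of_dvd_mul_right
          ((dvd_neg (a := γu) (b := Polynomial.C y * Polynomial.X * γn)).1 (hyz ▸ dvd_mul_left _ _))
      refine (Polynomial.natDegree_le_of_dvd h1 ?_).trans (by compute_degree)
      simp [hy]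
  have hv0 : v = 0 := by
    refine eq_zero_of_aeval_pderiv_eq_zero hf fun i => ?_
    obtain ⟨c, e, hce⟩ := hγ (Pi.single i 1)
    have h1 := coeff_dir1_linePoint hf.1 P v (Pi.single i 1)
    rw [hce, Polynomial.coeff_add, Polynomial.coeff_C_mul, Polynomial.coeff_C_mul,
      Polynomial.coeff_eq_zero_of_natDegree_lt (by omega),
      Polynomial.coeff_eq_zero_of_natDegree_lt (by omega)] at h1
    rw [dir1_single, mul_zero, mul_zero, add_zero] at h1
    exact h1.symm
  exact (by simpa using hPv.ne_zero 1 : v ≠ 0) hv0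

end RuledSurface

section TangentFrame

variable {K 𝕃 : Type*} [Field K] [Field 𝕃] [Algebra K 𝕃]
  {f : MvPolynomial (Fin 4) K} {d : ℕ} {P x y n : Fin 4 → 𝕃}

lemma linearIndependent_iff_det_frameMatrix_ne_zero (P x y n : Fin 4 → 𝕃) :
    LinearIndependent 𝕃 ![P, x, y, n] ↔ (frameMatrix P x y n).det ≠ 0 := by
  rw [← isUnit_iff_ne_zero, ← Matrix.isUnit_iff_isUnit_det,
    ← Matrix.linearIndependent_cols_iff_isUnit]
  rfl

lemma det_frameMatrix_combination (P x y n : Fin 4 → 𝕃) (p q r s : 𝕃) :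
    (frameMatrix P (p • x + q • y) (r • x + s • y) n).det
      = (p * s - q * r) * (frameMatrix P x y n).det := by
  simp only [frameMatrix, Matrix.det_succ_row_zero, Matrix.of_apply, Fin.sum_univ_succ,
    Matrix.submatrix_apply, Fin.succAbove, Matrix.det_unique, Fin.default_eq_zero]
  simp [Fin.ext_iff, Fin.lt_def]
  ring

lemma exists_tangent_frame (hP : P ≠ 0) (hPP : dir1 f P P = 0) (hg : ∃ n, dir1 f P n ≠ 0) :
    ∃ x y n, LinearIndependent 𝕃 ![P, x, y, n] ∧ dir1 f P x = 0 ∧ dir1 f P y = 0 ∧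
      dir1 f P n ≠ 0 := by
  obtain ⟨n, hn⟩ := hg
  let ℓ : (Fin 4 → 𝕃) →ₗ[𝕃] 𝕃 :=
    { toFun := dir1 f P
      map_add' := fun u v => dir1_add f P u v
      map_smul' := fun a u => dir1_smul f P u a }
  have hℓ : ∀ v, ℓ v = dir1 f P v := fun _ => rfl
  have hr : Module.finrank 𝕃 (LinearMap.ker ℓ) = 3 := by
    have h1 := LinearMap.finrank_range_add_finrank_ker ℓ
    have h2 : LinearMap.range ℓ = ⊤ :=
      LinearMap.range_eq_top.2 (LinearMap.surjective (fun h => hn (by rw [← hℓ, h]; rfl)))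
    rw [h2, finrank_top] at h1
    simp at h1
    omega
  let P' : LinearMap.ker ℓ := ⟨P, hPP⟩
  have hP' : LinearIndependent 𝕃 ![P'] :=
    LinearIndependent.of_subsingleton 0 (fun h => hP (congrArg Subtype.val h))
  obtain ⟨x, hx⟩ := exists_linearIndependent_cons_of_lt_finrank hP' (by omega)
  obtain ⟨y, hy⟩ := exists_linearIndependent_cons_of_lt_finrank hx (by omega)
  refine ⟨x, y, n, ?_, x.2, y.2, hn⟩
  have h3 := hy.map' (LinearMap.ker ℓ).subtype (Submodule.ker_subtype _)
  have h4 : LinearIndependent 𝕃 (Fin.cons n ((LinearMap.ker ℓ).subtype ∘ _)) :=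
    h3.finCons (x := n) (fun hmem => by
      have : Submodule.span 𝕃 (Set.range ((LinearMap.ker ℓ).subtype ∘
          (Fin.cons y (Fin.cons x ![P']) : Fin 3 → LinearMap.ker ℓ))) ≤ LinearMap.ker ℓ := by
        rw [Submodule.span_le]
        rintro _ ⟨i, rfl⟩
        exact Subtype.prop _
      exact hn (this hmem))
  have h5 : ![P, x.1, y.1, n] = (Fin.cons n ((LinearMap.ker ℓ).subtype ∘
      (Fin.cons y (Fin.cons x ![P']) : Fin 3 → LinearMap.ker ℓ)) :
        Fin 4 → Fin 4 → 𝕃) ∘ Fin.rev := by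
    funext i
    fin_cases i <;> rfl
  rw [h5]
  exact h4.comp _ Fin.rev_injective

/-- Along a tangent frame, the Hessian determinant is the discriminant of the second fundamental
form. -/
lemma det_hessMatrix_frame (hf : f.IsHomogeneous d) (h0 : aeval P f = 0) (hx : dir1 f P x = 0)
    (hy : dir1 f P y = 0) :
    (frameMatrix P x y n).det ^ 2 * (hessMatrix f P).det =
      (dir2 f P x y ^ 2 - dir2 f P x x * dir2 f P y y) * dir2 f P P n ^ 2 := by
  have hPP : dir2 f P P P = 0 := by rw [dir2_self _ _ hf, dir1_self _ hf, h0]; simp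
  have hPx : dir2 f P P x = 0 := by rw [dir2_self _ _ hf, hx, mul_zero]
  have hPy : dir2 f P P y = 0 := by rw [dir2_self _ _ hf, hy, mul_zero]
  have hxP := hPx; rw [dir2_comm] at hxP
  have hyP := hPy; rw [dir2_comm] at hyP
  have hB : ∀ i, (fun a => frameMatrix P x y n a i) = ![P, x, y, n] i := fun i => rfl
  have hh : (frameMatrix P x y n).transpose * hessMatrix f P * frameMatrix P x y n =
      !![0, 0, 0, dir2 f P P n; 0, dir2 f P x x, dir2 f P x y, dir2 f P x n;
        0, dir2 f P x y, dir2 f P y y, dir2 f P y n;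
        dir2 f P P n, dir2 f P x n, dir2 f P y n, dir2 f P n n] := by
    rw [hessMatrix_congruence]
    simp only [hB]
    ext i j
    fin_cases i <;> fin_cases j <;>
      simp [hPP, hPx, hPy, hxP, hyP, dir2_comm f P n, dir2_comm f P y x]
  have := congrArg Matrix.det hh
  rw [Matrix.det_mul, Matrix.det_mul, Matrix.det_transpose] at this
  rw [show (frameMatrix P x y n).det ^ 2 * (hessMatrix f P).det =
    (frameMatrix P x y n).det * (hessMatrix f P).det * (frameMatrix P x y n).det by ring, this]
  simp [Matrix.det_succ_row_zero, Fin.sum_univ_succ, Fin.succAbove]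
  ring

/-- Over a field with square roots, a nondegenerate second fundamental form has a null frame. -/
lemma exists_null_frame (hsq : ∀ a : 𝕃, ∃ b, b ^ 2 = a) (h2 : (2 : 𝕃) ≠ 0)
    (hli : LinearIndependent 𝕃 ![P, x, y, n]) (hx : dir1 f P x = 0) (hy : dir1 f P y = 0)
    (hdisc : dir2 f P x y ^ 2 - dir2 f P x x * dir2 f P y y ≠ 0) :
    ∃ u v, LinearIndependent 𝕃 ![P, u, v, n] ∧ dir1 f P u = 0 ∧ dir1 f P v = 0 ∧
      dir2 f P u u = 0 ∧ dir2 f P v v = 0 := by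
  rw [linearIndependent_iff_det_frameMatrix_ne_zero] at hli
  have key : ∀ p q r s : 𝕃, p * s - q * r ≠ 0 →
      p ^ 2 * dir2 f P x x + 2 * p * q * dir2 f P x y + q ^ 2 * dir2 f P y y = 0 →
      r ^ 2 * dir2 f P x x + 2 * r * s * dir2 f P x y + s ^ 2 * dir2 f P y y = 0 →
      ∃ u v, LinearIndependent 𝕃 ![P, u, v, n] ∧ dir1 f P u = 0 ∧ dir1 f P v = 0 ∧
        dir2 f P u u = 0 ∧ dir2 f P v v = 0 := by
    intro p q r s hdet hu hv
    refine ⟨p • x + q • y, r • x + s • y, ?_, ?_, ?_, ?_, ?_⟩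
    · rw [linearIndependent_iff_det_frameMatrix_ne_zero, det_frameMatrix_combination]
      exact mul_ne_zero hdet hli
    · rw [dir1_add, dir1_smul, dir1_smul, hx, hy]; ring
    · rw [dir1_add, dir1_smul, dir1_smul, hx, hy]; ring
    all_goals
      simp only [dir2_add_left, dir2_add_right, dir2_smul_left, dir2_smul_right, dir2_comm f P y x]
      first | linear_combination hu | linear_combination hv
  obtain ⟨σ, hσ⟩ := hsq (dir2 f P x y ^ 2 - dir2 f P x x * dir2 f P y y)
  set a := dir2 f P x x
  set b := dir2 f P x y
  set c := dir2 f P y y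
  have hσ0 : σ ≠ 0 := by rintro rfl; exact hdisc (by rw [← hσ]; ring)
  by_cases ha : a = 0
  · have hb : b ≠ 0 := by rintro hb; exact hdisc (by rw [ha, hb]; ring)
    refine key 1 0 c (-(2 * b)) ?_ ?_ ?_
    · have := mul_ne_zero h2 hb
      simpa using this
    · rw [ha]; ring
    · rw [ha]; ring
  · refine key (-b + σ) a (-b - σ) a ?_ ?_ ?_
    · have : (-b + σ) * a - a * (-b - σ) = 2 * a * σ := by ring
      rw [this]
      exact mul_ne_zero (mul_ne_zero h2 ha) hσ0
    · linear_combination a * hσ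
    · linear_combination a * hσ

end TangentFrame

section GenericPoint

variable {K 𝕃 : Type*} [Field K] [IsAlgClosed K] [Field 𝕃] [Algebra K 𝕃]
  {f : MvPolynomial (Fin 4) K} {d : ℕ}

/-- The flecnodal polynomial does not vanish at a point that can be moved in every tangent
direction. -/
lemma aeval_flecnodal_ne_zero_of_derivations (hd : 3 ≤ d)
    (hk : ∀ k : ℕ, 0 < k → k ≤ d → (k : K) ≠ 0) (hf : IsSmoothSurfaceOfDegree f d)
    (hsq : ∀ a : 𝕃, ∃ b, b ^ 2 = a) {P : Fin 4 → 𝕃} (hP : P ≠ 0) (h0 : aeval P f = 0)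
    (hH : (hessMatrix f P).det ≠ 0)
    (hD : ∀ w : Fin 4 → 𝕃, dir1 f P w = 0 → ∃ D : Derivation K 𝕃 𝕃, ∀ i, D (P i) = w i) :
    aeval P (flecnodal f) ≠ 0 := by
  intro hφ
  have hk' : ∀ k : ℕ, 0 < k → k ≤ d → (k : 𝕃) ≠ 0 := fun k h1 h2 => by
    have := (map_ne_zero (algebraMap K 𝕃)).2 (hk k h1 h2)
    rwa [map_natCast] at this
  have h2 : (2 : 𝕃) ≠ 0 := by exact_mod_cast hk' 2 (by omega) (by omega)
  have hPP : dir1 f P P = 0 := by rw [dir1_self P hf.1, h0, mul_zero]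
  obtain ⟨x, y, n, hli, hx, hy, hn⟩ := exists_tangent_frame (f := f) hP hPP (by
    by_contra hcon
    push Not at hcon
    exact hP (eq_zero_of_aeval_pderiv_eq_zero hf fun i => by rw [← dir1_single, hcon]))
  have hPn : dir2 f P P n ≠ 0 := by
    rw [dir2_self P n hf.1]
    exact mul_ne_zero (hk' (d - 1) (by omega) (by omega)) hn
  have hdisc : dir2 f P x y ^ 2 - dir2 f P x x * dir2 f P y y ≠ 0 := by
    refine left_ne_zero_of_mul (b := dir2 f P P n ^ 2) ?_
    rw [← det_hessMatrix_frame hf.1 h0 hx hy]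
    exact mul_ne_zero (pow_ne_zero _
      ((linearIndependent_iff_det_frameMatrix_ne_zero _ _ _ _).1 hli))
      hH
  obtain ⟨u, v, hli', hu, hv, huu, hvv⟩ := exists_null_frame hsq h2 hli hx hy hdisc
  obtain ⟨h3, h4⟩ := null_frame (n := n) hf.1 h0 hu hv huu hvv
  have huv : dir2 f P u v ≠ 0 := by
    intro h
    rw [h] at h4
    refine mul_ne_zero (pow_ne_zero 2
      ((linearIndependent_iff_det_frameMatrix_ne_zero _ _ _ _).1 hli')) hH (h4.trans (by ring))
  have h8 : (8 : 𝕃) ≠ 0 := by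
    have := pow_ne_zero 3 h2
    norm_num at this
    exact this
  have hspan := exists_coords_of_indep hli'
  have hpair : ∀ i : Fin 4, i ≠ 0 → LinearIndependent 𝕃 ![P, ![P, u, v, n] i] := by
    intro i hi
    have := hli'.comp ![0, i] (by
      intro a b hab
      fin_cases a <;> fin_cases b <;> simp_all [eq_comm])
    convert this using 1
    funext a; fin_cases a <;> rfl
  rw [hφ, mul_zero, eq_comm] at h3
  rcases mul_eq_zero.1 h3 with h3 | hvvv
  · have huuu := (mul_eq_zero.1 h3).resolve_left
      (mul_ne_zero (mul_ne_zero h8 (pow_ne_zero _ huv)) (pow_ne_zero _ hPn))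
    refine false_of_asymptotic hd hk hf h0 hv hu (dir2_comm f P u v ▸ huv) huu huuu hn (fun z => ?_)
      (hpair 1 (by decide)) hD
    obtain ⟨a, b, c, e, hz⟩ := hspan z
    exact ⟨a, b, c, e, by rw [hz]; simp only [add_assoc]⟩
  · refine false_of_asymptotic hd hk hf h0 hu hv huv hvv hvvv hn (fun z => ?_)
      (hpair 2 (by decide)) hD
    obtain ⟨a, b, c, e, hz⟩ := hspan z
    exact ⟨a, c, b, e, by rw [hz]; module⟩

end GenericPoint

section ExtendDerivation

variable {K S A 𝕃 : Type*} [Field K] [CommRing S] [Algebra K S] [CommRing A] [Algebra K A]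
  [Field 𝕃] [Algebra K 𝕃] [Algebra S A] [Algebra S 𝕃] [Algebra A 𝕃] [IsScalarTower K S A]
  [IsScalarTower S A 𝕃] [IsScalarTower K A 𝕃]

/-- A derivation that vanishes on the kernel of a surjection descends to the quotient. -/
lemma exists_derivation_of_surjective (hs : Function.Surjective (algebraMap S A))
    (δ : Derivation K S 𝕃) (hδ : ∀ s, algebraMap S A s = 0 → δ s = 0) :
    ∃ D : Derivation K A 𝕃, ∀ s, D (algebraMap S A s) = δ s := by
  have hg : ∀ s, algebraMap S A (Function.surjInv hs (algebraMap S A s)) = algebraMap S A s :=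
    fun s => Function.surjInv_eq hs _
  have hδ' : ∀ s t, algebraMap S A s = algebraMap S A t → δ s = δ t := fun s t h => by
    rw [← sub_eq_zero, ← map_sub]
    exact hδ _ (by rw [map_sub, h, sub_self])
  have hsmul : ∀ s (z : 𝕃), s • z = algebraMap S A s • z := fun s z => by
    rw [algebraMap_smul]
  let D : A →ₗ[K] 𝕃 :=
    { toFun := fun a => δ (Function.surjInv hs a)
      map_add' := fun a b => by
        rw [← map_add]
        exact hδ' _ _ (by simp [Function.surjInv_eq hs])
      map_smul' := fun c a => by
        rw [RingHom.id_apply, ← Derivation.map_smul]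
        refine hδ' _ _ ?_
        rw [Function.surjInv_eq hs, Algebra.smul_def c (Function.surjInv hs a), map_mul,
          Function.surjInv_eq hs, ← IsScalarTower.algebraMap_apply, ← Algebra.smul_def] }
  have hD : ∀ s, D (algebraMap S A s) = δ s := fun s => hδ' _ _ (hg s)
  refine ⟨Derivation.mk' D fun a b => ?_, hD⟩
  obtain ⟨s, rfl⟩ := hs a
  obtain ⟨t, rfl⟩ := hs b
  rw [← map_mul, hD, hD, hD, Derivation.leibniz, hsmul, hsmul]

lemma exists_derivation_of_formallyEtale [Algebra.FormallyEtale A 𝕃] (δ : Derivation K A 𝕃) :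
    ∃ D : Derivation K 𝕃 𝕃, ∀ a, D (algebraMap A 𝕃 a) = δ a := by
  let e := KaehlerDifferential.tensorKaehlerEquivOfFormallyEtale K A 𝕃
  let L : TensorProduct A 𝕃 (KaehlerDifferential K A) →ₗ[𝕃] 𝕃 :=
    δ.liftKaehlerDifferential.liftBaseChange 𝕃
  refine ⟨(L ∘ₗ e.symm.toLinearMap).compDer (KaehlerDifferential.D K 𝕃), fun a => ?_⟩
  have h1 := KaehlerDifferential.tensorKaehlerEquivOfFormallyEtale_symm_D_algebraMap K A 𝕃 a
  change L (e.symm (KaehlerDifferential.D K 𝕃 (algebraMap A 𝕃 a))) = δ a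
  rw [h1]
  simp [L]

end ExtendDerivation

section GenericPoint

universe u

variable {K : Type*} [Field K] {f : MvPolynomial (Fin 4) K} {d : ℕ} {e₀ e₁ w₂ w₃ : Fin 4 → K}

lemma aeval_det_hessMatrix {A : Type*} [CommRing A] [Algebra K A] (f : MvPolynomial (Fin 4) K)
    (P : Fin 4 → A) :
    aeval P (hessMatrix f (X : Fin 4 → MvPolynomial (Fin 4) K)).det = (hessMatrix f P).det := by
  refine (AlgHom.map_det (aeval P : MvPolynomial (Fin 4) K →ₐ[K] A) _).trans ?_
  congr 1
  ext i j
  simp [hessMatrix]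

lemma generic_point_of_formallyEtale {A 𝕃 : Type*} [CommRing A] [Field 𝕃] [Algebra K A]
    [Algebra (MvPolynomial (Fin 4) K) A] [Algebra K 𝕃] [Algebra (MvPolynomial (Fin 4) K) 𝕃]
    [Algebra A 𝕃] [IsScalarTower K (MvPolynomial (Fin 4) K) A]
    [IsScalarTower K (MvPolynomial (Fin 4) K) 𝕃] [IsScalarTower (MvPolynomial (Fin 4) K) A 𝕃]
    [IsScalarTower K A 𝕃] [Algebra.FormallyEtale A 𝕃]
    (hs : Function.Surjective (algebraMap (MvPolynomial (Fin 4) K) A))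
    (hinj : Function.Injective (algebraMap A 𝕃))
    (hker : ∀ g, algebraMap (MvPolynomial (Fin 4) K) A g = 0 ↔ f ∣ g) :
    ∃ P : Fin 4 → 𝕃, (∀ g : MvPolynomial (Fin 4) K, aeval P g = 0 ↔ f ∣ g) ∧
      ∀ w : Fin 4 → 𝕃, dir1 f P w = 0 → ∃ D : Derivation K 𝕃 𝕃, ∀ i, D (P i) = w i := by
  let P : Fin 4 → 𝕃 := fun i => algebraMap (MvPolynomial (Fin 4) K) 𝕃 (X i)
  have hP : ∀ g : MvPolynomial (Fin 4) K, aeval P g = algebraMap (MvPolynomial (Fin 4) K) 𝕃 g := by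
    intro g
    have : aeval P = IsScalarTower.toAlgHom K (MvPolynomial (Fin 4) K) 𝕃 := by
      ext i
      simp [P]
    rw [this]
    rfl
  have hP0 : ∀ g : MvPolynomial (Fin 4) K, aeval P g = 0 ↔ f ∣ g := fun g => by
    rw [hP, IsScalarTower.algebraMap_apply (MvPolynomial (Fin 4) K) A 𝕃, map_eq_zero_iff _ hinj,
      hker]
  refine ⟨P, hP0, fun w hw => ?_⟩
  let δ : Derivation K (MvPolynomial (Fin 4) K) 𝕃 := mkDerivation K w
  have hδX : ∀ i, δ (X i) = w i := fun i => mkDerivation_X _ _ _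
  have hδ : ∀ g, δ g = dir1 g P w := fun g => by
    have := derivation_aeval X δ g
    rw [aeval_X_left_apply] at this
    rw [this, dir1]
    refine Finset.sum_congr rfl fun i _ => ?_
    rw [aeval_X_left_apply, hδX, Algebra.smul_def, hP, mul_comm]
  obtain ⟨D₁, hD₁⟩ := exists_derivation_of_surjective (A := A) hs δ fun g hg => by
    obtain ⟨q, rfl⟩ := (hker g).1 hg
    rw [Derivation.leibniz, hδ f, hw, smul_zero, add_zero, Algebra.smul_def, ← hP,
      (hP0 f).2 dvd_rfl, zero_mul]
  obtain ⟨D, hD⟩ := exists_derivation_of_formallyEtale D₁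
  refine ⟨D, fun i => ?_⟩
  rw [← hδX, ← hD₁, ← hD, ← IsScalarTower.algebraMap_apply]

/-- A separably closed field with a generic point of the surface that can be moved in every tangent
direction. -/
lemma exists_generic_point {K : Type u} [Field K] {f : MvPolynomial (Fin 4) K} (hf : Prime f) :
    ∃ (𝕃 : Type u) (_ : Field 𝕃) (_ : IsSepClosed 𝕃) (_ : Algebra K 𝕃) (P : Fin 4 → 𝕃),
      (∀ g : MvPolynomial (Fin 4) K, aeval P g = 0 ↔ f ∣ g) ∧
      ∀ w : Fin 4 → 𝕃, dir1 f P w = 0 → ∃ D : Derivation K 𝕃 𝕃, ∀ i, D (P i) = w i := by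
  let A := MvPolynomial (Fin 4) K ⧸ Ideal.span {f}
  have : (Ideal.span {f}).IsPrime := (Ideal.span_singleton_prime hf.ne_zero).2 hf
  let F := FractionRing A
  let 𝕃 := SeparableClosure F
  letI : Algebra A 𝕃 := ((algebraMap F 𝕃).comp (algebraMap A F)).toAlgebra
  letI : Algebra K 𝕃 := ((algebraMap A 𝕃).comp (algebraMap K A)).toAlgebra
  letI : Algebra (MvPolynomial (Fin 4) K) 𝕃 :=
    ((algebraMap A 𝕃).comp (algebraMap (MvPolynomial (Fin 4) K) A)).toAlgebra
  have : IsScalarTower A F 𝕃 := @IsScalarTower.of_algebraMap_eq A F 𝕃 _ _ _ _ _ _ fun _ => rfl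
  have : IsScalarTower K A 𝕃 := @IsScalarTower.of_algebraMap_eq K A 𝕃 _ _ _ _ _ _ fun _ => rfl
  have : IsScalarTower (MvPolynomial (Fin 4) K) A 𝕃 :=
    @IsScalarTower.of_algebraMap_eq (MvPolynomial (Fin 4) K) A 𝕃 _ _ _ _ _ _ fun _ => rfl
  have : @IsScalarTower K (MvPolynomial (Fin 4) K) 𝕃 _ Algebra.toSMul Algebra.toSMul :=
    @IsScalarTower.of_algebraMap_eq K (MvPolynomial (Fin 4) K) 𝕃 _ _ _ _ _ _ fun _ => rfl
  have : Algebra.FormallyEtale A F := Algebra.FormallyEtale.of_isLocalization (nonZeroDivisors A)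
  have : Algebra.FormallyEtale F 𝕃 := Algebra.FormallyEtale.of_isSeparable F 𝕃
  have : Algebra.FormallyEtale A 𝕃 := Algebra.FormallyEtale.comp A F 𝕃
  have hinj : Function.Injective (algebraMap A 𝕃) :=
    (algebraMap F 𝕃).injective.comp (IsFractionRing.injective A F)
  exact ⟨𝕃, inferInstance, inferInstance, inferInstance,
    generic_point_of_formallyEtale (A := A) Ideal.Quotient.mk_surjective hinj
      fun g => Ideal.Quotient.eq_zero_iff_dvd _ _⟩

/-- The flecnodal polynomial of a smooth surface containing a line does not vanish identically on
the surface. -/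
lemma IsLineFrame.not_dvd_flecnodal [IsAlgClosed K] (h : IsLineFrame f d e₀ e₁ w₂ w₃) :
    ¬ f ∣ flecnodal f := by
  intro hdvd
  obtain ⟨𝕃, _, _, _, P, hP, hD⟩ := exists_generic_point h.irreducible.prime
  have h2 : (2 : 𝕃) ≠ 0 := by
    have := (map_ne_zero (algebraMap K 𝕃)).2 h.two_ne_zero
    rwa [map_ofNat] at this
  have : NeZero ((2 : ℕ) : 𝕃) := ⟨by exact_mod_cast h2⟩
  have hP0 : P ≠ 0 := by
    rintro rfl
    refine (by simpa using h.indep.ne_zero 0 : e₀ ≠ 0) (funext fun i => ?_)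
    obtain ⟨q, hq⟩ := (hP (X i)).1 (by simp)
    have h3 := congrArg (aeval e₀) hq
    have h4 := h.vanish 1 0
    rw [one_smul, zero_smul, add_zero] at h4
    rwa [map_mul, h4, zero_mul, aeval_X] at h3
  refine aeval_flecnodal_ne_zero_of_derivations h.three_le h.natCast_ne_zero h.smooth
    (fun a => IsSepClosed.exists_pow_nat_eq a 2) hP0 ((hP f).2 dvd_rfl) (fun hdet => ?_) hD
    ((hP _).2 hdvd)
  rw [← aeval_det_hessMatrix, hP] at hdet
  obtain ⟨q, hq⟩ := hdet
  apply h.frame_identities.2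
  rw [← aeval_det_hessMatrix, hq, map_mul, h.aeval_linePoint_eq_zero, zero_mul]

end GenericPoint

section HomEval

variable {D : Type*} [CommRing D]

/-- The value at `(u, w)` of the homogenization of `p` in degree `N`. -/
noncomputable def homEval (p : Polynomial D) (N : ℕ) (u w : D) : D :=
  MvPolynomial.eval ![u, w] (p.homogenize N)

lemma homEval_mul {p q : Polynomial D} {m n : ℕ} (hp : p.natDegree ≤ m) (hq : q.natDegree ≤ n)
    (u w : D) : homEval (p * q) (m + n) u w = homEval p m u w * homEval q n u w := by
  rw [homEval, Polynomial.homogenize_mul _ _ hp hq, map_mul, homEval, homEval]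

lemma homEval_C_mul_X_pow (c : D) {k n : ℕ} (hk : k ≤ n) (u w : D) :
    homEval (Polynomial.C c * Polynomial.X ^ k) n u w = c * u ^ k * w ^ (n - k) := by
  rw [homEval, Polynomial.homogenize_C_mul, Polynomial.homogenize_X_pow hk]
  simp [mul_assoc]

lemma homEval_sum {ι : Type*} (s : Finset ι) (p : ι → Polynomial D) (N : ℕ) (u w : D) :
    homEval (∑ i ∈ s, p i) N u w = ∑ i ∈ s, homEval (p i) N u w := by
  simp [homEval, Polynomial.homogenize_finsetSum]

lemma sum_projVandermonde_mul_coeff (p : Polynomial D) (N : ℕ) (u w : D) :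
    ∑ k : Fin (N + 1), u ^ (k : ℕ) * w ^ (k.rev : ℕ) * p.coeff k = homEval p N u w := by
  rw [homEval, Polynomial.homogenize, map_sum,
    Finset.Nat.sum_antidiagonal_eq_sum_range_succ_mk, ← Fin.sum_univ_eq_sum_range
      (fun k => MvPolynomial.eval ![u, w] (monomial
        ((Finsupp.single 0 k).update 1 (N - k)) (p.coeff k)))]
  refine Finset.sum_congr rfl fun k _ => ?_
  rw [eval_monomial, Finsupp.prod_fintype _ _ (by simp)]
  simp [Fin.prod_univ_two, Fin.val_rev]
  ring

variable {F Φ : Polynomial D} {m n : ℕ}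

lemma sylvester_castAdd (hΦ : Φ.natDegree ≤ n) (k : Fin (m + n)) (j : Fin m) :
    Polynomial.sylvester F Φ m n k (j.castAdd n) = (Polynomial.X ^ (j : ℕ) * Φ).coeff k := by
  simp only [Polynomial.sylvester, Matrix.of_apply, Fin.addCases_left, Set.mem_Icc,
    Polynomial.coeff_X_pow_mul']
  split_ifs with h1 h2 h2
  · rfl
  · omega
  · rw [Polynomial.coeff_eq_zero_of_natDegree_lt (by omega)]
  · rfl

lemma sylvester_natAdd (hF : F.natDegree ≤ m) (k : Fin (m + n)) (j : Fin n) :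
    Polynomial.sylvester F Φ m n k (j.natAdd m) = (Polynomial.X ^ (j : ℕ) * F).coeff k := by
  simp only [Polynomial.sylvester, Matrix.of_apply, Fin.addCases_right, Set.mem_Icc,
    Polynomial.coeff_X_pow_mul']
  split_ifs with h1 h2 h2
  · rfl
  · omega
  · rw [Polynomial.coeff_eq_zero_of_natDegree_lt (by omega)]
  · rfl

lemma dvd_sum_sylvester (hF : F.natDegree ≤ m) (hΦ : Φ.natDegree ≤ n) {q u w : D}
    (h1 : q ∣ homEval F m u w) (h2 : q ∣ homEval Φ n u w) (j : Fin (m + n)) :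
    q ∣ ∑ k : Fin (m + n), u ^ (k : ℕ) * w ^ (k.rev : ℕ) * Polynomial.sylvester F Φ m n k j := by
  have key : ∀ (N : ℕ) (p : Polynomial D) (c : Fin N → D), (∀ k : Fin N, c k = p.coeff k) →
      ∀ a b : ℕ, a + b + 1 = N → ∀ (i : ℕ), i ≤ a → ∀ G : Polynomial D, G.natDegree ≤ b →
      p = Polynomial.X ^ i * G → q ∣ homEval G b u w →
      q ∣ ∑ k : Fin N, u ^ (k : ℕ) * w ^ (k.rev : ℕ) * c k := by
    rintro N p c hc a b rfl i hi G hG rfl hq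
    simp only [hc]
    rw [sum_projVandermonde_mul_coeff,
      homEval_mul ((Polynomial.natDegree_X_pow_le i).trans hi) hG]
    exact hq.mul_left _
  refine Fin.addCases (fun j => ?_) (fun j => ?_) j
  · exact key _ _ _ (fun k => sylvester_castAdd hΦ k j) (m - 1) n (by have := j.2; omega) j
      (by have := j.2; omega) Φ hΦ
      rfl h2
  · exact key _ _ _ (fun k => sylvester_natAdd hF k j) (n - 1) m (by have := j.2; omega) j
      (by have := j.2; omega) F hF
      rfl h1

variable [IsDomain D]

lemma pow_dvd_resultant_of_fin (hF : F.natDegree ≤ m) (hΦ : Φ.natDegree ≤ n) {g : D}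
    (hg : Prime g) (u w : Fin (m + n) → D) (μ : Fin (m + n) → ℕ)
    (h1 : ∀ i, g ^ μ i ∣ homEval F m (u i) (w i)) (h2 : ∀ i, g ^ μ i ∣ homEval Φ n (u i) (w i))
    (h3 : ∀ i j, i ≠ j → ¬ g ∣ u i * w j - u j * w i) :
    g ^ ∑ i, μ i ∣ Polynomial.resultant F Φ m n := by
  have hV : ¬ g ∣ (Matrix.projVandermonde u w).det := by
    rw [Matrix.det_projVandermonde, hg.dvd_finsetProd_iff]
    rintro ⟨i, -, h⟩
    rw [hg.dvd_finsetProd_iff] at h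
    obtain ⟨j, hj, h⟩ := h
    exact h3 j i (Finset.mem_Ioi.1 hj).ne' h
  refine hg.pow_dvd_of_dvd_mul_left _ hV ?_
  rw [Polynomial.resultant, ← Matrix.det_mul]
  choose N hN using fun i j => dvd_sum_sylvester hF hΦ (h1 i) (h2 i) j
  have : Matrix.projVandermonde u w * Polynomial.sylvester F Φ m n =
      Matrix.of fun i j => g ^ μ i * N i j := by
    ext i j
    rw [Matrix.mul_apply, Matrix.of_apply, ← hN]
    rfl
  rw [this]
  refine ⟨(Matrix.of N).det, ?_⟩
  rw [← Finset.prod_pow_eq_pow_sum]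
  exact Matrix.det_mul_column (fun i => g ^ μ i) (Matrix.of N)

lemma pow_dvd_resultant_of_fintype {ι : Type*} [Fintype ι] (hι : Fintype.card ι = m + n)
    (hF : F.natDegree ≤ m) (hΦ : Φ.natDegree ≤ n) {g : D}
    (hg : Prime g) (u w : ι → D) (μ : ι → ℕ)
    (h1 : ∀ i, g ^ μ i ∣ homEval F m (u i) (w i)) (h2 : ∀ i, g ^ μ i ∣ homEval Φ n (u i) (w i))
    (h3 : ∀ i j, i ≠ j → ¬ g ∣ u i * w j - u j * w i) :
    g ^ ∑ i, μ i ∣ Polynomial.resultant F Φ m n := by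
  let e := Fintype.equivFinOfCardEq hι
  have := pow_dvd_resultant_of_fin hF hΦ hg (u ∘ e.symm) (w ∘ e.symm) (μ ∘ e.symm)
    (fun i => h1 _) (fun i => h2 _) (fun i j hij => h3 _ _ (e.symm.injective.ne hij))
  rwa [Function.comp_def, Equiv.sum_comp e.symm μ] at this

lemma pow_dvd_resultant_of_card_le (K : Type*) [Field K] [Infinite K] [Algebra K D] {ι : Type*}
    [Fintype ι] (hι : Fintype.card ι ≤ m + n)
    (hF : F.natDegree ≤ m) (hΦ : Φ.natDegree ≤ n) {g : D}
    (hg : Prime g) (u w : ι → D) (μ : ι → ℕ)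
    (h1 : ∀ i, g ^ μ i ∣ homEval F m (u i) (w i)) (h2 : ∀ i, g ^ μ i ∣ homEval Φ n (u i) (w i))
    (h3 : ∀ i j, i ≠ j → ¬ g ∣ u i * w j - u j * w i) (hw : ∀ i, ¬ g ∣ w i) :
    g ^ ∑ i, μ i ∣ Polynomial.resultant F Φ m n := by
  classical
  have hunit : ∀ a : K, g ∣ algebraMap K D a → a = 0 := fun a ha => by
    by_contra h0
    exact hg.not_isUnit (isUnit_of_dvd_unit ha ((Ne.isUnit h0).map (algebraMap K D)))
  have hbad : {c : K | ∃ i, g ∣ u i - algebraMap K D c * w i}.Finite := by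
    have : {c : K | ∃ i, g ∣ u i - algebraMap K D c * w i} =
        ⋃ i, {c : K | g ∣ u i - algebraMap K D c * w i} := by
      ext
      simp
    rw [this]
    refine Set.finite_iUnion fun i => Set.Subsingleton.finite fun c hc c' hc' => ?_
    have h := dvd_sub hc' hc
    rw [show u i - algebraMap K D c' * w i - (u i - algebraMap K D c * w i) =
      algebraMap K D (c - c') * w i by rw [map_sub]; ring] at h
    exact sub_eq_zero.1 (hunit _ ((hg.dvd_or_dvd h).resolve_right (hw i)))
  have : Infinite ↥({c : K | ∃ i, g ∣ u i - algebraMap K D c * w i}ᶜ) :=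
    hbad.infinite_compl.to_subtype
  let c := Infinite.natEmbedding ↥({c : K | ∃ i, g ∣ u i - algebraMap K D c * w i}ᶜ)
  have hc : ∀ k i, ¬ g ∣ u i - algebraMap K D (c k) * w i := fun k i h => (c k).2 ⟨i, h⟩
  have := pow_dvd_resultant_of_fintype (ι := ι ⊕ Fin (m + n - Fintype.card ι))
    (by simp; omega) hF hΦ hg (Sum.elim u fun k => algebraMap K D (c k))
    (Sum.elim w fun _ => 1) (Sum.elim μ fun _ => 0) ?_ ?_ ?_
  · simpa using this
  · rintro (i | k)
    · exact h1 i
    · simp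
  · rintro (i | k)
    · exact h2 i
    · simp
  · rintro (i | k) (j | l) hij
    · exact h3 i j (by simpa using hij)
    · simpa using hc l i
    · simp only [Sum.elim_inr, Sum.elim_inl, mul_one]
      rw [dvd_sub_comm]
      exact hc k j
    · simp only [Sum.elim_inr, mul_one, ← map_sub]
      intro h
      have := sub_eq_zero.1 (hunit _ h)
      exact hij (by rw [Fin.ext (c.injective (Subtype.ext this))])

end HomEval

section ResultantNeZero

variable {D : Type*} [CommRing D] [IsDomain D]

lemma resultant_ne_zero_of_prime {F Φ : Polynomial D} {m n : ℕ} (hF : F.natDegree ≤ m)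
    (hΦ : Φ.natDegree ≤ n) (hm : F.coeff m ≠ 0) (hp : Prime F) (hdvd : ¬ F ∣ Φ) :
    Polynomial.resultant F Φ m n ≠ 0 := by
  intro h
  obtain ⟨v, hv0, hv⟩ := Matrix.exists_mulVec_eq_zero_iff.2 h
  rw [← Polynomial.toMatrix_sylvesterMap' F Φ hF hΦ] at hv
  set b₁ := ((Polynomial.degreeLT.basis D m).prod (Polynomial.degreeLT.basis D n)).reindex
    finSumFinEquiv
  set x := b₁.equivFun.symm v with hx
  have hvx : v = b₁.repr x := by
    rw [hx]
    exact (b₁.equivFun.apply_symm_apply v).symm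
  have hx0 : x ≠ 0 := fun h0 => hv0 (by rw [hvx, h0]; simp)
  rw [hvx, LinearMap.toMatrix_mulVec_repr] at hv
  have hS : Polynomial.sylvesterMap F Φ hF hΦ x = 0 := by
    apply (Polynomial.degreeLT.basis D (m + n)).repr.injective
    ext i
    simpa using congrFun hv i
  have h1 : F * (x.2 : Polynomial D) + Φ * (x.1 : Polynomial D) = 0 := congrArg Subtype.val hS
  have h2 : F ∣ (x.1 : Polynomial D) := (hp.dvd_or_dvd (a := Φ) (Dvd.intro (-(x.2 : Polynomial D))
    (by linear_combination -h1))).resolve_left hdvd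
  have h3 : (x.1 : Polynomial D) = 0 := by
    refine Polynomial.eq_zero_of_dvd_of_degree_lt h2
      ((Polynomial.mem_degreeLT.1 x.1.2).trans_le ?_)
    exact Polynomial.le_degree_of_ne_zero hm
  rw [h3, mul_zero, add_zero] at h1
  exact hx0 (Prod.ext (Subtype.ext h3)
    (Subtype.ext ((mul_eq_zero.1 h1).resolve_left hp.ne_zero)))

end ResultantNeZero

section TotalDegree

variable {K σ : Type*} [Field K]

lemma totalDegree_det_le {ι : Type*} [Fintype ι] [DecidableEq ι]
    (M : Matrix ι ι (MvPolynomial σ K)) (c : ι → ℕ) (h : ∀ i j, (M i j).totalDegree ≤ c j) :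
    M.det.totalDegree ≤ ∑ j, c j := by
  rw [Matrix.det_apply]
  refine totalDegree_finsetSum_le fun s _ => (totalDegree_smul_le _ _).trans ?_
  exact (totalDegree_finsetProd _ _).trans (Finset.sum_le_sum fun j _ => h _ _)

lemma totalDegree_resultant_le {F Φ : Polynomial (MvPolynomial σ K)} {m n a b : ℕ}
    (hF : ∀ k, (F.coeff k).totalDegree ≤ a) (hΦ : ∀ k, (Φ.coeff k).totalDegree ≤ b) :
    (Polynomial.resultant F Φ m n).totalDegree ≤ m * b + n * a := by
  refine (totalDegree_det_le _ (Fin.append (fun _ : Fin m => b) (fun _ : Fin n => a)) ?_).trans ?_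
  · intro i j
    refine Fin.addCases (fun j => ?_) (fun j => ?_) j
    · rw [Fin.append_left]
      simp only [Polynomial.sylvester, Matrix.of_apply, Fin.addCases_left]
      split_ifs
      · exact hΦ _
      · simp
    · rw [Fin.append_right]
      simp only [Polynomial.sylvester, Matrix.of_apply, Fin.addCases_right]
      split_ifs
      · exact hF _
      · simp
  · rw [Fin.sum_univ_add]
    simp

end TotalDegree

section Spread

variable {K : Type*} [Field K] {f : MvPolynomial (Fin 4) K} {d : ℕ}

/-- The generic point of the span of a point on the first and of a point on the second coordinate
line, with coefficients `w` and `u`. -/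
noncomputable def spreadPoint (w u : MvPolynomial (Fin 4) K) : Fin 4 → MvPolynomial (Fin 4) K :=
  ![w * X 0, w * X 1, u * X 2, u * X 3]

/-- Restriction to the span of a generic point on the first and a generic point on the second
coordinate line. -/
noncomputable abbrev spreadHom :
    MvPolynomial (Fin 4) K →ₐ[K] Polynomial (MvPolynomial (Fin 4) K) :=
  weightHom ![0, 0, 1, 1]

lemma spreadHom_monomial (m : Fin 4 →₀ ℕ) (c : K) :
    spreadHom (monomial m c) = Polynomial.C (monomial m c) * Polynomial.X ^ (m 2 + m 3) := by
  rw [spreadHom, weightHom_monomial, Polynomial.C_mul_X_pow_eq_monomial]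
  congr 1
  simp [Finsupp.weight_apply, Finsupp.sum_fintype, Fin.sum_univ_four]

lemma apply_add_apply_le {m : Fin 4 →₀ ℕ} (hf : f.IsHomogeneous d) (hm : m ∈ f.support) :
    m 0 + m 1 + m 2 + m 3 = d := by
  have := hf (mem_support_iff.1 hm)
  rw [← this]
  simp [Finsupp.weight_apply, Finsupp.sum_fintype, Fin.sum_univ_four]

lemma homEval_spreadHom (hf : f.IsHomogeneous d) (w u : MvPolynomial (Fin 4) K) :
    homEval (spreadHom f) d u w = aeval (spreadPoint w u) f := by
  conv_lhs => rw [f.as_sum]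
  conv_rhs => rw [f.as_sum]
  rw [map_sum, map_sum, homEval_sum]
  refine Finset.sum_congr rfl fun m hm => ?_
  have h := apply_add_apply_le hf hm
  rw [spreadHom_monomial, homEval_C_mul_X_pow _ (by omega), aeval_monomial, monomial_eq,
    Finsupp.prod_fintype _ _ (by simp), Finsupp.prod_fintype _ _ (by simp)]
  simp only [Fin.prod_univ_four, spreadPoint, algebraMap_eq]
  rw [show d - (m 2 + m 3) = m 0 + m 1 by omega]
  simp [mul_pow, pow_add]
  ring

lemma natDegree_spreadHom_le (hf : f.IsHomogeneous d) : (spreadHom f).natDegree ≤ d := by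
  rw [f.as_sum, map_sum]
  refine Polynomial.natDegree_sum_le_of_forall_le _ _ fun m hm => ?_
  have h := apply_add_apply_le hf hm
  rw [spreadHom_monomial]
  exact (Polynomial.natDegree_C_mul_X_pow_le _ _).trans (by omega)

lemma totalDegree_coeff_spreadHom_le (hf : f.IsHomogeneous d) (k : ℕ) :
    ((spreadHom f).coeff k).totalDegree ≤ d := by
  rw [spreadHom, coeff_weightHom, weightedHomogeneousComponent_apply]
  refine totalDegree_finsetSum_le fun m hm => ?_
  have h := apply_add_apply_le hf (Finset.mem_filter.1 hm).1
  refine (totalDegree_monomial_le _ _).trans ?_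
  rw [Finsupp.sum_fintype _ _ (by simp), Fin.sum_univ_four]
  exact h.le

/-- Rescaling the first two variables. -/
noncomputable def rescaleHom : Polynomial (MvPolynomial (Fin 4) K) →+*
    Polynomial (MvPolynomial (Fin 4) K) :=
  Polynomial.eval₂RingHom (weightHom ![1, 1, 0, 0]).toRingHom Polynomial.X

lemma rescaleHom_spreadHom (hf : f.IsHomogeneous d) :
    rescaleHom (spreadHom f) = Polynomial.C f * Polynomial.X ^ d := by
  rw [← weightHom_one_of_isHomogeneous hf]
  have : (rescaleHom.comp (spreadHom (K := K)).toRingHom : MvPolynomial (Fin 4) K →+* _) =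
      (weightHom 1 : MvPolynomial (Fin 4) K →ₐ[K] _).toRingHom := by
    refine ringHom_ext (fun c => ?_) fun i => ?_
    · have h1 : ∀ w : Fin 4 → ℕ, weightHom w (C c) = Polynomial.C (C c) := fun w => by
        rw [← algebraMap_eq, AlgHom.commutes]
        rfl
      simp [h1, rescaleHom]
    · fin_cases i <;> simp [rescaleHom, weightHom]
  exact congrArg (fun φ : MvPolynomial (Fin 4) K →+* _ => φ f) this

lemma eq_of_rescaleHom_eq [Infinite K] {G : Polynomial (MvPolynomial (Fin 4) K)} {c : K} {m : ℕ}
    (h : rescaleHom G = Polynomial.C (C c) * Polynomial.X ^ m) :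
    G = Polynomial.C (C c) * Polynomial.X ^ m := by
  refine Polynomial.eq_of_infinite_eval_eq _ _ (Set.Infinite.mono (s := (fun s : K =>
    (C s : MvPolynomial (Fin 4) K)) '' {0}ᶜ) ?_
    ((Set.finite_singleton 0).infinite_compl.image (C_injective _ _).injOn))
  rintro _ ⟨s, hs, rfl⟩
  have h1 := congrArg (Polynomial.eval (C s)) h
  let θ : MvPolynomial (Fin 4) K →ₐ[K] MvPolynomial (Fin 4) K :=
    aeval ![C s * X 0, C s * X 1, X 2, X 3]
  let θ' : MvPolynomial (Fin 4) K →ₐ[K] MvPolynomial (Fin 4) K :=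
    aeval ![C s⁻¹ * X 0, C s⁻¹ * X 1, X 2, X 3]
  have hθ : ∀ p, θ' (θ p) = p := fun p => by
    have : θ'.comp θ = AlgHom.id K _ := by
      have hs1 : (C s⁻¹ : MvPolynomial (Fin 4) K) * C s = 1 := by
        rw [← C_mul, inv_mul_cancel₀ hs, C_1]
      ext i : 1
      have h0 : C s⁻¹ * X i * C s = (X i : MvPolynomial (Fin 4) K) := by
        rw [mul_right_comm, hs1, one_mul]
      fin_cases i <;> simp [θ, θ', algebraMap_eq, mul_comm (C s)] <;> exact h0
    exact congrArg (fun φ : MvPolynomial (Fin 4) K →ₐ[K] _ => φ p) this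
  have h2 : Polynomial.eval (C s) (rescaleHom G) = θ (Polynomial.eval (C s) G) := by
    have : (Polynomial.evalRingHom (C s)).comp rescaleHom =
        θ.toRingHom.comp (Polynomial.evalRingHom (C s)) := by
      refine Polynomial.ringHom_ext (fun p => ?_) ?_
      · have : ((Polynomial.aeval (C s : MvPolynomial (Fin 4) K)).restrictScalars K).comp
            (weightHom ![1, 1, 0, 0]) = θ := by
          ext i : 1
          fin_cases i <;> simp [θ, weightHom, mul_comm (C s)]
        simpa [rescaleHom, Polynomial.aeval_def] using
          congrArg (fun φ : MvPolynomial (Fin 4) K →ₐ[K] _ => φ p) this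
      · simp [rescaleHom, θ, algebraMap_eq]
    exact congrArg (fun φ : Polynomial (MvPolynomial (Fin 4) K) →+* _ => φ G) this
  rw [h2] at h1
  have h3 := congrArg θ' h1
  rw [hθ] at h3
  rw [Set.mem_ofPred_eq, h3]
  simp [θ', algebraMap_eq]

lemma irreducible_of_X_pow_mul_eq_spreadHom [Infinite K] (hf : f.IsHomogeneous d)
    (hirr : Irreducible f) {r : ℕ} {F : Polynomial (MvPolynomial (Fin 4) K)}
    (hF : Polynomial.X ^ r * F = spreadHom f) (h0 : F.coeff 0 ≠ 0) :
    Irreducible F := by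
  have hone : F.eval 1 = f := by
    have := congrArg (Polynomial.eval 1) hF
    rwa [Polynomial.eval_mul, Polynomial.eval_pow, Polynomial.eval_X, one_pow, one_mul,
      eval_one_weightHom] at this
  have hρ : ∀ G H, F = G * H → IsUnit (H.eval 1) → IsUnit H := by
    rintro G H rfl hu
    have h1 : rescaleHom H * (rescaleHom G * Polynomial.X ^ r) =
        Polynomial.C f * Polynomial.X ^ d := by
      rw [← rescaleHom_spreadHom hf, ← hF]
      simp [rescaleHom]
      ring
    obtain ⟨b, m, hb⟩ := Polynomial.exists_eq_C_mul_X_pow_of_mul hirr.ne_zero h1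
    have h2 : Polynomial.eval 1 (rescaleHom H) = H.eval 1 := by
      have : (Polynomial.evalRingHom 1).comp rescaleHom =
          (Polynomial.evalRingHom (1 : MvPolynomial (Fin 4) K)) := by
        refine Polynomial.ringHom_ext (fun p => ?_) ?_
        · simpa [rescaleHom] using eval_one_weightHom _ p
        · simp [rescaleHom]
      exact congrArg (fun φ : Polynomial (MvPolynomial (Fin 4) K) →+* _ => φ H) this
    rw [hb] at h2
    have h3 : b = H.eval 1 := by simpa using h2
    rw [← h3] at hu
    obtain ⟨c, hc, rfl⟩ := (isUnit_iff_eq_C_of_isReduced).1 hu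
    have h4 := eq_of_rescaleHom_eq hb
    have hm : m = 0 := by
      by_contra hm
      apply h0
      rw [Polynomial.mul_coeff_zero, h4]
      simp [Ne.symm hm]
    rw [h4, hm, pow_zero, mul_one]
    exact hu.map Polynomial.C
  have hnu : ¬ IsUnit F := fun hu => hirr.not_isUnit (hone ▸ hu.map (Polynomial.evalRingHom 1))
  refine ⟨hnu, fun G H hGH => ?_⟩
  have h1 : f = G.eval 1 * H.eval 1 := by rw [← hone, hGH, Polynomial.eval_mul]
  rcases hirr.isUnit_or_isUnit h1 with hu | hu
  · exact Or.inl (hρ H G (by rw [hGH, mul_comm]) hu)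
  · exact Or.inr (hρ G H hGH hu)

end Spread

section ProductOfPrimes

variable {D : Type*} [CommRing D] [IsDomain D] [DecompositionMonoid D]

lemma prod_pow_dvd_of_prime {ι : Type*} (S : Finset ι) (g : ι → D) (μ : ι → ℕ) {R : D}
    (hg : ∀ i ∈ S, Prime (g i))
    (h : ∀ i ∈ S, ∀ T : Finset ι, T ⊆ S → (∀ j ∈ T, Associated (g i) (g j)) →
      g i ^ ∑ j ∈ T, μ j ∣ R) :
    ∏ i ∈ S, g i ^ μ i ∣ R := by
  classical
  rw [← Finset.prod_fiberwise_of_maps_to (t := S.image fun i => Associates.mk (g i))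
    (g := fun i => Associates.mk (g i)) (fun i hi => Finset.mem_image_of_mem _ hi)]
  refine Finset.prod_dvd_of_isRelPrime ?_ ?_
  · intro a ha b hb hab
    refine IsRelPrime.prod_left fun i hi => IsRelPrime.prod_right fun j hj => ?_
    simp only [Finset.mem_filter] at hi hj
    refine IsRelPrime.pow ?_
    rw [(hg i hi.1).irreducible.isRelPrime_iff_not_dvd]
    intro hdvd
    refine hab ?_
    rw [← hi.2, ← hj.2, Associates.mk_eq_mk_iff_associated]
    exact (hg i hi.1).associated_of_dvd (hg j hj.1) hdvd
  · intro a ha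
    obtain ⟨i, hi, rfl⟩ := Finset.mem_image.1 ha
    have hT : ∀ j ∈ S.filter (fun j => Associates.mk (g j) = Associates.mk (g i)),
        Associated (g i) (g j) := fun j hj =>
      (Associates.mk_eq_mk_iff_associated.1 (Finset.mem_filter.1 hj).2).symm
    refine dvd_trans (Associated.dvd ?_) (h i hi _ (Finset.filter_subset _ S) hT)
    rw [← Finset.prod_pow_eq_pow_sum]
    exact Associated.prod _ _ _ fun j hj => ((hT j hj).symm).pow_pow

lemma card_le_of_homEval {ι : Type*} [Fintype ι] {F : Polynomial D} {m : ℕ}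
    {g : D} (hg : Prime g) (u w : ι → D)
    (h1 : ∀ i, g ∣ homEval F m (u i) (w i))
    (h3 : ∀ i j, i ≠ j → ¬ g ∣ u i * w j - u j * w i) {k : ℕ} (hk : k ≤ m)
    (hFk : ¬ g ∣ F.coeff k) : Fintype.card ι ≤ m := by
  by_contra! hm
  obtain ⟨e⟩ : Nonempty (Fin (m + 1) ↪ ι) :=
    Function.Embedding.nonempty_of_card_le (by simpa using hm)
  set V := Matrix.projVandermonde (u ∘ e) (w ∘ e) with hV
  have hdet : ¬ g ∣ V.det := by
    rw [Matrix.det_projVandermonde, hg.dvd_finsetProd_iff]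
    rintro ⟨i, -, h⟩
    rw [hg.dvd_finsetProd_iff] at h
    obtain ⟨j, hj, h⟩ := h
    exact h3 _ _ (e.injective.ne (Finset.mem_Ioi.1 hj).ne') h
  have h4 : ∀ i, g ∣ V.mulVec (fun k => F.coeff k) i := fun i => by
    rw [Matrix.mulVec, dotProduct]
    have := sum_projVandermonde_mul_coeff F m (u (e i)) (w (e i))
    have h5 := h1 (e i)
    rw [← this] at h5
    exact h5
  have h6 : V.det • (fun k : Fin (m + 1) => F.coeff k) =
      V.adjugate.mulVec (V.mulVec fun k => F.coeff k) := by
    rw [Matrix.mulVec_mulVec, Matrix.adjugate_mul, Matrix.smul_mulVec, Matrix.one_mulVec]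
  have h7 : g ∣ V.det * F.coeff k := by
    have := congrFun h6 ⟨k, by omega⟩
    rw [Pi.smul_apply, smul_eq_mul] at this
    rw [this, Matrix.mulVec, dotProduct]
    exact Finset.dvd_sum fun j _ => (h4 j).mul_left _
  exact (hg.dvd_or_dvd h7).elim hdet hFk

end ProductOfPrimes

section LineRoots

variable {K : Type*} [Field K]

/-- Modulo `g`, the generic spread point with coefficients `w` and `u` lies on the line `W`. -/
structure IsLineRoot (W : Submodule K (Fin 4 → K)) (g w u : MvPolynomial (Fin 4) K) : Prop where
  exists_lift : ∃ y q : Fin 4 → MvPolynomial (Fin 4) K,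
    (∀ v : Fin 4 → K, (fun i => eval v (y i)) ∈ W) ∧ spreadPoint w u = y + g • q
  vanish_of_dvd : ∀ l : Fin 4 → K, g ∣ ∑ i, C (l i) * spreadPoint w u i →
    ∀ v ∈ W, ∑ i, l i * v i = 0
  not_dvd_left : ¬ g ∣ w
  not_dvd_right : ¬ g ∣ u

lemma aeval_eq_zero_of_forall_eval_mem [Infinite K] {W : Submodule K (Fin 4 → K)}
    {y : Fin 4 → MvPolynomial (Fin 4) K} (hy : ∀ v : Fin 4 → K, (fun i => eval v (y i)) ∈ W)
    {h : MvPolynomial (Fin 4) K} (hh : ∀ v ∈ W, aeval v h = 0) : aeval y h = 0 := by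
  refine MvPolynomial.funext fun v => ?_
  rw [map_zero, ← coe_aeval_eq_eval]
  change aeval v (aeval y h) = 0
  rw [map_aeval_point]
  exact hh _ (hy v)

lemma dvd_aeval_add_smul_sub {D : Type*} [CommRing D] [Algebra K D] (h : MvPolynomial (Fin 4) K)
    (g : D) (y q : Fin 4 → D) : g ∣ aeval (y + g • q) h - aeval y h := by
  rw [← Ideal.mem_span_singleton, ← Ideal.Quotient.eq]
  let π := Ideal.Quotient.mkₐ K (Ideal.span {g})
  change π (aeval (y + g • q) h) = π (aeval y h)
  rw [map_aeval_point, map_aeval_point]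
  congr 2
  ext i
  have : π g = 0 := Ideal.Quotient.eq_zero_iff_mem.2 (Ideal.mem_span_singleton_self g)
  simp [this]

namespace IsLineRoot

variable {W W' : Submodule K (Fin 4 → K)} {g w u w' u' : MvPolynomial (Fin 4) K}

lemma dvd_aeval [Infinite K] (hW : IsLineRoot W g w u) {h : MvPolynomial (Fin 4) K}
    (hh : ∀ v ∈ W, aeval v h = 0) : g ∣ aeval (spreadPoint w u) h := by
  obtain ⟨y, q, hy, hx⟩ := hW.exists_lift
  have := dvd_aeval_add_smul_sub h g y q
  rwa [← hx, aeval_eq_zero_of_forall_eval_mem hy hh, sub_zero] at this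

lemma of_associated (hW : IsLineRoot W g w u) {g' : MvPolynomial (Fin 4) K}
    (hg : Associated g g') : IsLineRoot W g' w u := by
  obtain ⟨y, q, hy, hx⟩ := hW.exists_lift
  obtain ⟨c, hc⟩ := hg.dvd'
  refine ⟨⟨y, c • q, hy, ?_⟩, fun l hl => hW.vanish_of_dvd l (hg.dvd.trans hl),
    fun h => hW.not_dvd_left (hg.dvd.trans h), fun h => hW.not_dvd_right (hg.dvd.trans h)⟩
  rw [hx, smul_smul, hc]

lemma not_dvd_of_ne [Infinite K] (hW : IsLineRoot W g w u) (hW' : IsLineRoot W' g w' u')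
    (hg : Prime g)
    (h2 : Module.finrank K W = 2) (h2' : Module.finrank K W' = 2) (hne : W ≠ W') :
    ¬ g ∣ u * w' - u' * w := by
  intro hdvd
  have hle : ¬ W ≤ W' := fun h => hne (Submodule.eq_of_le_of_finrank_eq h (by rw [h2, h2']))
  obtain ⟨v, hv, hv'⟩ := SetLike.not_le_iff_exists.1 hle
  obtain ⟨L, hL, hLW⟩ := Submodule.exists_le_ker_of_notMem hv'
  have hLl : ∀ x : Fin 4 → K, L x = ∑ i, L (Pi.single i 1) * x i := fun x => by
    rw [LinearMap.pi_apply_eq_sum_univ L x]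
    refine Finset.sum_congr rfl fun i _ => ?_
    rw [smul_eq_mul, mul_comm]
    congr 2
    ext j
    simp [Pi.single_apply, eq_comm]
  set l : Fin 4 → K := fun i => L (Pi.single i 1) with hl
  have h1 : g ∣ ∑ i, C (l i) * spreadPoint w' u' i := by
    have := hW'.dvd_aeval (h := ∑ i, C (l i) * X i) fun x hx => by
      have h3 := hLW hx
      rw [LinearMap.mem_ker, hLl] at h3
      simpa using h3
    simpa [map_sum, algebraMap_eq] using this
  have h3 : g ∣ w' * ∑ i, C (l i) * spreadPoint w u i := by
    have h4 : w' * ∑ i, C (l i) * spreadPoint w u i = w * ∑ i, C (l i) * spreadPoint w' u' i +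
        (u * w' - u' * w) * (C (l 2) * X 2 + C (l 3) * X 3) := by
      simp only [Fin.sum_univ_four, spreadPoint]
      simp
      ring
    rw [h4]
    exact dvd_add (h1.mul_left _) (hdvd.mul_right _)
  have h5 := hW.vanish_of_dvd l ((hg.dvd_or_dvd h3).resolve_left hW'.not_dvd_left) v hv
  exact hL (by rw [hLl, h5])

end IsLineRoot

variable [Infinite K] {f φ : MvPolynomial (Fin 4) K} {d e : ℕ}

lemma pow_dvd_homEval_of_spreadHom (hf : f.IsHomogeneous d) {r : ℕ} (hr : 2 * r ≤ d)
    {F : Polynomial (MvPolynomial (Fin 4) K)} (hF : Polynomial.X ^ r * F = spreadHom f)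
    (hFd : F.natDegree ≤ d - 2 * r) {g w u : MvPolynomial (Fin 4) K} (hg : Prime g)
    (hw : ¬ g ∣ w) (hu : ¬ g ∣ u) {μ : ℕ} (h : g ^ μ ∣ aeval (spreadPoint w u) f) :
    g ^ μ ∣ homEval F (d - 2 * r) u w := by
  rw [← homEval_spreadHom hf, ← hF] at h
  obtain ⟨k, hk⟩ := Nat.exists_eq_add_of_le hr
  have h1 : homEval (Polynomial.X ^ r * F) d u w = (u ^ r * w ^ r) * homEval F (d - 2 * r) u w := by
    conv_lhs => rw [hk]
    rw [homEval_mul ((Polynomial.natDegree_X_pow_le r).trans (by omega)) (by omega),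
      show (Polynomial.X : Polynomial (MvPolynomial (Fin 4) K)) ^ r =
        Polynomial.C 1 * Polynomial.X ^ r by simp, homEval_C_mul_X_pow _ (by omega),
      show 2 * r - r = r by omega, show d - 2 * r = k by omega, one_mul]
  rw [h1] at h
  refine hg.pow_dvd_of_dvd_mul_left _ (fun h2 => ?_) h
  rcases hg.dvd_or_dvd h2 with h3 | h3
  · exact hu (hg.dvd_of_dvd_pow h3)
  · exact hw (hg.dvd_of_dvd_pow h3)

/-- The resultant is divisible by the product of the equations of the lines. -/
lemma prod_pow_dvd_resultant (hf : f.IsHomogeneous d) (hφ : φ.IsHomogeneous e) {r : ℕ}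
    (hrd : 2 * r ≤ d) (hre : 2 * r ≤ e) {F Φ : Polynomial (MvPolynomial (Fin 4) K)}
    (hF : Polynomial.X ^ r * F = spreadHom f) (hΦ : Polynomial.X ^ r * Φ = spreadHom φ)
    (hFd : F.natDegree ≤ d - 2 * r) (hΦe : Φ.natDegree ≤ e - 2 * r)
    (S : Finset (Submodule K (Fin 4 → K))) (hS : ∀ W ∈ S, Module.finrank K W = 2)
    (g w u : Submodule K (Fin 4 → K) → MvPolynomial (Fin 4) K)
    (μ : Submodule K (Fin 4 → K) → ℕ) (hg : ∀ W ∈ S, Prime (g W))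
    (hgf : ∀ W ∈ S, ¬ g W ∣ f) (hroot : ∀ W ∈ S, IsLineRoot W (g W) (w W) (u W))
    (hμ : ∀ W ∈ S, μ W ≠ 0)
    (h1 : ∀ W ∈ S, g W ^ μ W ∣ aeval (spreadPoint (w W) (u W)) f)
    (h2 : ∀ W ∈ S, g W ^ μ W ∣ aeval (spreadPoint (w W) (u W)) φ) :
    ∏ W ∈ S, g W ^ μ W ∣ Polynomial.resultant F Φ (d - 2 * r) (e - 2 * r) := by
  refine prod_pow_dvd_of_prime S g μ hg fun W₀ hW₀ T hT hass => ?_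
  have hp := hg W₀ hW₀
  have hr : ∀ W : T, IsLineRoot (W : Submodule K (Fin 4 → K)) (g W₀) (w W) (u W) := fun W =>
    (hroot W (hT W.2)).of_associated (hass W W.2).symm
  have hd1 : ∀ W : T, g W₀ ^ μ W ∣ homEval F (d - 2 * r) (u W) (w W) := fun W =>
    pow_dvd_homEval_of_spreadHom hf hrd hF hFd hp (hr W).not_dvd_left (hr W).not_dvd_right
      (((hass W W.2).pow_pow (n := μ W)).dvd.trans (h1 W (hT W.2)))
  have hd2 : ∀ W : T, g W₀ ^ μ W ∣ homEval Φ (e - 2 * r) (u W) (w W) := fun W =>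
    pow_dvd_homEval_of_spreadHom hφ hre hΦ hΦe hp (hr W).not_dvd_left (hr W).not_dvd_right
      (((hass W W.2).pow_pow (n := μ W)).dvd.trans (h2 W (hT W.2)))
  have hd3 : ∀ W W' : T, W ≠ W' → ¬ g W₀ ∣ u W * w W' - u W' * w W := fun W W' hne =>
    (hr W).not_dvd_of_ne (hr W') hp (hS W (hT W.2)) (hS W' (hT W'.2))
      (fun h => hne (Subtype.ext h))
  have hcard : Fintype.card T ≤ d - 2 * r := by
    have : ∃ k, ¬ g W₀ ∣ F.coeff k := by
      by_contra! hall
      refine hgf W₀ hW₀ ?_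
      have h3 := congrArg (Polynomial.eval 1) hF
      rw [Polynomial.eval_mul, Polynomial.eval_pow, Polynomial.eval_X, one_pow, one_mul,
        eval_one_weightHom] at h3
      rw [← h3, Polynomial.eval_eq_sum_range]
      exact Finset.dvd_sum fun k _ => (hall k).mul_right _
    obtain ⟨k, hk⟩ := this
    refine card_le_of_homEval hp (fun W : T => u W) (fun W : T => w W)
      (fun W => (dvd_pow_self _ (hμ W (hT W.2))).trans (hd1 W)) hd3 (k := k) ?_ hk
    by_contra hlt
    exact hk (by rw [Polynomial.coeff_eq_zero_of_natDegree_lt (by omega)]; exact dvd_zero _)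
  have := pow_dvd_resultant_of_card_le K (ι := T) (by omega) hFd hΦe hp
    (fun W : T => u W) (fun W : T => w W) (fun W : T => μ W) hd1 hd2 hd3
    (fun W => (hr W).not_dvd_left)
  rwa [Finset.sum_coe_sort T μ] at this

end LineRoots

section LineRootExistence

variable {K : Type*} [Field K]

/-- The subspace `W` meets the coordinate line on which the coordinates `i` and `j` vanish. -/
def MeetsCoordLine (W : Submodule K (Fin 4 → K)) (i j : Fin 4) : Prop :=
  ∃ v ∈ W, v ≠ 0 ∧ v i = 0 ∧ v j = 0

lemma MeetsCoordLine.of_minor_eq_zero {W : Submodule K (Fin 4 → K)} {p q : Fin 4 → K}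
    (hp : p ∈ W) (hq : q ∈ W) (hpq : LinearIndependent K ![p, q]) {i j : Fin 4}
    (h : p i * q j - p j * q i = 0) : MeetsCoordLine W i j := by
  rw [LinearIndependent.pair_iff] at hpq
  have key : ∀ a b : K, a ≠ 0 → a • p + b • q ≠ 0 := fun a b ha h0 => ha (hpq a b h0).1
  have key' : ∀ a b : K, b ≠ 0 → a • p + b • q ≠ 0 := fun a b ha h0 => ha (hpq a b h0).2
  have hmem : ∀ a b : K, a • p + b • q ∈ W := fun a b =>
    W.add_mem (W.smul_mem _ hp) (W.smul_mem _ hq)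
  by_cases hi : p i = 0
  · by_cases hj : p j = 0
    · exact ⟨p, hp, by simpa using key 1 0 one_ne_zero, hi, hj⟩
    · refine ⟨_, hmem (q j) (-p j), key' _ _ (neg_ne_zero.2 hj), ?_, ?_⟩
      · simp only [Pi.add_apply, Pi.smul_apply, smul_eq_mul]
        linear_combination h
      · simp only [Pi.add_apply, Pi.smul_apply, smul_eq_mul]
        ring
  · refine ⟨_, hmem (q i) (-p i), key' _ _ (neg_ne_zero.2 hi), ?_, ?_⟩
    · simp only [Pi.add_apply, Pi.smul_apply, smul_eq_mul]
      ring
    · simp only [Pi.add_apply, Pi.smul_apply, smul_eq_mul]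
      linear_combination -h

lemma exists_linearIndependent_pair {W : Submodule K (Fin 4 → K)} (hW : Module.finrank K W = 2)
    {p : Fin 4 → K} (hp : p ∈ W) (hp0 : p ≠ 0) :
    ∃ q ∈ W, LinearIndependent K ![p, q] ∧ ∀ v ∈ W, ∃ a b : K, v = a • p + b • q := by
  have h1 : LinearIndependent K ![(⟨p, hp⟩ : W)] :=
    LinearIndependent.of_subsingleton 0 (by simpa using hp0)
  obtain ⟨q, hq⟩ := exists_linearIndependent_cons_of_lt_finrank h1 (by omega)
  have hli : LinearIndependent K ![(⟨p, hp⟩ : W), q] := by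
    rw [LinearIndependent.pair_iff] at *
    intro s t hst
    have := (Fintype.linearIndependent_iff.1 hq) ![t, s] (by
      simpa [Fin.sum_univ_succ, add_comm] using hst)
    exact ⟨by simpa using this 1, by simpa using this 0⟩
  refine ⟨q, q.2, ?_, fun v hv => ?_⟩
  · rw [LinearIndependent.pair_iff] at hli ⊢
    exact fun s t hst => hli s t (Subtype.ext (by simpa using hst))
  · have hspan := hli.span_eq_top_of_card_eq_finrank' (by simp [hW])
    have : (⟨v, hv⟩ : W) ∈ Submodule.span K (Set.range ![(⟨p, hp⟩ : W), q]) := by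
      rw [hspan]; trivial
    rw [Matrix.range_cons, Matrix.range_cons, Matrix.range_empty, Set.union_empty,
      Set.singleton_union, Submodule.mem_span_pair] at this
    obtain ⟨a, b, hab⟩ := this
    exact ⟨a, b, by simpa using (congrArg Subtype.val hab).symm⟩

lemma exists_linear_form_of_isHomogeneous_one {P : MvPolynomial (Fin 4) K}
    (hP : P.IsHomogeneous 1) : ∃ a : Fin 4 → K, P = ∑ i, C (a i) * X i := by
  have : P ∈ homogeneousSubmodule (Fin 4) K 1 := hP
  rw [homogeneousSubmodule_one_eq_span_X, Submodule.mem_span_range_iff_exists_fun] at this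
  obtain ⟨a, ha⟩ := this
  exact ⟨a, by simp only [← ha, smul_eq_C_mul]⟩

/-- A bilinear form in `X 0, X 1` and `X 2, X 3`. -/
noncomputable def bilinearPoly (a b c d : K) : MvPolynomial (Fin 4) K :=
  C a * (X 0 * X 2) + C b * (X 0 * X 3) + C c * (X 1 * X 2) + C d * (X 1 * X 3)

lemma bilinearPoly_isHomogeneous (a b c d : K) : (bilinearPoly a b c d).IsHomogeneous 2 := by
  have h : ∀ (s : K) (i j : Fin 4), (C s * (X i * X j) : MvPolynomial (Fin 4) K).IsHomogeneous 2 :=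
    fun s i j => by
      simpa using (isHomogeneous_C (Fin 4) s).mul ((isHomogeneous_X K i).mul (isHomogeneous_X K j))
  exact (((h _ _ _).add (h _ _ _)).add (h _ _ _)).add (h _ _ _)

lemma eval_bilinearPoly (a b c d : K) (v : Fin 4 → K) : eval v (bilinearPoly a b c d) =
    a * (v 0 * v 2) + b * (v 0 * v 3) + c * (v 1 * v 2) + d * (v 1 * v 3) := by
  simp [bilinearPoly]

lemma isUnit_of_isHomogeneous_zero {P : MvPolynomial (Fin 4) K} (hP : P.IsHomogeneous 0)
    (h0 : P ≠ 0) : IsUnit P := by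
  rw [← totalDegree_zero_iff_isHomogeneous, totalDegree_eq_zero_iff_eq_C] at hP
  rw [hP] at h0 ⊢
  refine IsUnit.map _ (isUnit_iff_ne_zero.2 fun h => h0 (by rw [h, C_0]))

lemma prime_bilinearPoly {a b c d : K} (h : a * d - b * c ≠ 0) :
    Prime (bilinearPoly a b c d) := by
  have hhom := bilinearPoly_isHomogeneous a b c d
  have hne : bilinearPoly a b c d ≠ 0 := by
    intro h0
    have h1 := fun v => eval_bilinearPoly a b c d v
    simp only [h0, map_zero] at h1
    have e1 := h1 ![1, 0, 1, 0]
    have e2 := h1 ![1, 0, 0, 1]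
    simp at e1 e2
    exact h (by rw [← e1, ← e2]; ring)
  refine Irreducible.prime ⟨fun hu => ?_, fun P Q hPQ => ?_⟩
  · have h1 := hu.map (eval (0 : Fin 4 → K))
    rw [eval_bilinearPoly] at h1
    simp at h1
  · obtain ⟨k, hk⟩ := isHomogeneous_of_mul hhom hne hPQ
    obtain ⟨l, hl⟩ := isHomogeneous_of_mul hhom hne (hPQ.trans (mul_comm _ _))
    have hP0 : P ≠ 0 := fun h0 => hne (by rw [hPQ, h0, zero_mul])
    have hQ0 : Q ≠ 0 := fun h0 => hne (by rw [hPQ, h0, mul_zero])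
    have hkl : k + l = 2 := by
      have := hk.mul hl
      rw [← hPQ] at this
      exact this.inj_right hhom hne
    rcases Nat.lt_or_ge k 1 with hk1 | hk1
    · obtain rfl : k = 0 := by omega
      exact Or.inl (isUnit_of_isHomogeneous_zero hk hP0)
    rcases Nat.lt_or_ge l 1 with hl1 | hl1
    · obtain rfl : l = 0 := by omega
      exact Or.inr (isUnit_of_isHomogeneous_zero hl hQ0)
    obtain rfl : k = 1 := by omega
    obtain rfl : l = 1 := by omega
    obtain ⟨s, rfl⟩ := exists_linear_form_of_isHomogeneous_one hk
    obtain ⟨t, rfl⟩ := exists_linear_form_of_isHomogeneous_one hl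
    exfalso
    have h1 := fun v => eval_bilinearPoly a b c d v
    simp only [hPQ, map_mul, map_sum, Fin.sum_univ_four] at h1
    have e0 := h1 ![1, 0, 0, 0]
    have e1 := h1 ![0, 1, 0, 0]
    have e2 := h1 ![0, 0, 1, 0]
    have e3 := h1 ![0, 0, 0, 1]
    have e01 := h1 ![1, 1, 0, 0]
    have e02 := h1 ![1, 0, 1, 0]
    have e03 := h1 ![1, 0, 0, 1]
    have e12 := h1 ![0, 1, 1, 0]
    have e13 := h1 ![0, 1, 0, 1]
    have e23 := h1 ![0, 0, 1, 1]
    simp [-mul_eq_zero] at e0 e1 e2 e3 e01 e02 e03 e12 e13 e23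
    have e01' : s 0 * t 1 + s 1 * t 0 = 0 := by linear_combination e01 - e0 - e1
    have e23' : s 2 * t 3 + s 3 * t 2 = 0 := by linear_combination e23 - e2 - e3
    have h01 : s 0 * t 1 = 0 := by
      have : (s 0 * t 1) ^ 2 = 0 := by
        linear_combination (s 0 * t 1) * e01' - s 1 * t 1 * e0
      exact pow_eq_zero_iff (by norm_num) |>.1 this
    have h10 : s 1 * t 0 = 0 := by linear_combination e01' - h01
    have ea : a = s 0 * t 2 + s 2 * t 0 := by linear_combination -e02 + e0 + e2
    have eb : b = s 0 * t 3 + s 3 * t 0 := by linear_combination -e03 + e0 + e3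
    have ec : c = s 1 * t 2 + s 2 * t 1 := by linear_combination -e12 + e1 + e2
    have ed : d = s 1 * t 3 + s 3 * t 1 := by linear_combination -e13 + e1 + e3
    apply h
    rw [ea, eb, ec, ed]
    linear_combination (s 3 * t 2 - s 2 * t 3) * h01 + (s 2 * t 3 - s 3 * t 2) * h10

lemma prime_linear {a b : K} (i j : Fin 4) (hij : i ≠ j) (h : ¬ (a = 0 ∧ b = 0)) :
    Prime (C a * X i + C b * X j : MvPolynomial (Fin 4) K) ∧
      (C a * X i + C b * X j : MvPolynomial (Fin 4) K).totalDegree = 1 := by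
  set L : MvPolynomial (Fin 4) K := C a * X i + C b * X j with hL
  have hhom : L.IsHomogeneous 1 := (isHomogeneous_C_mul_X a i).add (isHomogeneous_C_mul_X b j)
  have hev : ∀ v : Fin 4 → K, eval v L = a * v i + b * v j := fun v => by simp [hL]
  have hne : L ≠ 0 := by
    intro h0
    simp only [h0, map_zero] at hev
    refine h ⟨?_, ?_⟩
    · simpa [hij.symm] using (hev (Pi.single i 1)).symm
    · simpa [hij] using (hev (Pi.single j 1)).symm
  have hdeg := hhom.totalDegree hne
  refine ⟨Irreducible.prime ⟨fun hu => ?_, fun P Q hPQ => ?_⟩, hdeg⟩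
  · have h1 := hu.map (eval (0 : Fin 4 → K))
    rw [hev] at h1
    simp at h1
  · have hP0 : P ≠ 0 := fun h0 => hne (by rw [hPQ, h0, zero_mul])
    have hQ0 : Q ≠ 0 := fun h0 => hne (by rw [hPQ, h0, mul_zero])
    rw [hPQ, totalDegree_mul_of_isDomain hP0 hQ0] at hdeg
    rcases Nat.eq_zero_or_pos P.totalDegree with h1 | h1
    · exact Or.inl (isUnit_of_isHomogeneous_zero ((totalDegree_zero_iff_isHomogeneous _).1 h1) hP0)
    · exact Or.inr (isUnit_of_isHomogeneous_zero
        ((totalDegree_zero_iff_isHomogeneous _).1 (by omega)) hQ0)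

lemma IsLineRoot.of_points {W : Submodule K (Fin 4 → K)} {p q : Fin 4 → K} (hp : p ∈ W)
    (hq : q ∈ W) (hspan : ∀ v ∈ W, ∃ a b : K, v = a • p + b • q)
    {g w u A B : MvPolynomial (Fin 4) K} (r : Fin 4 → MvPolynomial (Fin 4) K)
    (hx : ∀ i, spreadPoint w u i = A * C (p i) + B * C (q i) + g * r i) (v₁ v₂ : Fin 4 → K)
    (hg₁ : eval v₁ g = 0) (hg₂ : eval v₂ g = 0)
    (hdet : eval v₁ A * eval v₂ B - eval v₁ B * eval v₂ A ≠ 0)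
    (hw : eval v₁ w ≠ 0) (hu : eval v₁ u ≠ 0) : IsLineRoot W g w u := by
  have hnd : ∀ h : MvPolynomial (Fin 4) K, eval v₁ h ≠ 0 → ¬ g ∣ h := by
    rintro h hh ⟨k, rfl⟩
    exact hh (by rw [map_mul, hg₁, zero_mul])
  refine ⟨⟨fun i => A * C (p i) + B * C (q i), r, fun v => ?_, ?_⟩, fun l hl v hv => ?_,
    hnd _ hw, hnd _ hu⟩
  · have : (fun i => eval v (A * C (p i) + B * C (q i))) = eval v A • p + eval v B • q := by
      ext i
      simp
    rw [this]
    exact W.add_mem (W.smul_mem _ hp) (W.smul_mem _ hq)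
  · ext1 i
    simp [hx i]
  · have key : ∀ v', eval v' g = 0 →
        eval v' A * ∑ i, l i * p i + eval v' B * ∑ i, l i * q i = 0 := fun v' hv' => by
      obtain ⟨k, hk⟩ := hl
      have := congrArg (eval v') hk
      simp only [hx, map_sum, map_mul, map_add, eval_C, hv', zero_mul, add_zero] at this
      rw [← this, Finset.mul_sum, Finset.mul_sum, ← Finset.sum_add_distrib]
      exact Finset.sum_congr rfl fun i _ => by ring
    have k1 := key v₁ hg₁
    have k2 := key v₂ hg₂
    have hlp : ∑ i, l i * p i = 0 := by
      refine (mul_eq_zero.1 ?_).resolve_left hdet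
      linear_combination eval v₂ B * k1 - eval v₁ B * k2
    have hlq : ∑ i, l i * q i = 0 := by
      refine (mul_eq_zero.1 ?_).resolve_left hdet
      linear_combination eval v₁ A * k2 - eval v₂ A * k1
    obtain ⟨a, b, rfl⟩ := hspan v hv
    have : ∑ i, l i * (a • p + b • q) i = a * ∑ i, l i * p i + b * ∑ i, l i * q i := by
      rw [Finset.mul_sum, Finset.mul_sum, ← Finset.sum_add_distrib]
      exact Finset.sum_congr rfl fun i _ => by simp; ring
    rw [this, hlp, hlq, mul_zero, mul_zero, add_zero]

/-- The order of vanishing of `g` along the third coordinate line is at most one, and it is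
zero unless `W` meets that line. -/
def HasEdgeOrder (W : Submodule K (Fin 4 → K)) (g : MvPolynomial (Fin 4) K) : Prop :=
  (weightHom ![0, 1, 0, 1] g).coeff 0 ≠ 0 ∨
    MeetsCoordLine W 1 3 ∧ (weightHom ![0, 1, 0, 1] g).coeff 1 ≠ 0

lemma weightHom_X (w : Fin 4 → ℕ) (i : Fin 4) :
    weightHom (K := K) w (X i) = Polynomial.C (X i) * Polynomial.X ^ w i := by
  simp [weightHom]

lemma weightHom_C (w : Fin 4 → ℕ) (a : K) :
    weightHom w (C a) = Polynomial.C (C a) := by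
  rw [← algebraMap_eq, AlgHom.commutes]
  rfl

lemma weightHom_bilinearPoly (a b c d : K) : weightHom ![0, 1, 0, 1] (bilinearPoly a b c d) =
    Polynomial.C (C a * (X 0 * X 2)) + Polynomial.C (C b * (X 0 * X 3) + C c * (X 1 * X 2)) *
      Polynomial.X + Polynomial.C (C d * (X 1 * X 3)) * Polynomial.X ^ 2 := by
  simp only [bilinearPoly, map_add, map_mul, weightHom_X, weightHom_C]
  simp
  ring

/-- The root attached to a line missing the first two coordinate lines. -/
lemma exists_isLineRoot_of_not_meets {W : Submodule K (Fin 4 → K)}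
    (hW : Module.finrank K W = 2) (h1 : ¬ MeetsCoordLine W 2 3) (h2 : ¬ MeetsCoordLine W 0 1)
    {p : Fin 4 → K} (hp : p ∈ W) (hp0 : p ≠ 0) :
    ∃ g w u : MvPolynomial (Fin 4) K, Prime g ∧ g.totalDegree = 2 ∧ IsLineRoot W g w u ∧
      HasEdgeOrder W g ∧ ∃ (v : Fin 4 → K) (c : K), c ≠ 0 ∧ eval v g = 0 ∧
        (∀ i, eval v (spreadPoint w u i) = c * p i) ∧ v 2 = p 2 ∧ v 3 = p 3 := by
  obtain ⟨i, hi, hpi⟩ : ∃ i : Fin 4, (i = 2 ∨ i = 3) ∧ p i ≠ 0 := by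
    by_contra! h
    exact h1 ⟨p, hp, hp0, h 2 (.inl rfl), h 3 (.inr rfl)⟩
  obtain ⟨q, hq, hpq, hspan, hqi⟩ : ∃ q ∈ W, LinearIndependent K ![p, q] ∧
      (∀ v ∈ W, ∃ a b : K, v = a • p + b • q) ∧ q i ≠ 0 := by
    obtain ⟨q, hq, hpq, hspan⟩ := exists_linearIndependent_pair hW hp hp0
    by_cases hqi : q i = 0
    · refine ⟨q + p, W.add_mem hq hp, ?_, fun v hv => ?_, by simpa [hqi] using hpi⟩
      · rw [LinearIndependent.pair_iff] at hpq ⊢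
        intro s t hst
        obtain ⟨h3, h4⟩ := hpq (s + t) t (by rw [← hst]; module)
        exact ⟨by simpa [h4] using h3, h4⟩
      · obtain ⟨a, b, rfl⟩ := hspan v hv
        exact ⟨a - b, b, by module⟩
    · exact ⟨q, hq, hpq, hspan, hqi⟩
  have hδ : p 0 * q 1 - p 1 * q 0 ≠ 0 := fun h => h2 (.of_minor_eq_zero hp hq hpq h)
  have hε : p 2 * q 3 - p 3 * q 2 ≠ 0 := fun h => h1 (.of_minor_eq_zero hp hq hpq h)
  set A : MvPolynomial (Fin 4) K := C (q 0) * X 1 - C (q 1) * X 0 with hA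
  set B : MvPolynomial (Fin 4) K := -(C (p 0) * X 1 - C (p 1) * X 0) with hB
  set g := bilinearPoly (q 1 * p 3 - p 1 * q 3) (p 1 * q 2 - q 1 * p 2) (p 0 * q 3 - q 0 * p 3)
    (q 0 * p 2 - p 0 * q 2) with hg
  have hgprime : Prime g := prime_bilinearPoly (by
    have := mul_ne_zero hδ hε
    contrapose! this
    linear_combination this)
  have hdeg : g.totalDegree = 2 := (bilinearPoly_isHomogeneous _ _ _ _).totalDegree hgprime.ne_zero
  have hyg : (A * C (p 2) + B * C (q 2)) * X 3 - (A * C (p 3) + B * C (q 3)) * X 2 = g := by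
    simp only [hA, hB, hg, bilinearPoly, map_sub, map_mul]
    ring
  have hord : HasEdgeOrder W g := by
    rw [HasEdgeOrder, hg, weightHom_bilinearPoly]
    simp only [Polynomial.coeff_add, Polynomial.coeff_C_mul, Polynomial.coeff_X_pow,
      Polynomial.coeff_C, Polynomial.coeff_X]
    by_cases hM : p 1 * q 3 - p 3 * q 1 = 0
    · right
      refine ⟨.of_minor_eq_zero hp hq hpq hM, fun h0 => ?_⟩
      simp at h0
      have e1 := congrArg (eval ![1, 0, 0, 1]) h0
      have e2 := congrArg (eval ![0, 1, 1, 0]) h0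
      simp [-mul_eq_zero] at e1 e2
      apply mul_ne_zero hδ hε
      linear_combination (p 0 * q 2 - q 0 * p 2) * hM - (p 0 * q 3 - q 0 * p 3) * e1
    · left
      intro h0
      simp at h0
      have e1 := congrArg (eval ![1, 0, 1, 0]) h0
      simp [-mul_eq_zero] at e1
      exact hM (by linear_combination -e1)
  have hx : ∃ r : Fin 4 → MvPolynomial (Fin 4) K, ∀ j,
      spreadPoint (C (-(p 0 * q 1 - p 1 * q 0)) * X i) (A * C (p i) + B * C (q i)) j =
        X i * A * C (p j) + X i * B * C (q j) + g * r j := by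
    rcases hi with rfl | rfl
    · refine ⟨![0, 0, 0, 1], fun j => ?_⟩
      rw [← hyg]
      fin_cases j <;> simp [spreadPoint, hA, hB] <;> ring
    · refine ⟨![0, 0, -1, 0], fun j => ?_⟩
      rw [← hyg]
      fin_cases j <;> simp [spreadPoint, hA, hB] <;> ring
  obtain ⟨r, hx⟩ := hx
  have hgp : eval p g = 0 := by rw [hg, eval_bilinearPoly]; ring
  have hgq : eval q g = 0 := by rw [hg, eval_bilinearPoly]; ring
  refine ⟨g, _, _, hgprime, hdeg, IsLineRoot.of_points hp hq hspan r hx p q hgp hgq ?_ ?_ ?_,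
    hord, p, -(p 0 * q 1 - p 1 * q 0) * p i, mul_ne_zero (neg_ne_zero.2 hδ) hpi, hgp,
    fun j => ?_, rfl, rfl⟩
  · have : eval p (X i * A) * eval q (X i * B) - eval p (X i * B) * eval q (X i * A) =
        (p 0 * q 1 - p 1 * q 0) ^ 2 * (p i * q i) := by
      simp [hA, hB]; ring
    rw [this]
    exact mul_ne_zero (pow_ne_zero _ hδ) (mul_ne_zero hpi hqi)
  · rw [map_mul, eval_C, eval_X]
    exact mul_ne_zero (neg_ne_zero.2 hδ) hpi
  · have : eval p (A * C (p i) + B * C (q i)) = -(p 0 * q 1 - p 1 * q 0) * p i := by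
      simp [hA, hB]; ring
    rw [this]
    exact mul_ne_zero (neg_ne_zero.2 hδ) hpi
  · rw [hx j]
    simp only [map_add, map_mul, eval_X, eval_C, hgp, zero_mul, add_zero]
    simp [hA, hB]; ring

/-- The root attached to a line meeting only the second coordinate line. -/
lemma exists_isLineRoot_of_meets_right {W : Submodule K (Fin 4 → K)}
    (hW : Module.finrank K W = 2) (h1 : ¬ MeetsCoordLine W 2 3) (h2 : MeetsCoordLine W 0 1)
    (hne : ∃ v ∈ W, ¬ (v 0 = 0 ∧ v 1 = 0)) :
    ∃ g w u : MvPolynomial (Fin 4) K, Prime g ∧ g.totalDegree = 1 ∧ IsLineRoot W g w u ∧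
      HasEdgeOrder W g := by
  obtain ⟨p, hp, hp0, hp₀, hp₁⟩ := h2
  obtain ⟨q, hq, hpq, hspan⟩ := exists_linearIndependent_pair hW hp hp0
  have hε : p 2 * q 3 - p 3 * q 2 ≠ 0 := fun h => h1 (.of_minor_eq_zero hp hq hpq h)
  have hq0 : ¬ (q 0 = 0 ∧ q 1 = 0) := by
    rintro ⟨e0, e1⟩
    obtain ⟨v, hv, hv0⟩ := hne
    obtain ⟨a, b, rfl⟩ := hspan v hv
    exact hv0 (by simp [e0, e1, hp₀, hp₁])
  set g : MvPolynomial (Fin 4) K := C (q 1) * X 0 + C (-q 0) * X 1 with hg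
  obtain ⟨hgprime, hdeg⟩ := prime_linear (K := K) (a := q 1) (b := -q 0) 0 1 (by decide)
    (fun h => hq0 ⟨by simpa using h.2, h.1⟩)
  have hord : HasEdgeOrder W g := by
    have : weightHom ![0, 1, 0, 1] g = Polynomial.C (C (q 1) * X 0) +
        Polynomial.C (C (-q 0) * X 1) * Polynomial.X := by
      rw [hg, map_add, map_mul, map_mul, weightHom_X, weightHom_X, weightHom_C, weightHom_C]
      simp
      ring
    rw [HasEdgeOrder, this]
    simp only [Polynomial.coeff_add, Polynomial.coeff_C_mul, Polynomial.coeff_C,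
      Polynomial.coeff_X]
    by_cases hM : q 1 = 0
    · right
      refine ⟨.of_minor_eq_zero hp hq hpq (by rw [hM, hp₁]; ring), fun h0 => hq0 ⟨?_, hM⟩⟩
      simpa using h0
    · left
      simpa using hM
  obtain ⟨i, hi, hqi⟩ : ∃ i : Fin 4, (i = 0 ∨ i = 1) ∧ q i ≠ 0 := by
    by_contra! h
    exact hq0 ⟨h 0 (.inl rfl), h 1 (.inr rfl)⟩
  set A : MvPolynomial (Fin 4) K := X i * (C (q 3) * X 2 - C (q 2) * X 3) with hA
  set B : MvPolynomial (Fin 4) K := X i * (C (p 2) * X 3 - C (p 3) * X 2) with hB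
  have hx : ∃ r : Fin 4 → MvPolynomial (Fin 4) K, ∀ j,
      spreadPoint (C (q i) * (C (p 2) * X 3 - C (p 3) * X 2))
        (C (p 2 * q 3 - p 3 * q 2) * X i) j = A * C (p j) + B * C (q j) + g * r j := by
    rcases hi with rfl | rfl
    · refine ⟨![0, -(C (p 2) * X 3 - C (p 3) * X 2), 0, 0], fun j => ?_⟩
      fin_cases j <;> simp [spreadPoint, hA, hB, hg, hp₀, hp₁] <;> ring
    · refine ⟨![C (p 2) * X 3 - C (p 3) * X 2, 0, 0, 0], fun j => ?_⟩
      fin_cases j <;> simp [spreadPoint, hA, hB, hg, hp₀, hp₁] <;> ring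
  obtain ⟨r, hx⟩ := hx
  have hgq : eval q g = 0 := by simp [hg]; ring
  have hgq' : eval ![q 0, q 1, p 2, p 3] g = 0 := by simp [hg]; ring
  have hq_i : (![q 0, q 1, p 2, p 3] : Fin 4 → K) i = q i := by
    rcases hi with rfl | rfl <;> rfl
  refine ⟨g, _, _, hgprime, hdeg, IsLineRoot.of_points hp hq hspan r hx q ![q 0, q 1, p 2, p 3]
    hgq hgq' ?_ ?_ ?_, hord⟩
  · have : eval q A * eval ![q 0, q 1, p 2, p 3] B - eval q B * eval ![q 0, q 1, p 2, p 3] A =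
        -(p 2 * q 3 - p 3 * q 2) ^ 2 * q i ^ 2 := by
      simp [hA, hB, hq_i]; ring
    rw [this]
    exact mul_ne_zero (neg_ne_zero.2 (pow_ne_zero _ hε)) (pow_ne_zero _ hqi)
  · have : eval q (C (q i) * (C (p 2) * X 3 - C (p 3) * X 2)) =
        q i * (p 2 * q 3 - p 3 * q 2) := by simp
    rw [this]
    exact mul_ne_zero hqi hε
  · rw [map_mul, eval_C, eval_X]
    exact mul_ne_zero hε hqi

/-- The root attached to a line meeting only the first coordinate line. -/
lemma exists_isLineRoot_of_meets_left {W : Submodule K (Fin 4 → K)}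
    (hW : Module.finrank K W = 2) (h1 : MeetsCoordLine W 2 3) (h2 : ¬ MeetsCoordLine W 0 1)
    (hne : ∃ v ∈ W, ¬ (v 2 = 0 ∧ v 3 = 0)) :
    ∃ g w u : MvPolynomial (Fin 4) K, Prime g ∧ g.totalDegree = 1 ∧ IsLineRoot W g w u ∧
      HasEdgeOrder W g := by
  obtain ⟨p, hp, hp0, hp₀, hp₁⟩ := h1
  obtain ⟨q, hq, hpq, hspan⟩ := exists_linearIndependent_pair hW hp hp0
  have hε : p 0 * q 1 - p 1 * q 0 ≠ 0 := fun h => h2 (.of_minor_eq_zero hp hq hpq h)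
  have hq0 : ¬ (q 2 = 0 ∧ q 3 = 0) := by
    rintro ⟨e0, e1⟩
    obtain ⟨v, hv, hv0⟩ := hne
    obtain ⟨a, b, rfl⟩ := hspan v hv
    exact hv0 (by simp [e0, e1, hp₀, hp₁])
  set g : MvPolynomial (Fin 4) K := C (q 3) * X 2 + C (-q 2) * X 3 with hg
  obtain ⟨hgprime, hdeg⟩ := prime_linear (K := K) (a := q 3) (b := -q 2) 2 3 (by decide)
    (fun h => hq0 ⟨by simpa using h.2, h.1⟩)
  have hord : HasEdgeOrder W g := by
    have : weightHom ![0, 1, 0, 1] g = Polynomial.C (C (q 3) * X 2) +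
        Polynomial.C (C (-q 2) * X 3) * Polynomial.X := by
      rw [hg, map_add, map_mul, map_mul, weightHom_X, weightHom_X, weightHom_C, weightHom_C]
      simp
      ring
    rw [HasEdgeOrder, this]
    simp only [Polynomial.coeff_add, Polynomial.coeff_C_mul, Polynomial.coeff_C,
      Polynomial.coeff_X]
    by_cases hM : q 3 = 0
    · right
      refine ⟨.of_minor_eq_zero hp hq hpq (by rw [hM, hp₁]; ring), fun h0 => hq0 ⟨?_, hM⟩⟩
      simpa using h0
    · left
      simpa using hM
  obtain ⟨i, hi, hqi⟩ : ∃ i : Fin 4, (i = 2 ∨ i = 3) ∧ q i ≠ 0 := by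
    by_contra! h
    exact hq0 ⟨h 2 (.inl rfl), h 3 (.inr rfl)⟩
  set A : MvPolynomial (Fin 4) K := X i * (C (q 1) * X 0 - C (q 0) * X 1) with hA
  set B : MvPolynomial (Fin 4) K := X i * (C (p 0) * X 1 - C (p 1) * X 0) with hB
  have hx : ∃ r : Fin 4 → MvPolynomial (Fin 4) K, ∀ j,
      spreadPoint (C (p 0 * q 1 - p 1 * q 0) * X i)
        (C (q i) * (C (p 0) * X 1 - C (p 1) * X 0)) j =
          A * C (p j) + B * C (q j) + g * r j := by
    rcases hi with rfl | rfl
    · refine ⟨![0, 0, 0, -(C (p 0) * X 1 - C (p 1) * X 0)], fun j => ?_⟩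
      fin_cases j <;> simp [spreadPoint, hA, hB, hg, hp₀, hp₁] <;> ring
    · refine ⟨![0, 0, C (p 0) * X 1 - C (p 1) * X 0, 0], fun j => ?_⟩
      fin_cases j <;> simp [spreadPoint, hA, hB, hg, hp₀, hp₁] <;> ring
  obtain ⟨r, hx⟩ := hx
  have hgq : eval q g = 0 := by simp [hg]; ring
  have hgq' : eval ![p 0, p 1, q 2, q 3] g = 0 := by simp [hg]; ring
  have hq_i : (![p 0, p 1, q 2, q 3] : Fin 4 → K) i = q i := by
    rcases hi with rfl | rfl <;> rfl
  refine ⟨g, _, _, hgprime, hdeg, IsLineRoot.of_points hp hq hspan r hx q ![p 0, p 1, q 2, q 3]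
    hgq hgq' ?_ ?_ ?_, hord⟩
  · have : eval q A * eval ![p 0, p 1, q 2, q 3] B - eval q B * eval ![p 0, p 1, q 2, q 3] A =
        -(p 0 * q 1 - p 1 * q 0) ^ 2 * q i ^ 2 := by
      simp [hA, hB, hq_i]; ring
    rw [this]
    exact mul_ne_zero (neg_ne_zero.2 (pow_ne_zero _ hε)) (pow_ne_zero _ hqi)
  · rw [map_mul, eval_C, eval_X]
    exact mul_ne_zero hε hqi
  · have : eval q (C (q i) * (C (p 0) * X 1 - C (p 1) * X 0)) =
        q i * (p 0 * q 1 - p 1 * q 0) := by simp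
    rw [this]
    exact mul_ne_zero hqi hε

open Classical in
lemma exists_isLineRoot {W : Submodule K (Fin 4 → K)} (hW : Module.finrank K W = 2)
    (h1 : ∃ v ∈ W, ¬ (v 0 = 0 ∧ v 1 = 0)) (h2 : ∃ v ∈ W, ¬ (v 2 = 0 ∧ v 3 = 0))
    (h : ¬ (MeetsCoordLine W 2 3 ∧ MeetsCoordLine W 0 1)) :
    ∃ g w u : MvPolynomial (Fin 4) K, Prime g ∧ g.totalDegree ≤ 2 ∧
      2 ≤ g.totalDegree + (if MeetsCoordLine W 2 3 then 1 else 0) +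
        (if MeetsCoordLine W 0 1 then 1 else 0) ∧ IsLineRoot W g w u ∧ HasEdgeOrder W g := by
  by_cases hl : MeetsCoordLine W 2 3
  · have hr : ¬ MeetsCoordLine W 0 1 := fun hr => h ⟨hl, hr⟩
    obtain ⟨g, w, u, hg, hdeg, hroot, hord⟩ := exists_isLineRoot_of_meets_left hW hl hr h2
    exact ⟨g, w, u, hg, by omega, by simp [hl, hr, hdeg], hroot, hord⟩
  by_cases hr : MeetsCoordLine W 0 1
  · obtain ⟨g, w, u, hg, hdeg, hroot, hord⟩ := exists_isLineRoot_of_meets_right hW hl hr h1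
    exact ⟨g, w, u, hg, by omega, by simp [hl, hr, hdeg], hroot, hord⟩
  obtain ⟨v, hv, hv0⟩ := h1
  obtain ⟨g, w, u, hg, hdeg, hroot, hord, -⟩ :=
    exists_isLineRoot_of_not_meets hW hl hr hv (fun h0 => hv0 (by simp [h0]))
  exact ⟨g, w, u, hg, by omega, by simp [hl, hr, hdeg], hroot, hord⟩

end LineRootExistence

section EdgeCoefficients

variable {K : Type*} [Field K] {f : MvPolynomial (Fin 4) K} {d : ℕ}

lemma map_eval_weightHom (f : MvPolynomial (Fin 4) K) (w : Fin 4 → ℕ) (v : Fin 4 → K) :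
    (weightHom w f).map (eval v) = aeval (fun i => Polynomial.C (v i) * Polynomial.X ^ w i) f := by
  have h := map_aeval_point (fun i => Polynomial.C (X i : MvPolynomial (Fin 4) K) *
    Polynomial.X ^ w i) (Polynomial.mapAlgHom (aeval v : MvPolynomial (Fin 4) K →ₐ[K] K)) f
  have h2 : (fun i => Polynomial.mapAlgHom (aeval v : MvPolynomial (Fin 4) K →ₐ[K] K)
      (Polynomial.C (X i : MvPolynomial (Fin 4) K) * Polynomial.X ^ w i)) =
      fun i => Polynomial.C (v i) * Polynomial.X ^ w i := by
    funext i
    simp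
  rw [h2] at h
  rw [← h, weightHom]
  simp only [Polynomial.coe_mapAlgHom]
  rfl

lemma eval_coeff_zero_weightHom (f : MvPolynomial (Fin 4) K) (w : Fin 4 → ℕ) (v : Fin 4 → K) :
    eval v ((weightHom w f).coeff 0) = aeval (fun i => if w i = 0 then v i else 0) f := by
  rw [← Polynomial.coeff_map, map_eval_weightHom, Polynomial.coeff_zero_eq_aeval_zero]
  have h := map_aeval_point (fun i => Polynomial.C (v i) * Polynomial.X ^ w i)
    (Polynomial.aeval (R := K) (0 : K)) f
  rw [h]
  congr 2
  funext i
  split_ifs with hi <;> simp [hi]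

lemma eval_coeff_one_weightHom (f : MvPolynomial (Fin 4) K) {w : Fin 4 → ℕ} (hw : ∀ i, w i ≤ 1)
    (v : Fin 4 → K) : eval v ((weightHom w f).coeff 1) =
      dir1 f (fun i => if w i = 0 then v i else 0) (fun i => if w i = 0 then 0 else v i) := by
  have h1 : (fun i => Polynomial.C (v i) * Polynomial.X ^ w i) =
      linePoint (fun i => if w i = 0 then v i else 0) (fun i => if w i = 0 then 0 else v i) := by
    funext i
    rcases Nat.le_one_iff_eq_zero_or_eq_one.1 (hw i) with hi | hi <;>
      simp [linePoint, hi, Polynomial.X_mul_C]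
  rw [← Polynomial.coeff_map, map_eval_weightHom, h1]
  have h2 := Polynomial.coeff_derivative (aeval (linePoint (fun i => if w i = 0 then v i else 0)
    (fun i => if w i = 0 then 0 else v i)) f) 0
  rw [derivative_aeval_linePoint, Polynomial.coeff_zero_eq_aeval_zero, map_dir1, aeval_constVec,
    aeval_linePoint] at h2
  simpa using h2.symm

lemma dir1_eq_zero_of_forall_smul_add (f : MvPolynomial (Fin 4) K) {v u : Fin 4 → K}
    (h : aeval (linePoint v u) f = 0) : dir1 f v u = 0 := by
  have h2 := derivative_aeval_linePoint f v u
  rw [h, Polynomial.derivative_zero] at h2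
  have h3 := congrArg (Polynomial.aeval (0 : K)) h2
  rw [map_dir1, aeval_constVec, aeval_linePoint] at h3
  simpa using h3.symm

lemma coeff_zero_weightHom_eq_zero [Infinite K] {w : Fin 4 → ℕ}
    (h : ∀ v : Fin 4 → K, (∀ i, w i ≠ 0 → v i = 0) → aeval v f = 0) :
    (weightHom w f).coeff 0 = 0 := by
  refine MvPolynomial.funext fun v => ?_
  rw [eval_coeff_zero_weightHom, map_zero]
  exact h _ fun i hi => by simp [hi]

lemma coeff_one_weightHom_ne_zero [Infinite K] {w : Fin 4 → ℕ} (hw : ∀ i, w i ≤ 1)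
    (h : ∀ v : Fin 4 → K, (∀ i, w i ≠ 0 → v i = 0) → aeval v f = 0) {v u : Fin 4 → K}
    (hv : ∀ i, w i ≠ 0 → v i = 0) (hvu : dir1 f v u ≠ 0) : (weightHom w f).coeff 1 ≠ 0 := by
  intro h0
  have h1 := eval_coeff_one_weightHom f hw (fun i => if w i = 0 then v i else u i)
  rw [h0, map_zero] at h1
  have e1 : (fun i => if w i = 0 then (if w i = 0 then v i else u i) else 0) = v := by
    funext i
    split_ifs with hi
    · rfl
    · exact (hv i hi).symm
  have e2 : (fun i => if w i = 0 then 0 else (if w i = 0 then v i else u i)) =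
      fun i => if w i = 0 then 0 else u i := by
    funext i
    split_ifs <;> rfl
  rw [e1, e2] at h1
  have h2 : dir1 f v (fun i => if w i = 0 then u i else 0) = 0 := by
    refine dir1_eq_zero_of_forall_smul_add f (Polynomial.funext fun s => ?_)
    rw [Polynomial.eval_zero, ← Polynomial.coe_aeval_eq_eval, map_aeval_point, aeval_linePoint]
    exact h _ fun i hi => by simp [hv i hi, hi]
  apply hvu
  have h3 : u = (fun i => if w i = 0 then u i else 0) + fun i => if w i = 0 then 0 else u i := by
    funext i
    simp only [Pi.add_apply]
    split_ifs <;> simp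
  rw [h3, dir1_add, h2, ← h1, add_zero]

lemma coeff_weightHom_compl (hf : f.IsHomogeneous d) {w w' : Fin 4 → ℕ} (hw : ∀ i, w i + w' i = 1)
    {k l : ℕ} (hkl : k + l = d) : (weightHom w f).coeff k = (weightHom w' f).coeff l := by
  classical
  ext m
  rw [coeff_weightHom, coeff_weightHom, coeff_weightedHomogeneousComponent,
    coeff_weightedHomogeneousComponent]
  by_cases hm : coeff m f = 0
  · simp [hm]
  have h1 := hf hm
  have h2 : Finsupp.weight w m + Finsupp.weight w' m = d := by
    rw [← h1, Finsupp.weight_apply, Finsupp.weight_apply, Finsupp.weight_apply,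
      Finsupp.sum_fintype _ _ (by simp), Finsupp.sum_fintype _ _ (by simp),
      Finsupp.sum_fintype _ _ (by simp), ← Finset.sum_add_distrib]
    refine Finset.sum_congr rfl fun i _ => ?_
    rw [← smul_add, hw]
    rfl
  have : Finsupp.weight w m = k ↔ Finsupp.weight w' m = l := by omega
  simp only [this]

lemma natDegree_weightHom_le {w : Fin 4 → ℕ} (hw : ∀ i, w i ≤ 1) (p : MvPolynomial (Fin 4) K) :
    (weightHom w p).natDegree ≤ p.totalDegree := by
  rw [Polynomial.natDegree_le_iff_coeff_eq_zero]
  intro N hN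
  rw [coeff_weightHom]
  refine weightedHomogeneousComponent_eq_zero' _ _ fun m hm hmN => ?_
  have h1 := le_totalDegree hm
  rw [Finsupp.weight_apply, Finsupp.sum] at hmN
  rw [Finsupp.sum] at h1
  have : ∑ i ∈ m.support, m i • w i ≤ ∑ i ∈ m.support, m i :=
    Finset.sum_le_sum fun i _ => by simpa using Nat.mul_le_mul_left (m i) (hw i)
  omega

lemma exists_X_mul_eq_spreadHom [Infinite K] (hf : f.IsHomogeneous d) (hd : 2 ≤ d)
    (h1 : ∀ v : Fin 4 → K, v 2 = 0 → v 3 = 0 → aeval v f = 0)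
    (h2 : ∀ v : Fin 4 → K, v 0 = 0 → v 1 = 0 → aeval v f = 0) :
    ∃ F : Polynomial (MvPolynomial (Fin 4) K), Polynomial.X ^ 1 * F = spreadHom f ∧
      F.natDegree ≤ d - 2 * 1 ∧ ∀ k, F.coeff k = (spreadHom f).coeff (k + 1) := by
  have hc0 : (spreadHom f).coeff 0 = 0 :=
    coeff_zero_weightHom_eq_zero fun v hv => h1 v (hv 2 (by simp)) (hv 3 (by simp))
  have hcd : (spreadHom f).coeff d = 0 := by
    rw [coeff_weightHom_compl hf (w' := ![1, 1, 0, 0])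
      (fun i => by fin_cases i <;> rfl) (add_zero d)]
    exact coeff_zero_weightHom_eq_zero fun v hv => h2 v (hv 0 (by simp)) (hv 1 (by simp))
  refine ⟨(spreadHom f).divX, ?_, ?_, fun k => Polynomial.coeff_divX⟩
  · conv_rhs => rw [← Polynomial.divX_mul_X_add (spreadHom f), hc0, map_zero, add_zero]
    rw [pow_one, mul_comm]
  · rw [Polynomial.natDegree_le_iff_coeff_eq_zero]
    intro N hN
    rw [Polynomial.coeff_divX]
    rcases Nat.lt_or_ge d (N + 1) with h | h
    · exact Polynomial.coeff_eq_zero_of_natDegree_lt ((natDegree_spreadHom_le hf).trans_lt h)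
    · obtain rfl : d = N + 1 := by omega
      exact hcd

lemma X_dvd_weightHom_coeff_spreadHom [Infinite K] (hM : ∀ v : Fin 4 → K, v 1 = 0 → v 3 = 0 →
    aeval v f = 0) (k : ℕ) :
    Polynomial.X ∣ weightHom ![0, 1, 0, 1] ((spreadHom f).coeff k) := by
  rw [Polynomial.X_dvd_iff]
  refine MvPolynomial.funext fun v => ?_
  rw [eval_coeff_zero_weightHom, map_zero]
  change eval (fun i => if (![0, 1, 0, 1] : Fin 4 → ℕ) i = 0 then v i else 0) _ = 0
  rw [← Polynomial.coeff_map, map_eval_weightHom]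
  have : aeval (fun i => Polynomial.C (if (![0, 1, 0, 1] : Fin 4 → ℕ) i = 0 then v i else 0) *
      Polynomial.X ^ (![0, 0, 1, 1] : Fin 4 → ℕ) i) f = 0 := by
    refine Polynomial.funext fun s => ?_
    rw [Polynomial.eval_zero, ← Polynomial.coe_aeval_eq_eval, map_aeval_point]
    exact hM _ (by simp) (by simp)
  rw [this, Polynomial.coeff_zero]

lemma pow_dvd_det_of_forall_dvd {A ι : Type*} [CommRing A] [Fintype ι] [DecidableEq ι]
    {M : Matrix ι ι A} {a : A} (h : ∀ i j, a ∣ M i j) : a ^ Fintype.card ι ∣ M.det := by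
  choose N hN using h
  have : M = a • Matrix.of N := by
    ext i j
    simp [hN]
  rw [this, Matrix.det_smul]
  exact dvd_mul_right _ _

lemma pow_dvd_resultant_of_forall_dvd {A : Type*} [CommRing A] {F G : Polynomial A} {a : A}
    (hF : ∀ k, a ∣ F.coeff k) (hG : ∀ k, a ∣ G.coeff k) (m n : ℕ) :
    a ^ (m + n) ∣ Polynomial.resultant F G m n := by
  have := pow_dvd_det_of_forall_dvd (M := Polynomial.sylvester F G m n) (a := a) fun i j => by
    simp only [Polynomial.sylvester, Matrix.of_apply]
    refine Fin.addCases (fun j => ?_) (fun j => ?_) j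
    · simp only [Fin.addCases_left]
      split_ifs
      exacts [hG _, dvd_zero _]
    · simp only [Fin.addCases_right]
      split_ifs
      exacts [hF _, dvd_zero _]
  simpa [Polynomial.resultant] using this

end EdgeCoefficients

section SkewLines

variable {K : Type*} [Field K] [Infinite K] {f φ : MvPolynomial (Fin 4) K} {d e : ℕ}

lemma exists_resultant (hf : f.IsHomogeneous d) (hφ : φ.IsHomogeneous e) (hd : 2 ≤ d) (he : 2 ≤ e)
    (hirr : Irreducible f) (hfφ : ¬ f ∣ φ)
    (hf1 : ∀ v : Fin 4 → K, v 2 = 0 → v 3 = 0 → aeval v f = 0)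
    (hf2 : ∀ v : Fin 4 → K, v 0 = 0 → v 1 = 0 → aeval v f = 0)
    (hφ1 : ∀ v : Fin 4 → K, v 2 = 0 → v 3 = 0 → aeval v φ = 0)
    (hφ2 : ∀ v : Fin 4 → K, v 0 = 0 → v 1 = 0 → aeval v φ = 0)
    (hs1 : ∃ v u : Fin 4 → K, v 2 = 0 ∧ v 3 = 0 ∧ dir1 f v u ≠ 0)
    (hs2 : ∃ v u : Fin 4 → K, v 0 = 0 ∧ v 1 = 0 ∧ dir1 f v u ≠ 0) :
    ∃ R : MvPolynomial (Fin 4) K, R ≠ 0 ∧ R.totalDegree ≤ (d - 2) * e + (e - 2) * d ∧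
      (∀ (S : Finset (Submodule K (Fin 4 → K)))
        (g w u : Submodule K (Fin 4 → K) → MvPolynomial (Fin 4) K),
        (∀ W ∈ S, Module.finrank K W = 2 ∧ (∀ v ∈ W, aeval v f = 0) ∧ (∀ v ∈ W, aeval v φ = 0) ∧
          Prime (g W) ∧ ¬ g W ∣ f ∧ IsLineRoot W (g W) (w W) (u W)) → ∏ W ∈ S, g W ∣ R) ∧
      ((∀ v : Fin 4 → K, v 1 = 0 → v 3 = 0 → aeval v f = 0) →
        (∀ v : Fin 4 → K, v 1 = 0 → v 3 = 0 → aeval v φ = 0) →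
        Polynomial.X ^ (d + e - 4) ∣ weightHom ![0, 1, 0, 1] R) := by
  obtain ⟨F, hF, hFd, hFc⟩ := exists_X_mul_eq_spreadHom hf hd hf1 hf2
  obtain ⟨Φ, hΦ, hΦe, hΦc⟩ := exists_X_mul_eq_spreadHom hφ he hφ1 hφ2
  have hF0 : F.coeff 0 ≠ 0 := by
    obtain ⟨v, u, hv2, hv3, hvu⟩ := hs1
    rw [hFc]
    refine coeff_one_weightHom_ne_zero (fun i => by fin_cases i <;> simp)
      (fun v hv => hf1 v (hv 2 (by simp)) (hv 3 (by simp))) (v := v) (u := u) ?_ hvu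
    intro i hi
    fin_cases i <;> simp_all
  have hFl : F.coeff (d - 2 * 1) ≠ 0 := by
    obtain ⟨v, u, hv2, hv3, hvu⟩ := hs2
    rw [hFc, coeff_weightHom_compl hf (w' := ![1, 1, 0, 0])
      (fun i => by fin_cases i <;> rfl) (show d - 2 * 1 + 1 + 1 = d by omega)]
    refine coeff_one_weightHom_ne_zero (fun i => by fin_cases i <;> simp)
      (fun v hv => hf2 v (hv 0 (by simp)) (hv 1 (by simp))) (v := v) (u := u) ?_ hvu
    intro i hi
    fin_cases i <;> simp_all
  have hev : ∀ {G : Polynomial (MvPolynomial (Fin 4) K)} {h : MvPolynomial (Fin 4) K},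
      Polynomial.X ^ 1 * G = spreadHom h → G.eval 1 = h := fun {G h} hG => by
    have := congrArg (Polynomial.eval 1) hG
    rwa [Polynomial.eval_mul, Polynomial.eval_pow, Polynomial.eval_X, one_pow, one_mul,
      eval_one_weightHom] at this
  have hFp : Prime F := (irreducible_of_X_pow_mul_eq_spreadHom hf hirr hF hF0).prime
  refine ⟨Polynomial.resultant F Φ (d - 2 * 1) (e - 2 * 1),
    resultant_ne_zero_of_prime hFd hΦe hFl hFp ?_, ?_, ?_, ?_⟩
  · rintro ⟨G, hG⟩
    refine hfφ ⟨G.eval 1, ?_⟩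
    rw [← hev hΦ, hG, Polynomial.eval_mul, hev hF]
  · exact totalDegree_resultant_le
      (fun k => by rw [hFc]; exact totalDegree_coeff_spreadHom_le hf _)
      (fun k => by rw [hΦc]; exact totalDegree_coeff_spreadHom_le hφ _)
  · intro S g w u hS
    have := prod_pow_dvd_resultant hf hφ (r := 1) (by omega) (by omega) hF hΦ hFd hΦe S
      (fun W hW => (hS W hW).1) g w u (fun _ => 1) (fun W hW => (hS W hW).2.2.2.1)
      (fun W hW => (hS W hW).2.2.2.2.1) (fun W hW => (hS W hW).2.2.2.2.2) (fun _ _ => one_ne_zero)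
      (fun W hW => by
        rw [pow_one]; exact (hS W hW).2.2.2.2.2.dvd_aeval (hS W hW).2.1)
      (fun W hW => by
        rw [pow_one]; exact (hS W hW).2.2.2.2.2.dvd_aeval (hS W hW).2.2.1)
    simpa using this
  · intro hfM hφM
    have h1 := Polynomial.resultant_map_map F Φ (d - 2 * 1) (e - 2 * 1)
      (weightHom (K := K) ![0, 1, 0, 1]).toRingHom
    have h2 : weightHom ![0, 1, 0, 1] (Polynomial.resultant F Φ (d - 2 * 1) (e - 2 * 1)) =
      (weightHom (K := K) ![0, 1, 0, 1]).toRingHom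
        (Polynomial.resultant F Φ (d - 2 * 1) (e - 2 * 1)) := rfl
    rw [h2, ← h1, show d + e - 4 = (d - 2 * 1) + (e - 2 * 1) by omega]
    refine pow_dvd_resultant_of_forall_dvd (fun k => ?_) (fun k => ?_) _ _
    · rw [Polynomial.coeff_map, hFc]
      exact X_dvd_weightHom_coeff_spreadHom hfM _
    · rw [Polynomial.coeff_map, hΦc]
      exact X_dvd_weightHom_coeff_spreadHom hφM _

end SkewLines

section NewtonStep

variable {K A : Type*} [CommRing K] [CommRing A] [Algebra K A] {f φ : MvPolynomial (Fin 4) K}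
  {d e : ℕ}

lemma dir1_smul_point (hf : f.IsHomogeneous d) (a : A) (P v : Fin 4 → A) :
    dir1 f (a • P) v = a ^ (d - 1) * dir1 f P v := by
  rw [dir1, dir1, Finset.mul_sum]
  refine Finset.sum_congr rfl fun i _ => ?_
  rw [aeval_smul_of_isHomogeneous P a hf.pderiv]
  ring

lemma aeval_newton_step (hd : 1 ≤ d) (he : 1 ≤ e) (hf : f.IsHomogeneous d)
    (hφ : φ.IsHomogeneous e) {ε : A} (hε : ε * ε = 0) {x y q b : Fin 4 → A} (hx : x = y + ε • q)
    (hfy : aeval y f = 0) (hφy : aeval y φ = 0)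
    (hmin : dir1 f y b * dir1 φ y q - dir1 f y q * dir1 φ y b = 0) :
    aeval (dir1 f x b • x - aeval x f • b) φ = 0 := by
  have h1 : aeval x f = ε * dir1 f y q := by
    rw [hx, aeval_add_smul_of_sq_zero hε, hfy, zero_add]
  have h2 : aeval x φ = ε * dir1 φ y q := by
    rw [hx, aeval_add_smul_of_sq_zero hε, hφy, zero_add]
  have h3 : ε * dir1 f x b = ε * dir1 f y b := by
    rw [hx, dir1_add_smul_point_of_sq_zero hε]
    linear_combination dir2 f y q b * hε
  have h4 : ε * dir1 φ x b = ε * dir1 φ y b := by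
    rw [hx, dir1_add_smul_point_of_sq_zero hε]
    linear_combination dir2 φ y q b * hε
  set κ := dir1 f x b with hκ
  have h5 : κ • x - aeval x f • b = κ • x + ε • (-dir1 f y q • b) := by
    rw [h1]
    module
  obtain ⟨m, rfl⟩ := Nat.exists_eq_add_of_le' he
  rw [h5, aeval_add_smul_of_sq_zero hε, aeval_smul_of_isHomogeneous x κ hφ, h2, dir1_smul,
    dir1_smul_point hφ, Nat.add_sub_cancel]
  linear_combination κ ^ m * dir1 φ y q * h3 - dir1 f y q * κ ^ m * h4 + ε * κ ^ m * hmin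

end NewtonStep

section DoubleRoots

variable {K : Type*} [Field K] [Infinite K] {f φ : MvPolynomial (Fin 4) K} {d e : ℕ}

/-- If the gradients of `f` and `φ` are proportional along `W`, the root attached to `W` can be
refined to second order. -/
lemma IsLineRoot.exists_double (hd : 1 ≤ d) (he : 1 ≤ e) (hf : f.IsHomogeneous d)
    (hφ : φ.IsHomogeneous e) {W : Submodule K (Fin 4 → K)} (hWf : ∀ v ∈ W, aeval v f = 0)
    (hWφ : ∀ v ∈ W, aeval v φ = 0)
    (hW : ∀ v ∈ W, ∀ a b : Fin 4 → K, dir1 f v b * dir1 φ v a - dir1 f v a * dir1 φ v b = 0)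
    {g w u : MvPolynomial (Fin 4) K} (hg : Prime g) (hroot : IsLineRoot W g w u)
    {p v : Fin 4 → K} {c : K} (hc : c ≠ 0) (hgv : eval v g = 0)
    (hv : ∀ i, eval v (spreadPoint w u i) = c * p i) (hv2 : v 2 = p 2) (hv3 : v 3 = p 3)
    (hp : dir1 f p ![0, 0, p 2, p 3] ≠ 0) :
    ∃ w' u', IsLineRoot W g w' u' ∧ g ^ 2 ∣ aeval (spreadPoint w' u') f ∧
      g ^ 2 ∣ aeval (spreadPoint w' u') φ := by
  set x := spreadPoint w u with hx
  set b : Fin 4 → MvPolynomial (Fin 4) K := ![0, 0, X 2, X 3] with hb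
  set κ := dir1 f x b with hκ
  obtain ⟨y, q, hy, hxy⟩ := hroot.exists_lift
  rw [← hx] at hxy
  have hfg : g ∣ aeval x f := hroot.dvd_aeval hWf
  obtain ⟨s, hs⟩ := hfg
  have hκg : ¬ g ∣ κ := by
    rintro ⟨k, hk⟩
    have h1 := congrArg (aeval v : MvPolynomial (Fin 4) K →ₐ[K] K) hk
    rw [hκ, map_dir1, map_mul] at h1
    have h2 : (fun i => aeval v (x i)) = c • p := by
      funext i
      exact hv i
    have h3 : (fun i => aeval v (b i)) = ![0, 0, p 2, p 3] := by
      funext i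
      fin_cases i <;> simp [hb, hv2, hv3]
    have h4 : aeval v g = 0 := hgv
    rw [h2, h3, h4, zero_mul, dir1_smul_point hf] at h1
    exact mul_ne_zero (pow_ne_zero _ hc) hp h1
  have hx' : spreadPoint (κ * w) (κ * u - aeval x f) = κ • x - aeval x f • b := by
    funext i
    fin_cases i <;> simp [hx, hb, spreadPoint] <;> ring
  have hmin : dir1 f y b * dir1 φ y q - dir1 f y q * dir1 φ y b = 0 := by
    refine MvPolynomial.funext fun t => ?_
    change (aeval t : MvPolynomial (Fin 4) K →ₐ[K] K) _ = (aeval t) _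
    rw [map_sub, map_mul, map_mul, map_dir1, map_dir1, map_dir1, map_dir1, map_zero]
    exact hW _ (hy t) _ _
  have hmin' : dir1 f y b * dir1 f y q - dir1 f y q * dir1 f y b = 0 := by ring
  have key : ∀ {h : MvPolynomial (Fin 4) K} {k : ℕ}, 1 ≤ k → h.IsHomogeneous k →
      (∀ v ∈ W, aeval v h = 0) → dir1 f y b * dir1 h y q - dir1 f y q * dir1 h y b = 0 →
      g ^ 2 ∣ aeval (spreadPoint (κ * w) (κ * u - aeval x f)) h := by
    intro h k hk hh hWh hhmin
    rw [← Ideal.mem_span_singleton, ← Ideal.Quotient.eq_zero_iff_mem, hx']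
    let π := Ideal.Quotient.mkₐ K (Ideal.span {g ^ 2})
    change π _ = 0
    have hε : π g * π g = 0 := by
      rw [← map_mul, ← sq]
      exact Ideal.Quotient.eq_zero_iff_mem.2 (Ideal.mem_span_singleton_self _)
    have h1 := aeval_newton_step hd hk hf hh hε (x := fun i => π (x i)) (y := fun i => π (y i))
      (q := fun i => π (q i)) (b := fun i => π (b i)) (by funext i; simp [congrFun hxy i])
      (by rw [← map_aeval_point, aeval_eq_zero_of_forall_eval_mem hy hWf, map_zero])
      (by rw [← map_aeval_point, aeval_eq_zero_of_forall_eval_mem hy hWh, map_zero])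
      (by simp only [← map_dir1, ← map_mul, ← map_sub, hhmin, map_zero])
    rw [map_aeval_point]
    rw [← map_dir1, ← map_aeval_point] at h1
    have h2 : (fun i => π ((κ • x - aeval x f • b) i)) =
        π κ • (fun i => π (x i)) - π (aeval x f) • fun i => π (b i) := by
      funext i
      simp
    rw [h2]
    exact h1
  refine ⟨κ * w, κ * u - aeval x f, ⟨⟨κ • y, κ • q - s • b, fun t => ?_, ?_⟩, fun l hl => ?_,
    ?_, ?_⟩, key hd hf hWf hmin', key he hφ hWφ hmin⟩
  · have : (fun i => eval t ((κ • y) i)) = eval t κ • fun i => eval t (y i) := by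
      funext i
      simp
    rw [this]
    exact W.smul_mem _ (hy t)
  · rw [hx', hs, hxy]
    module
  · refine hroot.vanish_of_dvd l ((hg.dvd_or_dvd (?_ : g ∣ κ * _)).resolve_left hκg)
    have h1 : κ * ∑ i, C (l i) * x i =
        ∑ i, C (l i) * spreadPoint (κ * w) (κ * u - aeval x f) i +
          g * (s * ∑ i, C (l i) * b i) := by
      rw [hx', ← mul_assoc, ← hs, Finset.mul_sum, Finset.mul_sum, ← Finset.sum_add_distrib]
      refine Finset.sum_congr rfl fun i _ => ?_
      simp only [Pi.sub_apply, Pi.smul_apply, smul_eq_mul]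
      ring
    rw [h1]
    exact dvd_add hl (dvd_mul_right _ _)
  · intro h
    exact (hg.dvd_or_dvd h).elim hκg hroot.not_dvd_left
  · intro h
    have h1 : g ∣ κ * u := by
      have := dvd_add h (Dvd.intro s hs.symm)
      rwa [sub_add_cancel] at this
    exact (hg.dvd_or_dvd h1).elim hκg hroot.not_dvd_right

end DoubleRoots

section CoordinateCounts

variable {K : Type*} [Field K] {f φ : MvPolynomial (Fin 4) K} {d e : ℕ}

lemma not_dvd_of_totalDegree_lt {σ : Type*} {f g : MvPolynomial σ K} (hf : Irreducible f)
    (hg : ¬ IsUnit g) (h : g.totalDegree < f.totalDegree) : ¬ g ∣ f := by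
  rintro ⟨c, hc⟩
  have hc' : IsUnit c := (hf.isUnit_or_isUnit hc).resolve_left hg
  obtain ⟨c', hcc⟩ := hc'.exists_right_inv
  have hg0 : g ≠ 0 := by
    rintro rfl
    exact hf.ne_zero (by rw [hc, zero_mul])
  have : f.totalDegree + c'.totalDegree = g.totalDegree := by
    rw [← totalDegree_mul_of_isDomain hf.ne_zero (right_ne_zero_of_mul_eq_one hcc), hc, mul_assoc,
      hcc, mul_one]
  omega

lemma HasEdgeOrder.natTrailingDegree_le {W : Submodule K (Fin 4 → K)}
    {g : MvPolynomial (Fin 4) K} (h : HasEdgeOrder W g) [Decidable (MeetsCoordLine W 1 3)] :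
    (weightHom ![0, 1, 0, 1] g).natTrailingDegree ≤ if MeetsCoordLine W 1 3 then 1 else 0 := by
  rcases h with h | ⟨h1, h⟩
  · exact (Polynomial.natTrailingDegree_le_of_ne_zero h).trans (Nat.zero_le _)
  · rw [if_pos h1]
    exact Polynomial.natTrailingDegree_le_of_ne_zero h

lemma weightHom_ne_zero (w : Fin 4 → ℕ) {p : MvPolynomial (Fin 4) K} (hp : p ≠ 0) :
    weightHom w p ≠ 0 := fun h => hp (by
  have := eval_one_weightHom w p
  rw [h, Polynomial.eval_zero] at this
  exact this.symm)

open Classical in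
lemma natTrailingDegree_weightHom_prod_le {S : Finset (Submodule K (Fin 4 → K))}
    {g : Submodule K (Fin 4 → K) → MvPolynomial (Fin 4) K} (hg : ∀ W ∈ S, g W ≠ 0)
    (h : ∀ W ∈ S, HasEdgeOrder W (g W)) :
    (weightHom ![0, 1, 0, 1] (∏ W ∈ S, g W)).natTrailingDegree ≤
      ∑ W ∈ S, if MeetsCoordLine W 1 3 then 1 else 0 := by
  induction S using Finset.induction_on with
  | empty => simp
  | insert W S hW ih =>
    rw [Finset.prod_insert hW, Finset.sum_insert hW, map_mul, Polynomial.natTrailingDegree_mul]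
    · exact add_le_add (h W (Finset.mem_insert_self _ _)).natTrailingDegree_le
        (ih (fun V hV => hg V (Finset.mem_insert_of_mem hV))
          fun V hV => h V (Finset.mem_insert_of_mem hV))
    · exact weightHom_ne_zero _ (hg W (Finset.mem_insert_self _ _))
    · exact weightHom_ne_zero _ (Finset.prod_ne_zero_iff.2 fun V hV =>
        hg V (Finset.mem_insert_of_mem hV))

lemma totalDegree_prod_of_ne_zero {ι σ : Type*} {S : Finset ι} {g : ι → MvPolynomial σ K}
    (hg : ∀ i ∈ S, g i ≠ 0) : (∏ i ∈ S, g i).totalDegree = ∑ i ∈ S, (g i).totalDegree := by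
  classical
  induction S using Finset.induction_on with
  | empty => simp
  | insert i S hi ih =>
    have hg' : ∀ j ∈ S, g j ≠ 0 := fun j hj => hg j (Finset.mem_insert_of_mem hj)
    rw [Finset.prod_insert hi, Finset.sum_insert hi, totalDegree_mul_of_isDomain
      (hg i (Finset.mem_insert_self _ _)) (Finset.prod_ne_zero_iff.2 hg'), ih hg']

variable [Infinite K]

open Classical in
lemma two_mul_card_le_of_coordLines (hf : f.IsHomogeneous d) (hφ : φ.IsHomogeneous e) (hd : 3 ≤ d)
    (he : 2 ≤ e) (hirr : Irreducible f) (hfφ : ¬ f ∣ φ)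
    (hf1 : ∀ v : Fin 4 → K, v 2 = 0 → v 3 = 0 → aeval v f = 0)
    (hf2 : ∀ v : Fin 4 → K, v 0 = 0 → v 1 = 0 → aeval v f = 0)
    (hφ1 : ∀ v : Fin 4 → K, v 2 = 0 → v 3 = 0 → aeval v φ = 0)
    (hφ2 : ∀ v : Fin 4 → K, v 0 = 0 → v 1 = 0 → aeval v φ = 0)
    (hs1 : ∃ v u : Fin 4 → K, v 2 = 0 ∧ v 3 = 0 ∧ dir1 f v u ≠ 0)
    (hs2 : ∃ v u : Fin 4 → K, v 0 = 0 ∧ v 1 = 0 ∧ dir1 f v u ≠ 0)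
    (S : Finset (Submodule K (Fin 4 → K))) (hS : ∀ W ∈ S, Module.finrank K W = 2 ∧
      (∀ v ∈ W, aeval v f = 0) ∧ (∀ v ∈ W, aeval v φ = 0))
    (hS1 : ∀ W ∈ S, ∃ v ∈ W, ¬ (v 0 = 0 ∧ v 1 = 0))
    (hS2 : ∀ W ∈ S, ∃ v ∈ W, ¬ (v 2 = 0 ∧ v 3 = 0)) :
    2 * S.card ≤ (d - 2) * e + (e - 2) * d + (S.filter fun W => MeetsCoordLine W 2 3).card +
      (S.filter fun W => MeetsCoordLine W 0 1).card ∧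
    ((∀ v : Fin 4 → K, v 1 = 0 → v 3 = 0 → aeval v f = 0) →
      (∀ v : Fin 4 → K, v 1 = 0 → v 3 = 0 → aeval v φ = 0) →
      2 * S.card + (d + e - 4) ≤ (d - 2) * e + (e - 2) * d +
        (S.filter fun W => MeetsCoordLine W 2 3).card +
        (S.filter fun W => MeetsCoordLine W 0 1).card +
        (S.filter fun W => MeetsCoordLine W 1 3).card) := by
  obtain ⟨R, hR0, hRdeg, hRdvd, hRX⟩ := exists_resultant hf hφ (by omega) he hirr hfφ hf1 hf2 hφ1
    hφ2 hs1 hs2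
  set P : Submodule K (Fin 4 → K) → Prop := fun W => ¬ (MeetsCoordLine W 2 3 ∧ MeetsCoordLine W 0 1)
    with hP
  have hex : ∀ W : Submodule K (Fin 4 → K), ∃ g w u : MvPolynomial (Fin 4) K,
      W ∈ S.filter P → Prime g ∧ g.totalDegree ≤ 2 ∧
      2 ≤ g.totalDegree + (if MeetsCoordLine W 2 3 then 1 else 0) +
        (if MeetsCoordLine W 0 1 then 1 else 0) ∧ IsLineRoot W g w u ∧ HasEdgeOrder W g := by
    intro W
    by_cases hW : W ∈ S.filter P
    · obtain ⟨hWS, hWP⟩ := Finset.mem_filter.1 hW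
      obtain ⟨g, w, u, h⟩ := exists_isLineRoot (hS W hWS).1 (hS1 W hWS) (hS2 W hWS) hWP
      exact ⟨g, w, u, fun _ => h⟩
    · exact ⟨0, 0, 0, fun h => absurd h hW⟩
  choose g w u hg using hex
  have hg0 : ∀ W ∈ S.filter P, g W ≠ 0 := fun W hW => (hg W hW).1.ne_zero
  obtain ⟨R', rfl⟩ := hRdvd (S.filter P) g w u fun W hW => by
    have hWS := (Finset.mem_filter.1 hW).1
    refine ⟨(hS W hWS).1, (hS W hWS).2.1, (hS W hWS).2.2, (hg W hW).1, ?_, (hg W hW).2.2.2.1⟩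
    refine not_dvd_of_totalDegree_lt hirr (hg W hW).1.not_isUnit ?_
    rw [hf.totalDegree hirr.ne_zero]
    exact (hg W hW).2.1.trans_lt (by omega)
  have hprod0 := left_ne_zero_of_mul hR0
  have hR'0 := right_ne_zero_of_mul hR0
  rw [totalDegree_mul_of_isDomain hprod0 hR'0, totalDegree_prod_of_ne_zero hg0] at hRdeg
  have hsum : 2 * S.card ≤ ∑ W ∈ S.filter P, (g W).totalDegree +
      (S.filter fun W => MeetsCoordLine W 2 3).card +
      (S.filter fun W => MeetsCoordLine W 0 1).card := by
    rw [Finset.sum_filter, Finset.card_filter, Finset.card_filter, ← Finset.sum_add_distrib,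
      ← Finset.sum_add_distrib, mul_comm, ← smul_eq_mul, ← Finset.sum_const]
    refine Finset.sum_le_sum fun W hW => ?_
    by_cases h : P W
    · rw [if_pos h]
      exact (hg W (Finset.mem_filter.2 ⟨hW, h⟩)).2.2.1
    · rw [if_neg h]
      have h' := not_not.1 h
      rw [if_pos h'.1, if_pos h'.2]
  refine ⟨by omega, fun hfM hφM => ?_⟩
  have h1 := hRX hfM hφM
  have h2 : d + e - 4 ≤
      (weightHom ![0, 1, 0, 1] ((∏ W ∈ S.filter P, g W) * R')).natTrailingDegree := by
    refine Polynomial.le_natTrailingDegree (weightHom_ne_zero _ hR0) fun n hn => ?_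
    exact Polynomial.X_pow_dvd_iff.1 h1 n hn
  rw [map_mul, Polynomial.natTrailingDegree_mul (weightHom_ne_zero _ hprod0)
    (weightHom_ne_zero _ hR'0)] at h2
  have h3 := natTrailingDegree_weightHom_prod_le hg0 fun W hW => (hg W hW).2.2.2.2
  have h4 : (weightHom ![0, 1, 0, 1] R').natTrailingDegree ≤ R'.totalDegree :=
    (Polynomial.natTrailingDegree_le_natDegree _).trans
      (natDegree_weightHom_le (fun i => by fin_cases i <;> simp) _)
  have h5 : ∑ W ∈ S.filter P, (if MeetsCoordLine W 1 3 then 1 else 0) ≤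
      (S.filter fun W => MeetsCoordLine W 1 3).card := by
    rw [Finset.card_filter]
    exact Finset.sum_le_sum_of_subset (Finset.filter_subset _ _)
  omega

open Classical in
lemma card_add_card_le_of_coordLines (hf : f.IsHomogeneous d) (hφ : φ.IsHomogeneous e)
    (hd : 3 ≤ d) (he : 1 ≤ e) (hirr : Irreducible f) (hfφ : ¬ f ∣ φ)
    (hf1 : ∃ v : Fin 4 → K, v 2 = 0 ∧ v 3 = 0 ∧ aeval v f ≠ 0)
    (hf2 : ∃ v : Fin 4 → K, v 0 = 0 ∧ v 1 = 0 ∧ aeval v f ≠ 0)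
    (S : Finset (Submodule K (Fin 4 → K))) (hS : ∀ W ∈ S, Module.finrank K W = 2 ∧
      (∀ v ∈ W, aeval v f = 0) ∧ (∀ v ∈ W, aeval v φ = 0))
    (hS1 : ∀ W ∈ S, ¬ MeetsCoordLine W 2 3) (hS2 : ∀ W ∈ S, ¬ MeetsCoordLine W 0 1)
    (Q : Submodule K (Fin 4 → K) → Prop)
    (hQ : ∀ W ∈ S, Q W → (∀ v ∈ W, ∀ a b : Fin 4 → K,
      dir1 f v b * dir1 φ v a - dir1 f v a * dir1 φ v b = 0) ∧
      ∃ p ∈ W, dir1 f p ![0, 0, p 2, p 3] ≠ 0) :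
    S.card + (S.filter Q).card ≤ d * e := by
  have hex : ∀ W : Submodule K (Fin 4 → K), ∃ g w u : MvPolynomial (Fin 4) K,
      W ∈ S → Prime g ∧ g.totalDegree = 2 ∧ IsLineRoot W g w u ∧
        g ^ (if Q W then 2 else 1) ∣ aeval (spreadPoint w u) f ∧
        g ^ (if Q W then 2 else 1) ∣ aeval (spreadPoint w u) φ := by
    intro W
    by_cases hW : W ∈ S
    · obtain ⟨hr, hWf, hWφ⟩ := hS W hW
      by_cases hQW : Q W
      · obtain ⟨hmin, p, hp, hpd⟩ := hQ W hW hQW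
        have hp0 : p ≠ 0 := by
          rintro rfl
          refine hpd ?_
          have : (![0, 0, (0 : Fin 4 → K) 2, (0 : Fin 4 → K) 3] : Fin 4 → K) = 0 := by
            funext i
            fin_cases i <;> rfl
          rw [this, dir1_zero]
        obtain ⟨g, w, u, hg, hdeg, hroot, -, v, c, hc, hgv, hv, hv2, hv3⟩ :=
          exists_isLineRoot_of_not_meets hr (hS1 W hW) (hS2 W hW) hp hp0
        obtain ⟨w', u', h1, h2, h3⟩ := hroot.exists_double (by omega) he hf hφ hWf hWφ hmin hg hc
          hgv hv hv2 hv3 hpd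
        exact ⟨g, w', u', fun _ => ⟨hg, hdeg, h1, by rwa [if_pos hQW], by rwa [if_pos hQW]⟩⟩
      · obtain ⟨p, hp, hp0⟩ : ∃ p ∈ W, p ≠ 0 := by
          refine W.ne_bot_iff.1 ?_
          rintro rfl
          simp at hr
        obtain ⟨g, w, u, hg, hdeg, hroot, -⟩ :=
          exists_isLineRoot_of_not_meets hr (hS1 W hW) (hS2 W hW) hp hp0
        refine ⟨g, w, u, fun _ => ⟨hg, hdeg, hroot, ?_, ?_⟩⟩
        · rw [if_neg hQW, pow_one]
          exact hroot.dvd_aeval hWf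
        · rw [if_neg hQW, pow_one]
          exact hroot.dvd_aeval hWφ
    · exact ⟨0, 0, 0, fun h => absurd h hW⟩
  choose g w u hg using hex
  have hc0 : (spreadHom f).coeff 0 ≠ 0 := by
    obtain ⟨v, h2, h3, hv⟩ := hf1
    intro h0
    refine hv ?_
    have h1 := eval_coeff_zero_weightHom f ![0, 0, 1, 1] v
    rw [show weightHom ![0, 0, 1, 1] f = spreadHom f from rfl, h0, map_zero] at h1
    rw [h1]
    congr 2
    funext i
    fin_cases i <;> simp [h2, h3]
  have hcd : (spreadHom f).coeff d ≠ 0 := by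
    obtain ⟨v, h2, h3, hv⟩ := hf2
    intro h0
    refine hv ?_
    have h1 := eval_coeff_zero_weightHom f ![1, 1, 0, 0] v
    rw [← coeff_weightHom_compl hf (w := ![0, 0, 1, 1]) (fun i => by fin_cases i <;> rfl)
      (show d + 0 = d from rfl), show weightHom ![0, 0, 1, 1] f = spreadHom f from rfl, h0,
      map_zero] at h1
    rw [h1]
    congr 2
    funext i
    fin_cases i <;> simp [h2, h3]
  have hF : (Polynomial.X : Polynomial (MvPolynomial (Fin 4) K)) ^ 0 * spreadHom f = spreadHom f :=
    by rw [pow_zero, one_mul]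
  have hΦ : (Polynomial.X : Polynomial (MvPolynomial (Fin 4) K)) ^ 0 * spreadHom φ = spreadHom φ :=
    by rw [pow_zero, one_mul]
  have hdvd := prod_pow_dvd_resultant hf hφ (r := 0) (by omega) (by omega) hF hΦ
    (natDegree_spreadHom_le hf) (natDegree_spreadHom_le hφ) S (fun W hW => (hS W hW).1) g w u
    (fun W => if Q W then 2 else 1) (fun W hW => (hg W hW).1) (fun W hW => by
      refine not_dvd_of_totalDegree_lt hirr (hg W hW).1.not_isUnit ?_
      rw [hf.totalDegree hirr.ne_zero, (hg W hW).2.1]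
      omega) (fun W hW => (hg W hW).2.2.1) (fun W _ => by split_ifs <;> simp)
    (fun W hW => (hg W hW).2.2.2.1) (fun W hW => (hg W hW).2.2.2.2)
  have hne : Polynomial.resultant (spreadHom f) (spreadHom φ) (d - 2 * 0) (e - 2 * 0) ≠ 0 := by
    refine resultant_ne_zero_of_prime (natDegree_spreadHom_le hf) (natDegree_spreadHom_le hφ) hcd
      (irreducible_of_X_pow_mul_eq_spreadHom hf hirr hF hc0).prime ?_
    rintro ⟨q, hq⟩
    refine hfφ ⟨q.eval 1, ?_⟩
    have := congrArg (Polynomial.eval 1) hq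
    rwa [Polynomial.eval_mul, eval_one_weightHom, eval_one_weightHom] at this
  obtain ⟨c, hc⟩ := hdvd
  have hdeg := totalDegree_resultant_le (m := d - 2 * 0) (n := e - 2 * 0)
    (totalDegree_coeff_spreadHom_le hf) (totalDegree_coeff_spreadHom_le hφ)
  rw [hc] at hne hdeg
  rw [totalDegree_mul_of_isDomain (left_ne_zero_of_mul hne) (right_ne_zero_of_mul hne),
    totalDegree_prod_of_ne_zero fun W hW => pow_ne_zero _ (hg W hW).1.ne_zero] at hdeg
  have hsum : ∑ W ∈ S, (g W ^ (if Q W then 2 else 1)).totalDegree =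
      2 * (S.card + (S.filter Q).card) := by
    rw [Finset.card_filter, Finset.card_eq_sum_ones, ← Finset.sum_add_distrib, Finset.mul_sum]
    refine Finset.sum_congr rfl fun W hW => ?_
    split_ifs
    · rw [sq, totalDegree_mul_of_isDomain (hg W hW).1.ne_zero (hg W hW).1.ne_zero, (hg W hW).2.1]
      rfl
    · rw [pow_one, (hg W hW).2.1]
      rfl
  rw [hsum] at hdeg
  have : e * d = d * e := mul_comm _ _
  simp only [mul_zero, Nat.sub_zero] at hdeg
  omega

end CoordinateCounts

section CoordinateChange

variable {K : Type*} [Field K]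

/-- The polynomial `f` in the coordinates given by the linear automorphism `T`. -/
noncomputable def coordChange (T : (Fin 4 → K) ≃ₗ[K] (Fin 4 → K)) :
    MvPolynomial (Fin 4) K →ₐ[K] MvPolynomial (Fin 4) K :=
  aeval fun j => ∑ i, C (T (Pi.single i 1) j) * X i

variable (T : (Fin 4 → K) ≃ₗ[K] (Fin 4 → K)) (f : MvPolynomial (Fin 4) K)

lemma linearEquiv_apply_eq_sum (v : Fin 4 → K) (j : Fin 4) :
    T v j = ∑ i, T (Pi.single i 1) j * v i := by
  conv_lhs => rw [← Finset.univ_sum_single v]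
  rw [map_sum, Finset.sum_apply]
  refine Finset.sum_congr rfl fun i _ => ?_
  have : (Pi.single i (v i) : Fin 4 → K) = v i • Pi.single i 1 := by
    rw [← Pi.single_smul', smul_eq_mul, mul_one]
  rw [this, map_smul, Pi.smul_apply, smul_eq_mul, mul_comm]

lemma aeval_coordChange (v : Fin 4 → K) : aeval v (coordChange T f) = aeval (T v) f := by
  rw [coordChange, map_aeval_point]
  congr 2
  funext j
  simp [linearEquiv_apply_eq_sum T v j]

lemma aeval_linePoint_coordChange (v u : Fin 4 → K) :
    aeval (linePoint v u) (coordChange T f) = aeval (linePoint (T v) (T u)) f := by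
  rw [coordChange, map_aeval_point]
  congr 2
  funext j
  simp only [linePoint, map_sum, map_mul, aeval_X, linearEquiv_apply_eq_sum T v j,
    linearEquiv_apply_eq_sum T u j]
  rw [Finset.mul_sum, ← Finset.sum_add_distrib]
  refine Finset.sum_congr rfl fun i _ => ?_
  rw [← algebraMap_eq, AlgHom.commutes, Polynomial.algebraMap_eq]
  ring

lemma dir1_eq_eval_derivative (v u : Fin 4 → K) :
    dir1 f v u = (Polynomial.derivative (aeval (linePoint v u) f)).eval 0 := by
  have h2 := congrArg (Polynomial.aeval (0 : K)) (derivative_aeval_linePoint f v u)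
  rw [map_dir1] at h2
  have h3 : (fun i => Polynomial.aeval (0 : K) (linePoint v u i)) = v := by
    funext i
    simp [linePoint]
  have h4 : (fun i => Polynomial.aeval (0 : K) (constVec u i)) = u := by
    funext i
    simp [constVec]
  rw [h3, h4] at h2
  rw [← h2, Polynomial.coe_aeval_eq_eval]

lemma dir1_coordChange (v u : Fin 4 → K) :
    dir1 (coordChange T f) v u = dir1 f (T v) (T u) := by
  rw [dir1_eq_eval_derivative, dir1_eq_eval_derivative, aeval_linePoint_coordChange]

variable {f} in
lemma coordChange_isHomogeneous {d : ℕ} (hf : f.IsHomogeneous d) :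
    (coordChange T f).IsHomogeneous d := by
  have := hf.aeval (n := 1) (fun j => ∑ i, C (T (Pi.single i 1) j) * X i) fun j =>
    IsHomogeneous.sum _ _ _ fun i _ => by
      simpa using (isHomogeneous_C (Fin 4) (T (Pi.single i 1) j)).mul (isHomogeneous_X K i)
  rwa [one_mul] at this

variable [Infinite K]

lemma coordChange_symm_coordChange : coordChange T.symm (coordChange T f) = f := by
  refine MvPolynomial.funext fun v => ?_
  change aeval v _ = aeval v _
  rw [aeval_coordChange, aeval_coordChange, LinearEquiv.apply_symm_apply]

lemma coordChange_coordChange_symm : coordChange T (coordChange T.symm f) = f := by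
  have := coordChange_symm_coordChange T.symm f
  rwa [LinearEquiv.symm_symm] at this

variable {f} in
lemma coordChange_irreducible (hf : Irreducible f) : Irreducible (coordChange T f) := by
  let E : MvPolynomial (Fin 4) K ≃ₐ[K] MvPolynomial (Fin 4) K :=
    AlgEquiv.ofAlgHom (coordChange T) (coordChange T.symm)
      (AlgHom.ext fun p => coordChange_coordChange_symm T p)
      (AlgHom.ext fun p => coordChange_symm_coordChange T p)
  exact (MulEquiv.irreducible_iff E).2 hf

variable {f} in
lemma coordChange_not_dvd {φ : MvPolynomial (Fin 4) K} (h : ¬ f ∣ φ) :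
    ¬ coordChange T f ∣ coordChange T φ := fun h' => h (by
  have := map_dvd (coordChange T.symm) h'
  rwa [coordChange_symm_coordChange, coordChange_symm_coordChange] at this)

end CoordinateChange

section IntrinsicCounts

variable {K : Type*} [Field K] {f φ : MvPolynomial (Fin 4) K} {d e : ℕ}

/-- The gradients of `f` and `φ` are proportional at every point of `W`. -/
def GradientsProportional (f φ : MvPolynomial (Fin 4) K) (W : Submodule K (Fin 4 → K)) : Prop :=
  ∀ v ∈ W, ∀ a b : Fin 4 → K, dir1 f v b * dir1 φ v a - dir1 f v a * dir1 φ v b = 0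

lemma exists_linearEquiv_of_linearIndependent {b₀ b₁ b₂ b₃ : Fin 4 → K}
    (h : LinearIndependent K ![b₀, b₁, b₂, b₃]) : ∃ T : (Fin 4 → K) ≃ₗ[K] (Fin 4 → K),
      ∀ v, T v = v 0 • b₀ + v 1 • b₁ + v 2 • b₂ + v 3 • b₃ := by
  refine ⟨(basisOfLinearIndependentOfCardEqFinrank h (by simp)).equivFun.symm, fun v => ?_⟩
  rw [Module.Basis.equivFun_symm_apply, Fin.sum_univ_four]
  simp

/-- Lines in new coordinates. -/
lemma mem_map_symm {T : (Fin 4 → K) ≃ₗ[K] (Fin 4 → K)} {W : Submodule K (Fin 4 → K)}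
    {v : Fin 4 → K} : v ∈ W.map (T.symm : (Fin 4 → K) →ₗ[K] (Fin 4 → K)) ↔ T v ∈ W := by
  constructor
  · rintro ⟨w, hw, rfl⟩
    simpa using hw
  · intro h
    exact ⟨T v, h, by simp⟩

lemma map_symm_injective (T : (Fin 4 → K) ≃ₗ[K] (Fin 4 → K)) :
    Function.Injective fun W : Submodule K (Fin 4 → K) =>
      W.map (T.symm : (Fin 4 → K) →ₗ[K] (Fin 4 → K)) :=
  Submodule.map_injective_of_injective T.symm.injective

lemma card_filter_image_le {α β : Type*} [DecidableEq β] {S : Finset α} {g : α → β}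
    (p : β → Prop) (q : α → Prop) [DecidablePred p] [DecidablePred q]
    (h : ∀ a ∈ S, p (g a) → q a) :
    ((S.image g).filter p).card ≤ (S.filter q).card := by
  refine (Finset.card_le_card ?_).trans (Finset.card_image_le (f := g))
  intro b hb
  obtain ⟨hb, hp⟩ := Finset.mem_filter.1 hb
  obtain ⟨a, ha, rfl⟩ := Finset.mem_image.1 hb
  exact Finset.mem_image_of_mem _ (Finset.mem_filter.2 ⟨ha, h a ha hp⟩)

variable [Infinite K]

open Classical in
lemma two_mul_card_le_of_frame (hf : f.IsHomogeneous d) (hφ : φ.IsHomogeneous e) (hd : 3 ≤ d)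
    (he : 2 ≤ e) (hirr : Irreducible f) (hfφ : ¬ f ∣ φ)
    (hs : ∀ v : Fin 4 → K, v ≠ 0 → ∃ u, dir1 f v u ≠ 0)
    {L₁ L₂ M : Submodule K (Fin 4 → K)} (hL₁ : ∀ v ∈ L₁, aeval v f = 0 ∧ aeval v φ = 0)
    (hL₂ : ∀ v ∈ L₂, aeval v f = 0 ∧ aeval v φ = 0)
    {b₀ b₁ b₂ b₃ : Fin 4 → K} (hb : LinearIndependent K ![b₀, b₁, b₂, b₃]) (hb₀ : b₀ ∈ L₁)
    (hb₁ : b₁ ∈ L₁) (hb₂ : b₂ ∈ L₂) (hb₃ : b₃ ∈ L₂)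
    (S : Finset (Submodule K (Fin 4 → K))) (hS : ∀ W ∈ S, Module.finrank K W = 2 ∧
      (∀ v ∈ W, aeval v f = 0) ∧ (∀ v ∈ W, aeval v φ = 0))
    (hS1 : ∀ W ∈ S, ¬ W ≤ L₁) (hS2 : ∀ W ∈ S, ¬ W ≤ L₂) :
    2 * S.card ≤ (d - 2) * e + (e - 2) * d + (S.filter fun W => ¬ Disjoint W L₁).card +
      (S.filter fun W => ¬ Disjoint W L₂).card ∧
    (b₀ ∈ M → b₂ ∈ M → (∀ v ∈ M, aeval v f = 0 ∧ aeval v φ = 0) →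
      2 * S.card + (d + e - 4) ≤ (d - 2) * e + (e - 2) * d +
        (S.filter fun W => ¬ Disjoint W L₁).card +
        (S.filter fun W => ¬ Disjoint W L₂).card +
        (S.filter fun W => ¬ Disjoint W M).card) := by
  obtain ⟨T, hT⟩ := exists_linearEquiv_of_linearIndependent hb
  have hT1 : ∀ v : Fin 4 → K, v 2 = 0 → v 3 = 0 → T v ∈ L₁ := fun v h2 h3 => by
    rw [hT, h2, h3, zero_smul, zero_smul, add_zero, add_zero]
    exact L₁.add_mem (L₁.smul_mem _ hb₀) (L₁.smul_mem _ hb₁)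
  have hT2 : ∀ v : Fin 4 → K, v 0 = 0 → v 1 = 0 → T v ∈ L₂ := fun v h2 h3 => by
    rw [hT, h2, h3, zero_smul, zero_smul, zero_add, zero_add]
    exact L₂.add_mem (L₂.smul_mem _ hb₂) (L₂.smul_mem _ hb₃)
  have hTM : b₀ ∈ M → b₂ ∈ M → ∀ v : Fin 4 → K, v 1 = 0 → v 3 = 0 → T v ∈ M :=
    fun h0 h2 v h1 h3 => by
      rw [hT, h1, h3, zero_smul, zero_smul, add_zero, add_zero]
      exact M.add_mem (M.smul_mem _ h0) (M.smul_mem _ h2)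
  have hdis : ∀ {N W : Submodule K (Fin 4 → K)} {i j : Fin 4},
      (∀ v : Fin 4 → K, v i = 0 → v j = 0 → T v ∈ N) →
      MeetsCoordLine (W.map (T.symm : (Fin 4 → K) →ₗ[K] (Fin 4 → K))) i j → ¬ Disjoint W N := by
    rintro N W i j hN ⟨v, hv, hv0, hi, hj⟩ h
    exact hv0 (T.map_eq_zero_iff.1 (Submodule.disjoint_def.1 h _ (mem_map_symm.1 hv) (hN v hi hj)))
  have hsm : ∀ i : Fin 4, ∃ u, dir1 (coordChange T f) (Pi.single i (1 : K)) u ≠ 0 := fun i => by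
    obtain ⟨u, hu⟩ := hs (T (Pi.single i 1)) fun h => by
      have := congrFun (T.map_eq_zero_iff.1 h) i
      simp at this
    exact ⟨T.symm u, by rwa [dir1_coordChange, LinearEquiv.apply_symm_apply]⟩
  have hnle : ∀ {N W : Submodule K (Fin 4 → K)} {i j : Fin 4},
      (∀ v : Fin 4 → K, v i = 0 → v j = 0 → T v ∈ N) → ¬ W ≤ N →
      ∃ v ∈ W.map (T.symm : (Fin 4 → K) →ₗ[K] (Fin 4 → K)), ¬ (v i = 0 ∧ v j = 0) := by
    intro N W i j hN h
    by_contra! hcon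
    refine h fun x hx => ?_
    have h1 := hcon (T.symm x) ⟨x, hx, rfl⟩
    simpa using hN _ h1.1 h1.2
  obtain ⟨u₁, hu₁⟩ := hsm 0
  obtain ⟨u₂, hu₂⟩ := hsm 2
  set S' := S.image fun W : Submodule K (Fin 4 → K) =>
    W.map (T.symm : (Fin 4 → K) →ₗ[K] (Fin 4 → K)) with hS'
  have hcard : S'.card = S.card := Finset.card_image_of_injective _ (map_symm_injective T)
  have key := two_mul_card_le_of_coordLines (coordChange_isHomogeneous T hf)
    (coordChange_isHomogeneous T hφ) hd he (coordChange_irreducible T hirr)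
    (coordChange_not_dvd T hfφ)
    (fun v h2 h3 => by rw [aeval_coordChange]; exact (hL₁ _ (hT1 v h2 h3)).1)
    (fun v h2 h3 => by rw [aeval_coordChange]; exact (hL₂ _ (hT2 v h2 h3)).1)
    (fun v h2 h3 => by rw [aeval_coordChange]; exact (hL₁ _ (hT1 v h2 h3)).2)
    (fun v h2 h3 => by rw [aeval_coordChange]; exact (hL₂ _ (hT2 v h2 h3)).2)
    ⟨_, u₁, by simp, by simp, hu₁⟩ ⟨_, u₂, by simp, by simp, hu₂⟩ S'
    (Finset.forall_mem_image.2 fun W hW => ⟨by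
      rw [LinearEquiv.finrank_map_eq]
      exact (hS W hW).1, fun v hv => by
        rw [aeval_coordChange]
        exact (hS W hW).2.1 _ (mem_map_symm.1 hv), fun v hv => by
        rw [aeval_coordChange]
        exact (hS W hW).2.2 _ (mem_map_symm.1 hv)⟩)
    (Finset.forall_mem_image.2 fun W hW => hnle hT2 (hS2 W hW))
    (Finset.forall_mem_image.2 fun W hW => hnle hT1 (hS1 W hW))
  have c1 : (S'.filter fun W => MeetsCoordLine W 2 3).card ≤
    (S.filter fun W => ¬ Disjoint W L₁).card :=
    card_filter_image_le (S := S) (fun W => MeetsCoordLine W 2 3) (fun W => ¬ Disjoint W L₁)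
      fun W _ h => hdis hT1 h
  have c2 : (S'.filter fun W => MeetsCoordLine W 0 1).card ≤
    (S.filter fun W => ¬ Disjoint W L₂).card :=
    card_filter_image_le (S := S) (fun W => MeetsCoordLine W 0 1) (fun W => ¬ Disjoint W L₂)
      fun W _ h => hdis hT2 h
  rw [hcard] at key
  refine ⟨by omega, fun h0 h2 hM => ?_⟩
  have c3 : (S'.filter fun W => MeetsCoordLine W 1 3).card ≤
    (S.filter fun W => ¬ Disjoint W M).card :=
    card_filter_image_le (S := S) (fun W => MeetsCoordLine W 1 3) (fun W => ¬ Disjoint W M)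
      fun W _ h => hdis (hTM h0 h2) h
  have := key.2 (fun v h1 h3 => by rw [aeval_coordChange]; exact (hM _ (hTM h0 h2 v h1 h3)).1)
    (fun v h1 h3 => by rw [aeval_coordChange]; exact (hM _ (hTM h0 h2 v h1 h3)).2)
  omega

open Classical in
lemma card_add_card_le_of_frame (hf : f.IsHomogeneous d) (hφ : φ.IsHomogeneous e) (hd : 3 ≤ d)
    (he : 1 ≤ e) (hirr : Irreducible f) (hfφ : ¬ f ∣ φ)
    {b₀ b₁ b₂ b₃ : Fin 4 → K} (hb : LinearIndependent K ![b₀, b₁, b₂, b₃])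
    (hb₀ : aeval b₀ f ≠ 0) (hb₂ : aeval b₂ f ≠ 0)
    (S : Finset (Submodule K (Fin 4 → K))) (hS : ∀ W ∈ S, Module.finrank K W = 2 ∧
      (∀ v ∈ W, aeval v f = 0) ∧ (∀ v ∈ W, aeval v φ = 0))
    (hS1 : ∀ W ∈ S, Disjoint W (Submodule.span K {b₀, b₁}))
    (hS2 : ∀ W ∈ S, Disjoint W (Submodule.span K {b₂, b₃}))
    (hp : ∀ W ∈ S, ∃ x y : Fin 4 → K, x ∈ Submodule.span K {b₀, b₁} ∧
      y ∈ Submodule.span K {b₂, b₃} ∧ x + y ∈ W ∧ dir1 f (x + y) y ≠ 0) :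
    S.card + (S.filter (GradientsProportional f φ)).card ≤ d * e := by
  obtain ⟨T, hT⟩ := exists_linearEquiv_of_linearIndependent hb
  have hT1 : ∀ v : Fin 4 → K, v 2 = 0 → v 3 = 0 → T v ∈ Submodule.span K {b₀, b₁} :=
    fun v h2 h3 => by
      rw [hT, h2, h3, zero_smul, zero_smul, add_zero, add_zero]
      exact Submodule.mem_span_pair.2 ⟨_, _, rfl⟩
  have hT2 : ∀ v : Fin 4 → K, v 0 = 0 → v 1 = 0 → T v ∈ Submodule.span K {b₂, b₃} :=
    fun v h2 h3 => by
      rw [hT, h2, h3, zero_smul, zero_smul, zero_add, zero_add]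
      exact Submodule.mem_span_pair.2 ⟨_, _, rfl⟩
  have hdis : ∀ {N W : Submodule K (Fin 4 → K)} {i j : Fin 4},
      (∀ v : Fin 4 → K, v i = 0 → v j = 0 → T v ∈ N) → Disjoint W N →
      ¬ MeetsCoordLine (W.map (T.symm : (Fin 4 → K) →ₗ[K] (Fin 4 → K))) i j := by
    rintro N W i j hN h ⟨v, hv, hv0, hi, hj⟩
    exact hv0 (T.map_eq_zero_iff.1 (Submodule.disjoint_def.1 h _ (mem_map_symm.1 hv) (hN v hi hj)))
  set S' := S.image fun W : Submodule K (Fin 4 → K) =>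
    W.map (T.symm : (Fin 4 → K) →ₗ[K] (Fin 4 → K)) with hS'
  have hcard : S'.card = S.card := Finset.card_image_of_injective _ (map_symm_injective T)
  set Q : Submodule K (Fin 4 → K) → Prop := fun W =>
    ∃ V ∈ S, GradientsProportional f φ V ∧
      V.map (T.symm : (Fin 4 → K) →ₗ[K] (Fin 4 → K)) = W with hQ
  have key := card_add_card_le_of_coordLines (coordChange_isHomogeneous T hf)
    (coordChange_isHomogeneous T hφ) hd he (coordChange_irreducible T hirr)
    (coordChange_not_dvd T hfφ)
    ⟨Pi.single 0 1, by simp, by simp, by rw [aeval_coordChange, hT]; simpa using hb₀⟩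
    ⟨Pi.single 2 1, by simp, by simp, by rw [aeval_coordChange, hT]; simpa using hb₂⟩ S'
    (Finset.forall_mem_image.2 fun W hW => ⟨by
      rw [LinearEquiv.finrank_map_eq]
      exact (hS W hW).1, fun v hv => by
        rw [aeval_coordChange]
        exact (hS W hW).2.1 _ (mem_map_symm.1 hv), fun v hv => by
        rw [aeval_coordChange]
        exact (hS W hW).2.2 _ (mem_map_symm.1 hv)⟩)
    (Finset.forall_mem_image.2 fun W hW => hdis hT1 (hS1 W hW))
    (Finset.forall_mem_image.2 fun W hW => hdis hT2 (hS2 W hW)) Q ?_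
  · have c1 : (S.filter (GradientsProportional f φ)).card ≤ (S'.filter Q).card := by
      rw [← Finset.card_image_of_injective (S.filter (GradientsProportional f φ))
        (map_symm_injective T)]
      refine Finset.card_le_card fun W hW => ?_
      obtain ⟨V, hV, rfl⟩ := Finset.mem_image.1 hW
      obtain ⟨hVS, hVm⟩ := Finset.mem_filter.1 hV
      exact Finset.mem_filter.2 ⟨Finset.mem_image_of_mem _ hVS, V, hVS, hVm, rfl⟩
    have key' : S'.card + (S'.filter Q).card ≤ d * e := by convert key
    omega
  · rintro _ - ⟨V, hVS, hVm, rfl⟩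
    refine ⟨fun v hv a b => ?_, ?_⟩
    · simp only [dir1_coordChange]
      exact hVm _ (mem_map_symm.1 hv) _ _
    · obtain ⟨x, y, hx, hy, hxy, hne⟩ := hp V hVS
      obtain ⟨x0, x1, rfl⟩ := Submodule.mem_span_pair.1 hx
      obtain ⟨y0, y1, rfl⟩ := Submodule.mem_span_pair.1 hy
      have h1 : T ![x0, x1, y0, y1] = x0 • b₀ + x1 • b₁ + (y0 • b₂ + y1 • b₃) := by
        rw [hT]
        simp [add_assoc]
      have h2 : T ![0, 0, y0, y1] = y0 • b₂ + y1 • b₃ := by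
        rw [hT]
        simp
      refine ⟨![x0, x1, y0, y1], mem_map_symm.2 (by rwa [h1]), ?_⟩
      rw [dir1_coordChange, h1]
      change dir1 f _ (T ![0, 0, y0, y1]) ≠ 0
      rwa [h2]

end IntrinsicCounts

section GenericLines

variable {K : Type*} [Field K] [Infinite K]

lemma exists_eval_ne_zero_notMem {q : MvPolynomial (Fin 4) K} (hq : q ≠ 0)
    (𝓕 : Finset (Submodule K (Fin 4 → K))) (h𝓕 : ∀ F ∈ 𝓕, F ≠ ⊤) :
    ∃ v : Fin 4 → K, aeval v q ≠ 0 ∧ ∀ F ∈ 𝓕, v ∉ F := by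
  have hex : ∀ F : Submodule K (Fin 4 → K), ∃ l : MvPolynomial (Fin 4) K,
      F ∈ 𝓕 → l ≠ 0 ∧ ∀ v ∈ F, eval v l = 0 := by
    intro F
    by_cases hF : F ∈ 𝓕
    · obtain ⟨g, hg, hle⟩ := Submodule.exists_le_ker_of_lt_top F (h𝓕 F hF).lt_top
      have hev : ∀ v, eval v (∑ i, C (g (Pi.single i 1)) * X i) = g v := fun v => by
        rw [map_sum]
        conv_rhs => rw [← Finset.univ_sum_single v]
        rw [map_sum]
        refine Finset.sum_congr rfl fun i _ => ?_
        have : (Pi.single i (v i) : Fin 4 → K) = v i • Pi.single i 1 := by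
          rw [← Pi.single_smul', smul_eq_mul, mul_one]
        rw [this, map_smul, map_mul, eval_C, eval_X, smul_eq_mul, mul_comm]
      refine ⟨∑ i, C (g (Pi.single i 1)) * X i, fun _ =>
        ⟨fun h0 => hg (LinearMap.ext fun v => ?_), fun v hv => ?_⟩⟩
      · rw [← hev, h0, map_zero, LinearMap.zero_apply]
      · rw [hev]
        exact hle hv
    · exact ⟨0, fun h => absurd h hF⟩
  choose l hl using hex
  have hne : q * ∏ F ∈ 𝓕, l F ≠ 0 :=
    mul_ne_zero hq (Finset.prod_ne_zero_iff.2 fun F hF => (hl F hF).1)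
  obtain ⟨v, hv⟩ : ∃ v, eval v (q * ∏ F ∈ 𝓕, l F) ≠ 0 := by
    by_contra! h
    exact hne (MvPolynomial.funext fun v => by rw [h v, map_zero])
  rw [map_mul, map_prod] at hv
  refine ⟨v, left_ne_zero_of_mul hv, fun F hF hvF => ?_⟩
  exact Finset.prod_ne_zero_iff.1 (right_ne_zero_of_mul hv) F hF ((hl F hF).2 v hvF)

lemma exists_generic_line {q : MvPolynomial (Fin 4) K} (hq : q ≠ 0)
    (𝓕 : Finset (Submodule K (Fin 4 → K))) (h𝓕 : ∀ F ∈ 𝓕, Module.finrank K F ≤ 2) :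
    ∃ b₀ b₁ : Fin 4 → K, LinearIndependent K ![b₀, b₁] ∧ aeval b₀ q ≠ 0 ∧
      ∀ F ∈ 𝓕, Disjoint F (Submodule.span K {b₀, b₁}) := by
  classical
  have hbot : ∀ F ∈ insert ⊥ 𝓕, Module.finrank K F ≤ 2 := by
    intro F hF
    rcases Finset.mem_insert.1 hF with rfl | hF
    · simp
    · exact h𝓕 F hF
  obtain ⟨b₀, hb₀, hb₀F⟩ := exists_eval_ne_zero_notMem hq (insert ⊥ 𝓕) fun F hF h => by
    have := hbot F hF
    rw [h] at this
    simp at this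
  obtain ⟨b₁, -, hb₁F⟩ := exists_eval_ne_zero_notMem (one_ne_zero (α := MvPolynomial (Fin 4) K))
    ((insert ⊥ 𝓕).image fun F => F ⊔ Submodule.span K {b₀})
    (Finset.forall_mem_image.2 fun F hF h => by
      have h1 := hbot F hF
      have h2 := Submodule.finrank_add_le_finrank_add_finrank F (Submodule.span K {b₀})
      have h3 : Module.finrank K (Submodule.span K {b₀}) ≤ 1 := by
        have := finrank_span_finset_le_card (R := K) ({b₀} : Finset (Fin 4 → K))
        rwa [Finset.coe_singleton, Finset.card_singleton] at this
      rw [h] at h2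
      simp only [finrank_top, Module.finrank_fintype_fun_eq_card, Fintype.card_fin] at h2
      omega)
  rw [Finset.forall_mem_image] at hb₁F
  have key : ∀ F ∈ insert ⊥ 𝓕, ∀ x y : K, x • b₀ + y • b₁ ∈ F → x = 0 ∧ y = 0 := by
    intro F hF x y hxy
    have hy : y = 0 := by
      by_contra hy
      refine hb₁F hF (Submodule.mem_sup.2 ⟨y⁻¹ • (x • b₀ + y • b₁), F.smul_mem _ hxy,
        -(y⁻¹ * x) • b₀, Submodule.smul_mem _ _ (Submodule.mem_span_singleton_self _), ?_⟩)
      rw [smul_add, smul_smul, smul_smul, inv_mul_cancel₀ hy, neg_smul, one_smul]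
      abel
    rw [hy, zero_smul, add_zero] at hxy
    refine ⟨?_, hy⟩
    by_contra hx
    exact hb₀F F hF (by simpa [smul_smul, hx] using F.smul_mem x⁻¹ hxy)
  refine ⟨b₀, b₁, ?_, hb₀, fun F hF => ?_⟩
  · rw [LinearIndependent.pair_iff]
    exact fun x y h => key ⊥ (Finset.mem_insert_self _ _) x y ((Submodule.mem_bot K).2 h)
  · rw [Submodule.disjoint_def]
    intro v hv hv'
    obtain ⟨x, y, rfl⟩ := Submodule.mem_span_pair.1 hv'
    obtain ⟨rfl, rfl⟩ := key F (Finset.mem_insert_of_mem hF) x y hv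
    simp

lemma linearIndependent_of_disjoint {b₀ b₁ c₀ c₁ : Fin 4 → K}
    (hb : LinearIndependent K ![b₀, b₁]) (hc : LinearIndependent K ![c₀, c₁])
    (h : Disjoint (Submodule.span K {c₀, c₁}) (Submodule.span K {b₀, b₁})) :
    LinearIndependent K ![b₀, b₁, c₀, c₁] := by
  rw [LinearIndependent.pair_iff] at hb hc
  rw [Fintype.linearIndependent_iff]
  intro g hg
  rw [Fin.sum_univ_four] at hg
  simp only [Matrix.cons_val] at hg
  have h1 : g 2 • c₀ + g 3 • c₁ = -g 0 • b₀ + -g 1 • b₁ := by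
    rw [neg_smul, neg_smul, ← sub_eq_zero, ← hg]
    abel
  have h2 := Submodule.disjoint_def.1 h _ (Submodule.mem_span_pair.2 ⟨g 2, g 3, rfl⟩)
    (Submodule.mem_span_pair.2 ⟨_, _, h1.symm⟩)
  obtain ⟨h3, h4⟩ := hc _ _ h2
  obtain ⟨h5, h6⟩ := hb _ _ (h1.symm.trans h2)
  intro i
  fin_cases i
  · exact neg_eq_zero.1 h5
  · exact neg_eq_zero.1 h6
  · exact h3
  · exact h4

end GenericLines

section LineCounts

variable {K : Type*} [Field K] [Infinite K] {f φ : MvPolynomial (Fin 4) K} {d e : ℕ}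

lemma exists_span_pair {L : Submodule K (Fin 4 → K)} (hL : Module.finrank K L = 2)
    {p : Fin 4 → K} (hp : p ∈ L) (hp0 : p ≠ 0) : ∃ q : Fin 4 → K,
      LinearIndependent K ![p, q] ∧ Submodule.span K {p, q} = L := by
  obtain ⟨q, hq, hpq, hspan⟩ := exists_linearIndependent_pair hL hp hp0
  refine ⟨q, hpq, le_antisymm (Submodule.span_le.2 ?_) fun v hv => ?_⟩
  · rintro _ (rfl | rfl)
    exacts [hp, hq]
  · obtain ⟨a, b, rfl⟩ := hspan v hv
    exact Submodule.mem_span_pair.2 ⟨a, b, rfl⟩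

lemma exists_mem_ne_zero {L : Submodule K (Fin 4 → K)} (hL : Module.finrank K L = 2) :
    ∃ p ∈ L, p ≠ 0 := by
  refine L.ne_bot_iff.1 ?_
  rintro rfl
  simp at hL

open Classical in
/-- Lines along which the gradients are proportional count twice. -/
theorem card_add_card_gradientsProportional_le (hf : f.IsHomogeneous d) (hφ : φ.IsHomogeneous e)
    (hd : 3 ≤ d) (he : 1 ≤ e) (hirr : Irreducible f) (hfφ : ¬ f ∣ φ)
    (hs : ∀ v : Fin 4 → K, v ≠ 0 → ∃ u, dir1 f v u ≠ 0)
    (S : Finset (Submodule K (Fin 4 → K))) (hS : ∀ W ∈ S, Module.finrank K W = 2 ∧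
      (∀ v ∈ W, aeval v f = 0) ∧ (∀ v ∈ W, aeval v φ = 0)) :
    S.card + (S.filter (GradientsProportional f φ)).card ≤ d * e := by
  have hex : ∀ W : Submodule K (Fin 4 → K), ∃ p : Fin 4 → K, W ∈ S → p ∈ W ∧ p ≠ 0 := by
    intro W
    by_cases hW : W ∈ S
    · obtain ⟨p, hp⟩ := exists_mem_ne_zero (hS W hW).1
      exact ⟨p, fun _ => hp⟩
    · exact ⟨0, fun h => absurd h hW⟩
  choose p hp using hex
  have heval : ∀ (W : Submodule K (Fin 4 → K)) (v : Fin 4 → K),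
      aeval v (∑ i, C (aeval (p W) (pderiv i f)) * X i) = dir1 f (p W) v := by
    intro W v
    rw [dir1, map_sum]
    refine Finset.sum_congr rfl fun i _ => ?_
    simp [mul_comm]
  have hq : f * ∏ W ∈ S, ∑ i, C (aeval (p W) (pderiv i f)) * X i ≠ 0 := by
    refine mul_ne_zero hirr.ne_zero (Finset.prod_ne_zero_iff.2 fun W hW h0 => ?_)
    obtain ⟨u, hu⟩ := hs (p W) (hp W hW).2
    rw [← heval, h0, map_zero] at hu
    exact hu rfl
  obtain ⟨c₀, c₁, hc, hc₀, hcS⟩ := exists_generic_line hq S fun W hW => (hS W hW).1.le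
  rw [map_mul, map_prod] at hc₀
  have hc₀f := left_ne_zero_of_mul hc₀
  have hc₀p : ∀ W ∈ S, dir1 f (p W) c₀ ≠ 0 := fun W hW => by
    rw [← heval]
    exact Finset.prod_ne_zero_iff.1 (right_ne_zero_of_mul hc₀) W hW
  set n : Submodule K (Fin 4 → K) → Fin 4 → K := fun W =>
    dir1 f (p W) c₁ • c₀ - dir1 f (p W) c₀ • c₁ with hn
  obtain ⟨b₀, b₁, hb, hb₀, hbS⟩ := exists_generic_line hirr.ne_zero
    (S ∪ insert (Submodule.span K {c₀, c₁}) (S.image fun W => Submodule.span K {p W, n W}))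
    (by
      intro F hF
      have hpair : ∀ x y : Fin 4 → K, Module.finrank K (Submodule.span K {x, y}) ≤ 2 := by
        intro x y
        have := finrank_span_finset_le_card (R := K) ({x, y} : Finset (Fin 4 → K))
        rw [Finset.coe_pair] at this
        exact this.trans Finset.card_le_two
      rcases Finset.mem_union.1 hF with hF | hF
      · exact (hS F hF).1.le
      · rcases Finset.mem_insert.1 hF with rfl | hF
        · exact hpair _ _
        · obtain ⟨W, -, rfl⟩ := Finset.mem_image.1 hF
          exact hpair _ _)
  have hbc := linearIndependent_of_disjoint hb hc (hbS _ (by simp))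
  refine card_add_card_le_of_frame hf hφ hd he hirr hfφ hbc hb₀ hc₀f S hS
    (fun W hW => hbS W (Finset.mem_union_left _ hW)) hcS fun W hW => ?_
  obtain ⟨x0, x1, y0, y1, hxy⟩ : ∃ x0 x1 y0 y1 : K,
      p W = (x0 • b₀ + x1 • b₁) + (y0 • c₀ + y1 • c₁) := by
    obtain ⟨T, hT⟩ := exists_linearEquiv_of_linearIndependent hbc
    have h := (T.apply_symm_apply (p W)).symm.trans (hT _)
    exact ⟨_, _, _, _, h.trans (add_assoc _ _ _)⟩
  have hpW := hp W hW
  refine ⟨_, _, Submodule.mem_span_pair.2 ⟨x0, x1, rfl⟩, Submodule.mem_span_pair.2 ⟨y0, y1, rfl⟩,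
    hxy ▸ hpW.1, fun h0 => ?_⟩
  rw [← hxy, dir1_add, dir1_smul, dir1_smul] at h0
  have hc₀W := hc₀p W hW
  have hx : x0 • b₀ + x1 • b₁ = (1 : K) • p W + (y1 / dir1 f (p W) c₀) • n W := by
    have h1 : y0 = -(y1 / dir1 f (p W) c₀) * dir1 f (p W) c₁ := by
      field_simp
      linear_combination h0
    have h2 : y1 / dir1 f (p W) c₀ * dir1 f (p W) c₀ = y1 := div_mul_cancel₀ _ hc₀W
    have h3 : (y1 / dir1 f (p W) c₀) • n W = -(y0 • c₀ + y1 • c₁) := by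
      rw [hn]
      dsimp only
      rw [smul_sub, smul_smul, smul_smul, h2, h1]
      module
    rw [h3, one_smul, ← sub_eq_add_neg]
    exact eq_sub_of_add_eq hxy.symm
  have hmem := Submodule.disjoint_def.1 (hbS (Submodule.span K {p W, n W}) (by
    refine Finset.mem_union_right _ (Finset.mem_insert_of_mem (Finset.mem_image_of_mem _ hW))))
    (x0 • b₀ + x1 • b₁) (hx ▸ Submodule.mem_span_pair.2 ⟨_, _, rfl⟩)
    (Submodule.mem_span_pair.2 ⟨_, _, rfl⟩)
  rw [hmem, zero_add] at hxy
  exact hpW.2 (Submodule.disjoint_def.1 (hcS W hW) _ hpW.1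
    (hxy ▸ Submodule.mem_span_pair.2 ⟨_, _, rfl⟩))

open Classical in
/-- Two skew lines. -/
theorem two_mul_card_le_of_disjoint (hf : f.IsHomogeneous d) (hφ : φ.IsHomogeneous e)
    (hd : 3 ≤ d) (he : 2 ≤ e) (hirr : Irreducible f) (hfφ : ¬ f ∣ φ)
    (hs : ∀ v : Fin 4 → K, v ≠ 0 → ∃ u, dir1 f v u ≠ 0)
    (S : Finset (Submodule K (Fin 4 → K))) (hS : ∀ W ∈ S, Module.finrank K W = 2 ∧
      (∀ v ∈ W, aeval v f = 0) ∧ (∀ v ∈ W, aeval v φ = 0))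
    {L₁ L₂ : Submodule K (Fin 4 → K)} (hL₁ : L₁ ∈ S) (hL₂ : L₂ ∈ S) (hL : Disjoint L₁ L₂) :
    2 * (S.card - 2) ≤ (d - 2) * e + (e - 2) * d +
      (((S.erase L₁).erase L₂).filter fun W => ¬ Disjoint W L₁).card +
      (((S.erase L₁).erase L₂).filter fun W => ¬ Disjoint W L₂).card := by
  have h1 := hS _ hL₁
  have h2 := hS _ hL₂
  have hne : L₂ ≠ L₁ := by
    rintro rfl
    have := disjoint_self.1 hL
    subst this
    simp at h1
  obtain ⟨b₀, hb₀, hb₀0⟩ := exists_mem_ne_zero h1.1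
  obtain ⟨b₁, hb, hbL⟩ := exists_span_pair h1.1 hb₀ hb₀0
  obtain ⟨c₀, hc₀, hc₀0⟩ := exists_mem_ne_zero h2.1
  obtain ⟨c₁, hc, hcL⟩ := exists_span_pair h2.1 hc₀ hc₀0
  have hbc : LinearIndependent K ![b₀, b₁, c₀, c₁] :=
    linearIndependent_of_disjoint hb hc (by rw [hbL, hcL]; exact hL.symm)
  have hcard : ((S.erase L₁).erase L₂).card = S.card - 2 := by
    rw [Finset.card_erase_of_mem (Finset.mem_erase.2 ⟨hne, hL₂⟩), Finset.card_erase_of_mem hL₁,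
      Nat.sub_sub]
  rw [← hcard]
  refine (two_mul_card_le_of_frame (M := ⊥) hf hφ hd he hirr hfφ hs
    (fun v hv => ⟨h1.2.1 v hv, h1.2.2 v hv⟩) (fun v hv => ⟨h2.2.1 v hv, h2.2.2 v hv⟩) hbc hb₀
    (hbL ▸ Submodule.mem_span_pair.2 ⟨0, 1, by simp⟩) hc₀
    (hcL ▸ Submodule.mem_span_pair.2 ⟨0, 1, by simp⟩) _
    (fun W hW => hS W (Finset.mem_of_mem_erase (Finset.mem_of_mem_erase hW)))
    (fun W hW hle => ?_) fun W hW hle => ?_).1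
  · refine (Finset.mem_erase.1 (Finset.mem_erase.1 hW).2).1
      (Submodule.eq_of_le_of_finrank_eq hle ?_)
    rw [h1.1, (hS W (Finset.mem_of_mem_erase (Finset.mem_of_mem_erase hW))).1]
  · refine (Finset.mem_erase.1 hW).1 (Submodule.eq_of_le_of_finrank_eq hle ?_)
    rw [h2.1, (hS W (Finset.mem_of_mem_erase (Finset.mem_of_mem_erase hW))).1]

open Classical in
/-- A chain of three lines. -/
theorem two_mul_card_le_of_chain (hf : f.IsHomogeneous d) (hφ : φ.IsHomogeneous e)
    (hd : 3 ≤ d) (he : 2 ≤ e) (hirr : Irreducible f) (hfφ : ¬ f ∣ φ)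
    (hs : ∀ v : Fin 4 → K, v ≠ 0 → ∃ u, dir1 f v u ≠ 0)
    (S : Finset (Submodule K (Fin 4 → K))) (hS : ∀ W ∈ S, Module.finrank K W = 2 ∧
      (∀ v ∈ W, aeval v f = 0) ∧ (∀ v ∈ W, aeval v φ = 0))
    {L₁ L₂ M : Submodule K (Fin 4 → K)} (hL₁ : L₁ ∈ S) (hL₂ : L₂ ∈ S) (hM : M ∈ S)
    (hL : Disjoint L₁ L₂) (hM₁ : ¬ Disjoint M L₁) (hM₂ : ¬ Disjoint M L₂) (hne₁ : M ≠ L₁)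
    (hne₂ : M ≠ L₂) :
    2 * (S.card - 3) + (d + e - 4) ≤ (d - 2) * e + (e - 2) * d +
      ((((S.erase L₁).erase L₂).erase M).filter fun W => ¬ Disjoint W L₁).card +
      ((((S.erase L₁).erase L₂).erase M).filter fun W => ¬ Disjoint W L₂).card +
      ((((S.erase L₁).erase L₂).erase M).filter fun W => ¬ Disjoint W M).card := by
  have h1 := hS _ hL₁
  have h2 := hS _ hL₂
  have h3 := hS _ hM
  have hne : L₂ ≠ L₁ := by
    rintro rfl
    have := disjoint_self.1 hL
    subst this
    simp at h1
  have hmeet : ∀ {W V : Submodule K (Fin 4 → K)}, ¬ Disjoint W V → ∃ v ∈ V, v ≠ 0 ∧ v ∈ W := by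
    intro W V h
    rw [Submodule.disjoint_def] at h
    push Not at h
    obtain ⟨v, hv, hv', hv0⟩ := h
    exact ⟨v, hv', hv0, hv⟩
  obtain ⟨b₀, hb₀, hb₀0, hb₀M⟩ := hmeet hM₁
  obtain ⟨b₁, hb, hbL⟩ := exists_span_pair h1.1 hb₀ hb₀0
  obtain ⟨c₀, hc₀, hc₀0, hc₀M⟩ := hmeet hM₂
  obtain ⟨c₁, hc, hcL⟩ := exists_span_pair h2.1 hc₀ hc₀0
  have hbc : LinearIndependent K ![b₀, b₁, c₀, c₁] :=
    linearIndependent_of_disjoint hb hc (by rw [hbL, hcL]; exact hL.symm)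
  have hcard : (((S.erase L₁).erase L₂).erase M).card = S.card - 3 := by
    rw [Finset.card_erase_of_mem (Finset.mem_erase.2 ⟨hne₂, Finset.mem_erase.2 ⟨hne₁, hM⟩⟩),
      Finset.card_erase_of_mem (Finset.mem_erase.2 ⟨hne, hL₂⟩), Finset.card_erase_of_mem hL₁,
      Nat.sub_sub, Nat.sub_sub]
  have hsub : ∀ W ∈ ((S.erase L₁).erase L₂).erase M, W ∈ S := fun W hW =>
    Finset.mem_of_mem_erase (Finset.mem_of_mem_erase (Finset.mem_of_mem_erase hW))
  rw [← hcard]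
  refine (two_mul_card_le_of_frame hf hφ hd he hirr hfφ hs
    (fun v hv => ⟨h1.2.1 v hv, h1.2.2 v hv⟩) (fun v hv => ⟨h2.2.1 v hv, h2.2.2 v hv⟩) hbc hb₀
    (hbL ▸ Submodule.mem_span_pair.2 ⟨0, 1, by simp⟩) hc₀
    (hcL ▸ Submodule.mem_span_pair.2 ⟨0, 1, by simp⟩) _ (fun W hW => hS W (hsub W hW))
    (fun W hW hle => ?_) fun W hW hle => ?_).2 hb₀M hc₀M fun v hv => ⟨h3.2.1 v hv, h3.2.2 v hv⟩
  · refine (Finset.mem_erase.1 (Finset.mem_erase.1 (Finset.mem_erase.1 hW).2).2).1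
      (Submodule.eq_of_le_of_finrank_eq hle ?_)
    rw [h1.1, (hS W (hsub W hW)).1]
  · refine (Finset.mem_erase.1 (Finset.mem_erase.1 hW).2).1
      (Submodule.eq_of_le_of_finrank_eq hle ?_)
    rw [h2.1, (hS W (hsub W hW)).1]

end LineCounts

section InflectionDegree

variable {K : Type*} [Field K] {f : MvPolynomial (Fin 4) K} {d : ℕ} {e₀ e₁ w₂ w₃ : Fin 4 → K}

lemma constVec_left_eq (e₀ e₁ : Fin 4 → K) :
    constVec e₀ = linePoint e₀ e₁ + (-Polynomial.X : Polynomial K) • constVec e₁ := by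
  funext i
  simp [linePoint, constVec]

namespace IsLineFrame

variable [IsAlgClosed K]

/-- The inflection polynomial of a line has degree at most `8 d - 14`. -/
lemma natDegree_inflection_le (h : IsLineFrame f d e₀ e₁ w₂ w₃) :
    (inflection f (linePoint e₀ e₁) (constVec e₁)
      (tangentVec f (linePoint e₀ e₁) (constVec w₂) (constVec w₃))).natDegree ≤ 8 * d - 14 := by
  have hd := h.three_le
  have hP := natDegree_linePoint_le e₀ e₁
  have hl := natDegree_tangentVec_le h.smooth.1 hP (natDegree_constVec_le w₂)
    (natDegree_constVec_le w₃)
  have hl1 := dir1_tangentVec f (linePoint e₀ e₁) (constVec w₂) (constVec w₃)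
  set l := tangentVec f (linePoint e₀ e₁) (constVec w₂) (constVec w₃)
  set P := linePoint e₀ e₁ with hPdef
  have h0 := natDegree_constVec_le e₀
  have h1 := natDegree_constVec_le e₁
  have hPl : dir2 f P P l = 0 := by rw [dir2_self P l h.smooth.1, hl1, mul_zero]
  have hPPl : dir3 f P P P l = 0 := by rw [dir3_self P P l h.smooth.1, hPl, mul_zero]
  have hPll := dir3_self P l l h.smooth.1
  have hP1l := dir3_self P (constVec e₁) l h.smooth.1
  have h0eq := constVec_left_eq e₀ e₁
  rw [← hPdef] at h0eq
  have e0ll : dir3 f P (constVec e₀) l l =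
      ((d - 2 : ℕ) : Polynomial K) * dir2 f P l l - Polynomial.X * dir3 f P (constVec e₁) l l := by
    rw [h0eq, dir3_add_left, dir3_smul_left, hPll]; ring
  have e01l : dir3 f P (constVec e₀) (constVec e₁) l =
      ((d - 2 : ℕ) : Polynomial K) * dir2 f P (constVec e₁) l -
        Polynomial.X * dir3 f P (constVec e₁) (constVec e₁) l := by
    rw [h0eq, dir3_add_left, dir3_smul_left, hP1l]; ring
  have e00l : dir3 f P (constVec e₀) (constVec e₀) l =
      - 2 * Polynomial.X * (((d - 2 : ℕ) : Polynomial K) * dir2 f P (constVec e₁) l) +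
        Polynomial.X ^ 2 * dir3 f P (constVec e₁) (constVec e₁) l := by
    rw [h0eq, dir3_add_left, dir3_smul_left, dir3_add_mid, dir3_smul_mid, dir3_add_mid,
      dir3_smul_mid, hPPl, hP1l, dir3_comm_left f P (constVec e₁) P l, hP1l]; ring
  have key : ((d - 2 : ℕ) : Polynomial K) ^ 2 * inflection f P (constVec e₁) l =
      -(4 * (dir3 f P l l l * (dir3 f P (constVec e₀) (constVec e₀) l *
          dir3 f P (constVec e₁) (constVec e₁) l) -
        dir3 f P l l l * (dir3 f P (constVec e₀) (constVec e₁) l *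
          dir3 f P (constVec e₀) (constVec e₁) l)) -
      3 * (dir3 f P (constVec e₁) (constVec e₁) l * (dir3 f P (constVec e₀) l l *
          dir3 f P (constVec e₀) l l) -
        2 * (dir3 f P (constVec e₀) l l * (dir3 f P (constVec e₁) l l *
          dir3 f P (constVec e₀) (constVec e₁) l)) +
        dir3 f P (constVec e₀) (constVec e₀) l * (dir3 f P (constVec e₁) l l *
          dir3 f P (constVec e₁) l l))) := by
    rw [e0ll, e01l, e00l, inflection]; ring
  have hne : (((d - 2 : ℕ) : K)) ^ 2 ≠ 0 :=
    pow_ne_zero _ (h.natCast_ne_zero (d - 2) (by omega) (by omega))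
  have hdeg := Polynomial.natDegree_C_mul (p := inflection f P (constVec e₁) l) hne
  rw [Polynomial.C_pow, Polynomial.C_eq_natCast, key] at hdeg
  rw [← hdeg]
  have hab := fun (u v : Fin 4 → Polynomial K) (hu : ∀ i, (u i).natDegree ≤ 0)
      (hv : ∀ i, (v i).natDegree ≤ 0) =>
    natDegree_dir3_le (f := f) h.smooth.1 hP hu hv hl
  have hb := fun (u : Fin 4 → Polynomial K) (hu : ∀ i, (u i).natDegree ≤ 0) =>
    natDegree_dir3_le (f := f) h.smooth.1 hP hu hl hl
  have hlll := natDegree_dir3_le (f := f) h.smooth.1 hP hl hl hl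
  have h3 : ∀ {p q r : Polynomial K} {a b c : ℕ}, p.natDegree ≤ a → q.natDegree ≤ b →
      r.natDegree ≤ c → a + (b + c) ≤ 8 * d - 14 → (p * (q * r)).natDegree ≤ 8 * d - 14 :=
    fun hp hq hr hs => (Polynomial.natDegree_mul_le.trans (add_le_add hp
      (Polynomial.natDegree_mul_le.trans (add_le_add hq hr)))).trans hs
  have hcast : ∀ {p : Polynomial K} (k : ℕ), p.natDegree ≤ 8 * d - 14 →
      ((k : Polynomial K) * p).natDegree ≤ 8 * d - 14 := fun k hp => by
    rw [← Polynomial.C_eq_natCast]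
    exact (Polynomial.natDegree_C_mul_le _ _).trans hp
  rw [Polynomial.natDegree_neg]
  refine (Polynomial.natDegree_sub_le_of_le (m := 8 * d - 14) (n := 8 * d - 14)
    (hcast 4 ?_) (hcast 3 ?_)).trans (by simp)
  · exact (Polynomial.natDegree_sub_le_of_le (h3 hlll (hab _ _ h0 h0) (hab _ _ h1 h1) (by omega))
      (h3 hlll (hab _ _ h0 h1) (hab _ _ h0 h1) (by omega))).trans (by simp)
  · refine (Polynomial.natDegree_add_le_of_degree_le (n := 8 * d - 14)
      ((Polynomial.natDegree_sub_le_of_le (m := 8 * d - 14) (n := 8 * d - 14) ?_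
        (hcast 2 ?_)).trans (by simp)) ?_)
    · exact h3 (hab _ _ h1 h1) (hb _ h0) (hb _ h0) (by omega)
    · exact h3 (hb _ h0) (hb _ h1) (hab _ _ h0 h1) (by omega)
    · exact h3 (hab _ _ h0 h0) (hb _ h1) (hb _ h1) (by omega)

end IsLineFrame

end InflectionDegree

section TaylorCoefficients

variable {K A : Type*} [Field K] [CommRing A] [Algebra K A]

/-- The expansion of `f` at the point `P + Y w`, as a polynomial in `Y`. -/
noncomputable def expansion (f : MvPolynomial (Fin 4) K) (P w : Fin 4 → A) : Polynomial A :=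
  aeval (fun i => Polynomial.C (P i) + Polynomial.X * Polynomial.C (w i)) f

variable (f : MvPolynomial (Fin 4) K) (P w : Fin 4 → A)

lemma coeff_zero_expansion : (expansion f P w).coeff 0 = aeval P f := by
  have := map_aeval_point (fun i => Polynomial.C (P i) + Polynomial.X * Polynomial.C (w i))
    (Polynomial.eval₂AlgHom (AlgHom.id K A) 0 fun _ => Commute.all _ _) f
  simpa [Polynomial.coeff_zero_eq_eval_zero, expansion, Polynomial.eval₂_eq_eval_map] using this

lemma expansion_derivatives :
    (expansion f P w).coeff 1 = dir1 f P w ∧ 2 * (expansion f P w).coeff 2 = dir2 f P w w ∧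
      6 * (expansion f P w).coeff 3 = dir3 f P w w w := by
  set Q : Fin 4 → Polynomial A := fun i => Polynomial.C (P i) + Polynomial.X * Polynomial.C (w i)
    with hQ
  set W : Fin 4 → Polynomial A := fun i => Polynomial.C (w i) with hW
  let D : Derivation K (Polynomial A) (Polynomial A) :=
    (Polynomial.derivative' (R := A)).restrictScalars K
  have hD : ∀ p, D p = Polynomial.derivative p := fun p => rfl
  have hDQ : (fun i => D (Q i)) = W := by
    funext i; rw [hD]; simp [hQ, hW]
  have hDW : (fun i => D (W i)) = 0 := by
    funext i; rw [hD]; simp [hW]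
  have h1 : Polynomial.derivative (expansion f P w) = dir1 f Q W := by
    rw [← hD, expansion, ← hQ, derivation_aeval', hDQ]
  have h2 : Polynomial.derivative (dir1 f Q W) = dir2 f Q W W := by
    rw [← hD, derivation_dir1, hDQ, hDW, dir1_zero, add_zero]
  have h3 : Polynomial.derivative (dir2 f Q W W) = dir3 f Q W W W := by
    rw [← hD, derivation_dir2, hDQ, hDW, dir2_zero_left, dir2_zero_right, add_zero, add_zero]
  let ψ : Polynomial A →ₐ[K] A := Polynomial.eval₂AlgHom (AlgHom.id K A) 0 fun _ => Commute.all _ _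
  have hψ : ∀ p, ψ p = p.coeff 0 := fun p => by
    simp [ψ, Polynomial.coeff_zero_eq_eval_zero, Polynomial.eval₂_eq_eval_map]
  have hψQ : (fun i => ψ (Q i)) = P := by
    funext i; rw [hψ]; simp [hQ]
  have hψW : (fun i => ψ (W i)) = w := by
    funext i; rw [hψ]; simp [hW]
  have c1 := map_dir1 Q W ψ f
  have c2 := map_dir2 Q W W ψ f
  have c3 := map_dir3 Q W W W ψ f
  rw [hψQ, hψW, hψ] at c1 c2 c3
  rw [← h1] at c1
  rw [← h2, ← h1] at c2
  rw [← h3, ← h2, ← h1] at c3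
  simp only [Polynomial.coeff_derivative] at c1 c2 c3
  refine ⟨by rw [← c1]; norm_num, by rw [← c2]; push_cast; ring_nf, ?_⟩
  rw [← c3]; push_cast; ring_nf

end TaylorCoefficients

section

variable {K : Type*} [Field K]

/-- A power series in two variables, without terms of degree zero in the second one, that vanishes
on `j` lines through the origin has no term of degree at most `j`. -/
lemma X_pow_dvd_coeff_of_lines {G : Polynomial (Polynomial K)} (h0 : G.coeff 0 = 0) (S : Finset K)
    (hS : ∀ m ∈ S, G.eval₂ (Polynomial.compRingHom (Polynomial.C m * Polynomial.X))
      Polynomial.X = 0) (b : ℕ) :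
    (Polynomial.X : Polynomial K) ^ (S.card + 1 - b) ∣ G.coeff b := by
  rcases Nat.eq_zero_or_pos b with rfl | hb
  · simp [h0]
  rw [Polynomial.X_pow_dvd_iff]
  intro a ha
  set N := a + b with hN
  let q : Polynomial K :=
    ∑ c ∈ Finset.range N, Polynomial.monomial c ((G.coeff (N - c)).coeff c)
  have hq : q = 0 := by
    refine Polynomial.eq_zero_of_natDegree_lt_card_of_eval_eq_zero' q S (fun m hm => ?_) ?_
    · have h1 := hS m hm
      rw [Polynomial.eval₂_eq_sum_range' _ (n := G.natDegree + 1 + (N + 1)) (by omega)] at h1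
      have h2 := congrArg (fun p => p.coeff N) h1
      simp only [Polynomial.finsetSum_coeff, Polynomial.coeff_mul_X_pow',
        Polynomial.coe_compRingHom_apply, Polynomial.comp_C_mul_X_coeff,
        Polynomial.coeff_zero] at h2
      rw [← Finset.sum_subset (s₁ := Finset.range (N + 1))] at h2
      · rw [← Finset.sum_range_reflect, Finset.sum_range_succ] at h2
        simp only [q, Polynomial.eval_finsetSum, Polynomial.eval_monomial]
        rw [← h2]
        simp only [Nat.add_sub_cancel, Nat.sub_self, h0, Polynomial.coeff_zero, zero_mul,
          ite_self, add_zero]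
        refine Finset.sum_congr rfl fun c hc => ?_
        rw [Finset.mem_range] at hc
        rw [if_pos (by omega), Nat.sub_sub_self (by omega)]
      · intro c hc
        rw [Finset.mem_range] at hc ⊢
        omega
      · intro c _ hc
        rw [Finset.mem_range] at hc
        rw [if_neg (by omega)]
    · refine lt_of_le_of_lt (Polynomial.natDegree_sum_le_of_forall_le (n := N - 1) _ _
        fun c hc => (Polynomial.natDegree_monomial_le _).trans ?_) (by omega)
      rw [Finset.mem_range] at hc; omega
  have h2 := congrArg (fun p => p.coeff a) hq
  simp only [q, Polynomial.finsetSum_coeff, Polynomial.coeff_monomial, Polynomial.coeff_zero,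
    Finset.sum_ite_eq', Finset.mem_range] at h2
  rw [if_pos (by omega)] at h2
  rwa [hN, Nat.add_sub_cancel_left] at h2

end

section InflectionMultiplicity

variable {K : Type*} [Field K] {f : MvPolynomial (Fin 4) K} {d : ℕ} {e₀ e₁ w₂ w₃ : Fin 4 → K}

lemma tangentVec_map (f : MvPolynomial (Fin 4) K) (e₀ e₁ w₂ w₃ : Fin 4 → K) (s : K) :
    (fun i => Polynomial.aeval s
      (tangentVec f (linePoint e₀ e₁) (constVec w₂) (constVec w₃) i)) =
      tangentVec f (e₀ + s • e₁) w₂ w₃ := by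
  have a2 := map_dir1 (linePoint e₀ e₁) (constVec w₂) (Polynomial.aeval s) f
  have a3 := map_dir1 (linePoint e₀ e₁) (constVec w₃) (Polynomial.aeval s) f
  rw [aeval_linePoint, aeval_constVec] at a2 a3
  funext i
  simp only [tangentVec, Pi.add_apply, Pi.smul_apply, smul_eq_mul, map_add, map_mul, map_neg,
    a2, a3]
  simp [constVec]

lemma aeval_inflection (f : MvPolynomial (Fin 4) K) (e₀ e₁ w₂ w₃ : Fin 4 → K) (s : K) :
    Polynomial.aeval s (inflection f (linePoint e₀ e₁) (constVec e₁)
      (tangentVec f (linePoint e₀ e₁) (constVec w₂) (constVec w₃))) =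
    inflection f (e₀ + s • e₁) e₁ (tangentVec f (e₀ + s • e₁) w₂ w₃) := by
  simp only [inflection, map_add, map_sub, map_mul, map_pow, map_dir2, map_dir3, tangentVec_map,
    aeval_linePoint, aeval_constVec, map_ofNat]

lemma expansion_eq_aeval_linePoint (f : MvPolynomial (Fin 4) K) (p v : Fin 4 → K) :
    expansion f p v = aeval (linePoint p v) f := rfl

namespace IsLineFrame

variable [IsAlgClosed K]

lemma inflection_eq_zero_of_line (h : IsLineFrame f d e₀ e₁ w₂ w₃) {m : K}
    (hm : aeval (linePoint e₀ (tangentVec f e₀ w₂ w₃ + m • e₁)) f = 0) :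
    inflection f e₀ e₁ (tangentVec f e₀ w₂ w₃) = 0 := by
  obtain ⟨-, h2, h3⟩ := expansion_derivatives f e₀ (tangentVec f e₀ w₂ w₃ + m • e₁)
  rw [expansion_eq_aeval_linePoint, hm, Polynomial.coeff_zero, mul_zero] at h2 h3
  have z2 := congrArg (Polynomial.aeval (0 : K)) h.dir2_e₁
  have z3 := congrArg (Polynomial.aeval (0 : K)) h.dir3_e₁
  rw [map_dir2, aeval_linePoint, aeval_constVec, zero_smul, add_zero, map_zero] at z2
  rw [map_dir3, aeval_linePoint, aeval_constVec, zero_smul, add_zero, map_zero] at z3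
  set l := tangentVec f e₀ w₂ w₃
  simp only [dir2_add_left, dir2_add_right, dir2_smul_left, dir2_smul_right, z2,
    dir2_comm f e₀ l e₁] at h2
  simp only [dir3_add_left, dir3_add_mid, dir3_add_right, dir3_smul_left, dir3_smul_mid,
    dir3_smul_right, z3, dir3_comm_left f e₀ l e₁, dir3_comm_right f e₀ e₁ l e₁,
    dir3_comm_right f e₀ l l e₁] at h3
  rw [inflection]
  have hll : dir2 f e₀ l l = -2 * m * dir2 f e₀ e₁ l := by linear_combination -h2
  rw [hll]
  linear_combination (-4 * dir2 f e₀ e₁ l ^ 2) * h3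

lemma tangentVec_change (h : IsLineFrame f d e₀ e₁ w₂ w₃) : ∃ w : Fin 4 → K,
    tangentVec f (linePoint e₀ e₁) (constVec w₂) (constVec w₃) =
      tangentVec f (linePoint e₀ e₁) (constVec (tangentVec f e₀ w₂ w₃)) (constVec w) := by
  have hne := h.dir1_ne_zero_or 0
  rw [zero_smul, add_zero] at hne
  obtain ⟨c, e, hce⟩ : ∃ c e : K, dir1 f e₀ w₃ * e + dir1 f e₀ w₂ * c = 1 := by
    rcases hne with h0 | h0
    · exact ⟨(dir1 f e₀ w₂)⁻¹, 0, by simp [h0]⟩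
    · exact ⟨0, (dir1 f e₀ w₃)⁻¹, by simp [h0]⟩
  have hC := congrArg Polynomial.C hce
  have hlin : ∀ (a b : K) (u v : Fin 4 → K),
      constVec (a • u + b • v) = Polynomial.C a • constVec u + Polynomial.C b • constVec v := by
    intro a b u v; funext i; simp [constVec]
  refine ⟨c • w₂ + e • w₃, ?_⟩
  rw [tangentVec, tangentVec, hlin]
  conv_rhs => rw [tangentVec, hlin]
  simp only [dir1_add, dir1_smul]
  funext i
  simp only [Pi.add_apply, Pi.smul_apply, smul_eq_mul, map_neg]
  simp only [map_add, map_mul, map_one] at hC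
  linear_combination (-(dir1 f (linePoint e₀ e₁) (constVec w₃) * constVec w₂ i -
    dir1 f (linePoint e₀ e₁) (constVec w₂) * constVec w₃ i)) * hC

lemma X_pow_dvd_inflection (h : IsLineFrame f d e₀ e₁ w₂ w₃) (S : Finset K)
    (hS : ∀ m ∈ S, aeval (linePoint e₀ (tangentVec f e₀ w₂ w₃ + m • e₁)) f = 0) :
    (Polynomial.X : Polynomial K) ^ S.card ∣ inflection f (linePoint e₀ e₁) (constVec e₁)
      (tangentVec f (linePoint e₀ e₁) (constVec w₂) (constVec w₃)) := by
  obtain hj | hj | ⟨i, hi⟩ : S.card = 0 ∨ S.card = 1 ∨ ∃ i, S.card = i + 2 := by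
    rcases h1 : S.card with _ | _ | i
    · simp
    · simp
    · exact Or.inr (Or.inr ⟨i, rfl⟩)
  · simp [hj]
  · obtain ⟨m, hm⟩ := Finset.card_pos.1 (by omega : 0 < S.card)
    rw [hj, pow_one, Polynomial.X_dvd_iff, Polynomial.coeff_zero_eq_aeval_zero, aeval_inflection,
      zero_smul, add_zero]
    exact h.inflection_eq_zero_of_line (hS m hm)
  obtain ⟨w, hw⟩ := h.tangentVec_change
  rw [hw]
  set l := tangentVec f e₀ w₂ w₃
  set P := linePoint e₀ e₁ with hP
  set u := constVec e₁ with hu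
  set L := constVec l with hL
  set W := constVec w
  have hG0 : (expansion f P L).coeff 0 = 0 := by
    rw [coeff_zero_expansion]; exact h.aeval_linePoint_eq_zero
  have hGS : ∀ m ∈ S, (expansion f P L).eval₂
      (Polynomial.compRingHom (Polynomial.C m * Polynomial.X)) Polynomial.X = 0 := by
    intro m hm
    let ψ : Polynomial (Polynomial K) →ₐ[K] Polynomial K :=
      Polynomial.eval₂AlgHom (Polynomial.aeval (Polynomial.C m * Polynomial.X)) Polynomial.X
        fun _ => Commute.all _ _
    have h1 := map_aeval_point
      (fun i => Polynomial.C (P i) + Polynomial.X * Polynomial.C (L i)) ψ f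
    have h2 : (fun i => ψ (Polynomial.C (P i) + Polynomial.X * Polynomial.C (L i))) =
        linePoint e₀ (l + m • e₁) := by
      funext i
      change Polynomial.eval₂ _ _ _ = _
      simp [hP, hL, linePoint, constVec]
      ring
    rw [h2, hS m hm] at h1
    rw [← h1]
    rfl
  have hdvd := X_pow_dvd_coeff_of_lines hG0 S hGS
  obtain ⟨c1, c2, c3⟩ := expansion_derivatives f P L
  have d1 : Polynomial.X ^ (i + 2) ∣ dir1 f P L := by
    have := hdvd 1; rwa [hi, c1] at this
  have d2 : Polynomial.X ^ (i + 1) ∣ dir2 f P L L := by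
    have := hdvd 2; rw [hi] at this; rw [← c2]; exact Dvd.dvd.mul_left this _
  have d3 : Polynomial.X ^ i ∣ dir3 f P L L L := by
    have := hdvd 3; rw [hi] at this; rw [← c3]; exact Dvd.dvd.mul_left this _
  have hder : ∀ (n : ℕ) (p : Polynomial K), Polynomial.X ^ (n + 1) ∣ p →
      Polynomial.X ^ n ∣ Polynomial.derivative p := fun n p hp => by
    have := Polynomial.pow_sub_one_dvd_derivative_of_pow_dvd hp
    rwa [Nat.add_sub_cancel] at this
  have d1' : Polynomial.X ^ (i + 1) ∣ dir2 f P u L := by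
    rw [hP, hu, hL, dir2_e₁_constVec]
    exact hder (i + 1) _ d1
  have d1'' : Polynomial.X ^ i ∣ dir3 f P u u L := by
    rw [hP, hu, hL, dir3_e₁_constVec]
    exact hder i _ d1'
  have d2' : Polynomial.X ^ i ∣ dir3 f P u L L := by
    rw [hP, hu, hL, dir3_e₁_constVec]
    exact hder i _ d2
  have d0 : (Polynomial.X : Polynomial K) ^ (i + 1) ∣ dir1 f P L :=
    (pow_dvd_pow _ (by omega)).trans d1
  have d00 : (Polynomial.X : Polynomial K) ^ i ∣ dir1 f P L :=
    (pow_dvd_pow _ (by omega)).trans d1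
  have tul : Polynomial.X ^ (i + 1) ∣ dir2 f P u (tangentVec f P L W) := by
    rw [tangentVec, dir2_add_right, dir2_smul_right, dir2_smul_right]
    exact dvd_add (d1'.mul_left _) ((dvd_neg.2 d0).mul_right _)
  have tll : Polynomial.X ^ (i + 1) ∣ dir2 f P (tangentVec f P L W) (tangentVec f P L W) := by
    rw [tangentVec, dir2_add_right, dir2_smul_right, dir2_smul_right, dir2_add_left,
      dir2_smul_left, dir2_smul_left]
    exact dvd_add ((dvd_add (d2.mul_left _) ((dvd_neg.2 d0).mul_right _)).mul_left _)
      ((dvd_neg.2 d0).mul_right _)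
  have tuul : Polynomial.X ^ i ∣ dir3 f P u u (tangentVec f P L W) := by
    rw [tangentVec, dir3_add_right, dir3_smul_right, dir3_smul_right]
    exact dvd_add (d1''.mul_left _) ((dvd_neg.2 d00).mul_right _)
  have tull : Polynomial.X ^ i ∣ dir3 f P u (tangentVec f P L W) (tangentVec f P L W) := by
    rw [tangentVec, dir3_add_right, dir3_smul_right, dir3_smul_right, dir3_add_mid,
      dir3_smul_mid, dir3_smul_mid]
    exact dvd_add ((dvd_add (d2'.mul_left _) ((dvd_neg.2 d00).mul_right _)).mul_left _)
      ((dvd_neg.2 d00).mul_right _)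
  have tlll : Polynomial.X ^ i ∣
      dir3 f P (tangentVec f P L W) (tangentVec f P L W) (tangentVec f P L W) := by
    rw [tangentVec, dir3_add_right, dir3_smul_right, dir3_smul_right, dir3_add_mid,
      dir3_smul_mid, dir3_smul_mid, dir3_add_left, dir3_smul_left, dir3_smul_left]
    exact dvd_add ((dvd_add ((dvd_add (d3.mul_left _) ((dvd_neg.2 d00).mul_right _)).mul_left _)
      ((dvd_neg.2 d00).mul_right _)).mul_left _) ((dvd_neg.2 d00).mul_right _)
  have hall : ∀ {x y z : Polynomial K} (c : Polynomial K), Polynomial.X ^ (i + 1) ∣ x →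
      Polynomial.X ^ (i + 1) ∣ y → Polynomial.X ^ i ∣ z →
      (Polynomial.X : Polynomial K) ^ (i + 2) ∣ c * (x * y * z) := by
    intro x y z c hx hy hz
    refine Dvd.dvd.mul_left ((pow_dvd_pow _ (?_ : i + 2 ≤ (i + 1) + (i + 1) + i)).trans ?_) _
    · omega
    · rw [pow_add, pow_add]
      exact mul_dvd_mul (mul_dvd_mul hx hy) hz
  have := dvd_add (dvd_sub (hall 4 tul tul tlll) (hall 6 tul tll tull)) (hall 3 tll tll tuul)
  rw [hi, inflection]
  convert this using 1
  ring

end IsLineFrame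

end InflectionMultiplicity

section Neighbours

variable {K : Type*} [Field K] {f : MvPolynomial (Fin 4) K} {d : ℕ} {e₀ e₁ w₂ w₃ : Fin 4 → K}

lemma IsLineFrame.shift (h : IsLineFrame f d e₀ e₁ w₂ w₃) (s : K) :
    IsLineFrame f d (e₀ + s • e₁) e₁ w₂ w₃ where
  three_le := h.three_le
  natCast_ne_zero := h.natCast_ne_zero
  smooth := h.smooth
  indep := by
    have hi := h.indep
    rw [Fintype.linearIndependent_iff] at hi ⊢
    intro g hg
    have := hi ![g 0, g 0 * s + g 1, g 2, g 3] (by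
      rw [← hg, Fin.sum_univ_four, Fin.sum_univ_four]
      simp only [Matrix.cons_val]
      module)
    have h0 := this 0
    have h1 := this 1
    have h2 := this 2
    have h3 := this 3
    simp only [Matrix.cons_val] at h0 h1 h2 h3
    rw [h0, zero_mul, zero_add] at h1
    intro i
    fin_cases i <;> assumption
  vanish := fun x y => by
    have e : x • (e₀ + s • e₁) + y • e₁ = x • e₀ + (x * s + y) • e₁ := by module
    rw [e]
    exact h.vanish _ _

lemma inflection_shift (f : MvPolynomial (Fin 4) K) (e₀ e₁ w₂ w₃ : Fin 4 → K) (s : K) :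
    (inflection f (linePoint e₀ e₁) (constVec e₁)
      (tangentVec f (linePoint e₀ e₁) (constVec w₂) (constVec w₃))).comp
        (Polynomial.X + Polynomial.C s) =
    inflection f (linePoint (e₀ + s • e₁) e₁) (constVec e₁)
      (tangentVec f (linePoint (e₀ + s • e₁) e₁) (constVec w₂) (constVec w₃)) := by
  let ψ : Polynomial K →ₐ[K] Polynomial K := Polynomial.aeval (Polynomial.X + Polynomial.C s)
  have hP : (fun i => ψ (linePoint e₀ e₁ i)) = linePoint (e₀ + s • e₁) e₁ := by
    funext i
    simp [ψ, linePoint]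
    ring
  have hc : ∀ v : Fin 4 → K, (fun i => ψ (constVec v i)) = constVec v := by
    intro v; funext i; simp [ψ, constVec]
  have hl : (fun i => ψ (tangentVec f (linePoint e₀ e₁) (constVec w₂) (constVec w₃) i)) =
      tangentVec f (linePoint (e₀ + s • e₁) e₁) (constVec w₂) (constVec w₃) := by
    have a2 := map_dir1 (linePoint e₀ e₁) (constVec w₂) ψ f
    have a3 := map_dir1 (linePoint e₀ e₁) (constVec w₃) ψ f
    rw [hP, hc] at a2 a3
    funext i
    simp only [tangentVec, Pi.add_apply, Pi.smul_apply, smul_eq_mul, map_add, map_mul, map_neg,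
      a2, a3]
    rw [congrFun (hc w₂) i, congrFun (hc w₃) i]
  change ψ _ = _
  simp only [inflection, map_add, map_sub, map_mul, map_pow, map_dir2, map_dir3, hl, hP, hc,
    map_ofNat]

lemma isLineFrame_of_disjoint [Infinite K] (hd : 3 ≤ d) (hc : ∀ k : ℕ, 0 < k → k ≤ d → (k : K) ≠ 0)
    (hf : IsSmoothSurfaceOfDegree f d) (he : LinearIndependent K ![e₀, e₁])
    (hw : LinearIndependent K ![w₂, w₃])
    (hdis : Disjoint (Submodule.span K {w₂, w₃}) (Submodule.span K {e₀, e₁}))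
    (hL : IsLineInSurface f (Submodule.span K {e₀, e₁})) : IsLineFrame f d e₀ e₁ w₂ w₃ where
  three_le := hd
  natCast_ne_zero := hc
  smooth := hf
  indep := linearIndependent_of_disjoint he hw hdis
  vanish := fun x y => hL.2 _ (Submodule.mem_span_pair.2 ⟨x, y, rfl⟩)

lemma exists_disjoint_span [Infinite K] {L : Submodule K (Fin 4 → K)}
    (hL : Module.finrank K L = 2) :
    ∃ w₂ w₃ : Fin 4 → K, LinearIndependent K ![w₂, w₃] ∧
      Disjoint (Submodule.span K {w₂, w₃}) L := by
  obtain ⟨C, hC⟩ := L.exists_isCompl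
  have h2 : Module.finrank K C = 2 := by
    have := Submodule.finrank_add_eq_of_isCompl hC
    simp at this
    omega
  obtain ⟨p, hp, hp0⟩ := exists_mem_ne_zero h2
  obtain ⟨q, hpq, hspan⟩ := exists_span_pair h2 hp hp0
  exact ⟨p, q, hpq, hspan ▸ hC.disjoint.symm⟩

lemma eq_of_le_of_finrank_two {M L : Submodule K (Fin 4 → K)} (hM : Module.finrank K M = 2)
    (hL : Module.finrank K L = 2) (h : M ≤ L) : M = L :=
  Submodule.eq_of_le_of_finrank_eq h (hM.trans hL.symm)

/-- A basis of a line whose second vector avoids finitely many other lines. -/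
lemma exists_span_pair_notMem [Infinite K] {L : Submodule K (Fin 4 → K)}
    (hL : Module.finrank K L = 2) (N : Finset (Submodule K (Fin 4 → K)))
    (hN : ∀ M ∈ N, Module.finrank K M = 2 ∧ M ≠ L) :
    ∃ e₀ e₁ : Fin 4 → K, LinearIndependent K ![e₀, e₁] ∧ Submodule.span K {e₀, e₁} = L ∧
      ∀ M ∈ N, e₁ ∉ M := by
  classical
  let s : Finset (Submodule K L) := insert ⊥ (N.image fun M => M.comap L.subtype)
  have hs : ⊤ ∉ s := by
    rw [Finset.mem_insert, Finset.mem_image, not_or]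
    constructor
    · intro h
      have := finrank_top K L
      rw [h, finrank_bot, hL] at this
      omega
    · rintro ⟨M, hM, h⟩
      rw [Submodule.comap_subtype_eq_top] at h
      exact (hN M hM).2 (eq_of_le_of_finrank_two hL (hN M hM).1 h).symm
  obtain ⟨x, hx⟩ := (Set.ne_univ_iff_exists_notMem _).1 (Subspace.biUnion_ne_univ_of_top_notMem hs)
  simp only [Set.mem_iUnion, not_exists, SetLike.mem_coe] at hx
  have hx0 : (x : Fin 4 → K) ≠ 0 := by
    intro h
    exact hx ⊥ (Finset.mem_insert_self _ _) (by simpa using h)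
  obtain ⟨q, hq, hspan⟩ := exists_span_pair hL x.2 hx0
  refine ⟨q, x, ?_, by rw [Set.pair_comm, hspan], fun M hM h => ?_⟩
  · exact LinearIndependent.pair_symm_iff.1 hq
  · exact hx (M.comap L.subtype)
      (Finset.mem_insert_of_mem (Finset.mem_image_of_mem _ hM)) h

end Neighbours

section Neighbours

variable {K : Type*} [Field K] {f : MvPolynomial (Fin 4) K} {d : ℕ} {e₀ e₁ w₂ w₃ : Fin 4 → K}
  {M : Submodule K (Fin 4 → K)}

lemma IsLineInSurface.aeval_linePoint [Infinite K] (hM : IsLineInSurface f M) {p q : Fin 4 → K}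
    (hp : p ∈ M) (hq : q ∈ M) : aeval (linePoint p q) f = 0 := by
  refine Polynomial.funext fun s => ?_
  rw [← Polynomial.coe_aeval_eq_eval, map_aeval_point, _root_.aeval_linePoint]
  simpa using hM.2 _ (M.add_mem hp (M.smul_mem s hq))

namespace IsLineFrame

variable [IsAlgClosed K]

lemma exists_tangent_coords (h : IsLineFrame f d e₀ e₁ w₂ w₃) {q : Fin 4 → K}
    (hq : dir1 f e₀ q = 0) :
    ∃ x y z : K, q = x • e₀ + y • e₁ + z • tangentVec f e₀ w₂ w₃ := by
  obtain ⟨a, b, c, e, rfl⟩ := exists_coords_of_indep h.indep q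
  have z0 : dir1 f e₀ e₀ = 0 := by
    rw [dir1_self e₀ h.smooth.1]
    have := h.vanish 1 0
    rw [one_smul, zero_smul, add_zero] at this
    rw [this, mul_zero]
  have z1 := congrArg (Polynomial.aeval (0 : K)) h.dir1_e₁
  rw [map_dir1, aeval_linePoint, aeval_constVec, zero_smul, add_zero, map_zero] at z1
  simp only [dir1_add, dir1_smul, z0, z1, mul_zero, zero_add] at hq
  have hne := h.dir1_ne_zero_or 0
  rw [zero_smul, add_zero] at hne
  obtain ⟨z, hz1, hz2⟩ : ∃ z, c = z * dir1 f e₀ w₃ ∧ e = -(z * dir1 f e₀ w₂) := by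
    rcases hne with h0 | h0
    · refine ⟨-e / dir1 f e₀ w₂, ?_, by field_simp⟩
      field_simp
      linear_combination hq
    · refine ⟨c / dir1 f e₀ w₃, by field_simp, ?_⟩
      field_simp
      linear_combination hq
  refine ⟨a, b, z, ?_⟩
  rw [hz1, hz2, tangentVec]
  module

lemma exists_eq_span_of_mem (h : IsLineFrame f d e₀ e₁ w₂ w₃) (hM : IsLineInSurface f M)
    (h0 : e₀ ∈ M) (h1 : e₁ ∉ M) :
    ∃ m : K, M = Submodule.span K {e₀, tangentVec f e₀ w₂ w₃ + m • e₁} := by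
  have he0 : e₀ ≠ 0 := by simpa using h.point_ne_zero 0
  obtain ⟨q, hq, hspan⟩ := exists_span_pair hM.1 h0 he0
  have hqM : q ∈ M := hspan ▸ Submodule.subset_span (by simp)
  have hd1 : dir1 f e₀ q = 0 := by
    rw [← (expansion_derivatives f e₀ q).1, expansion_eq_aeval_linePoint,
      hM.aeval_linePoint h0 hqM, Polynomial.coeff_zero]
  obtain ⟨x, y, z, hxyz⟩ := h.exists_tangent_coords hd1
  have hz : z ≠ 0 := by
    rintro rfl
    rw [zero_smul, add_zero] at hxyz
    have hy : y = 0 := by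
      by_contra hy
      refine h1 ?_
      have : e₁ = y⁻¹ • (q - x • e₀) := by
        rw [hxyz, add_sub_cancel_left, smul_smul, inv_mul_cancel₀ hy, one_smul]
      rw [this]
      exact M.smul_mem _ (M.sub_mem hqM (M.smul_mem _ h0))
    rw [hy, zero_smul, add_zero] at hxyz
    have := (LinearIndependent.pair_iff.1 hq) x (-1) (by rw [hxyz]; module)
    simp at this
  refine ⟨y / z, le_antisymm ?_ (Submodule.span_le.2 ?_)⟩
  · rw [← hspan, Submodule.span_le]
    rintro _ (rfl | rfl)
    · exact Submodule.subset_span (by simp)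
    · refine Submodule.mem_span_pair.2 ⟨x, z, ?_⟩
      rw [hxyz, smul_add, smul_smul, mul_div_cancel₀ _ hz]
      abel
  · rintro _ (rfl | rfl)
    · exact h0
    · have : tangentVec f e₀ w₂ w₃ + (y / z) • e₁ = z⁻¹ • (q - x • e₀) := by
        rw [hxyz, add_assoc, add_sub_cancel_left, smul_add, smul_smul, smul_smul,
          inv_mul_cancel₀ hz, one_smul, add_comm, div_eq_inv_mul]
      rw [this]
      exact M.smul_mem _ (M.sub_mem hqM (M.smul_mem _ h0))

lemma exists_eq_span (h : IsLineFrame f d e₀ e₁ w₂ w₃) (hM : IsLineInSurface f M)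
    (h1 : e₁ ∉ M) (hdis : ¬ Disjoint M (Submodule.span K {e₀, e₁})) :
    ∃ s m : K, M = Submodule.span K {e₀ + s • e₁, tangentVec f (e₀ + s • e₁) w₂ w₃ + m • e₁} := by
  obtain ⟨q, hq1, hq2, hq0⟩ : ∃ q, q ∈ M ∧ q ∈ Submodule.span K {e₀, e₁} ∧ q ≠ 0 := by
    simpa [Submodule.disjoint_def] using hdis
  obtain ⟨a, b, rfl⟩ := Submodule.mem_span_pair.1 hq2
  have ha : a ≠ 0 := by
    rintro rfl
    rw [zero_smul, zero_add] at hq1 hq0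
    have hb : b ≠ 0 := by rintro rfl; simp at hq0
    exact h1 ((M.smul_mem_iff hb).1 hq1)
  have hs : e₀ + (b / a) • e₁ ∈ M := by
    have : e₀ + (b / a) • e₁ = a⁻¹ • (a • e₀ + b • e₁) := by
      rw [smul_add, smul_smul, smul_smul, inv_mul_cancel₀ ha, one_smul, div_eq_inv_mul]
    rw [this]
    exact M.smul_mem _ hq1
  obtain ⟨m, hm⟩ := (h.shift (b / a)).exists_eq_span_of_mem hM hs h1
  exact ⟨b / a, m, hm⟩

open Classical in
/-- The lines meeting a given line are counted by the zeros of the inflection polynomial. -/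
lemma card_le_natDegree_inflection (h : IsLineFrame f d e₀ e₁ w₂ w₃)
    (hV : inflection f (linePoint e₀ e₁) (constVec e₁)
      (tangentVec f (linePoint e₀ e₁) (constVec w₂) (constVec w₃)) ≠ 0)
    (N : Finset (Submodule K (Fin 4 → K)))
    (hN : ∀ M ∈ N, IsLineInSurface f M ∧ e₁ ∉ M ∧ ¬ Disjoint M (Submodule.span K {e₀, e₁})) :
    N.card ≤ 8 * d - 14 := by
  refine le_trans ?_ h.natDegree_inflection_le
  set V := inflection f (linePoint e₀ e₁) (constVec e₁)
      (tangentVec f (linePoint e₀ e₁) (constVec w₂) (constVec w₃)) with hVdef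
  have hex : ∀ M, ∃ s m : K, M ∈ N →
      M = Submodule.span K {e₀ + s • e₁, tangentVec f (e₀ + s • e₁) w₂ w₃ + m • e₁} := by
    intro M
    by_cases hM : M ∈ N
    · obtain ⟨s, m, hsm⟩ := h.exists_eq_span (hN M hM).1 (hN M hM).2.1 (hN M hM).2.2
      exact ⟨s, m, fun _ => hsm⟩
    · exact ⟨0, 0, fun h => absurd h hM⟩
  choose s m hsm using hex
  have hfib : ∀ t : K, (N.filter fun M => s M = t).card ≤ V.rootMultiplicity t := by
    intro t
    set F := N.filter fun M => s M = t
    have hF : ∀ M ∈ F, M ∈ N ∧ s M = t := fun M hM => Finset.mem_filter.1 hM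
    have hinj : (F.image m).card = F.card := by
      refine Finset.card_image_of_injOn fun M hM M' hM' hmm => ?_
      obtain ⟨h1, h2⟩ := hF M hM
      obtain ⟨h1', h2'⟩ := hF M' hM'
      rw [hsm M h1, hsm M' h1', h2, h2', hmm]
    rw [← hinj, Polynomial.rootMultiplicity_eq_rootMultiplicity]
    have hcomp := inflection_shift f e₀ e₁ w₂ w₃ t
    rw [← hVdef] at hcomp
    have hne : V.comp (Polynomial.X + Polynomial.C t) ≠ 0 := by
      rw [Ne, Polynomial.comp_X_add_C_eq_zero_iff]
      exact hV
    rw [Polynomial.le_rootMultiplicity_iff hne, hcomp, Polynomial.C_0, sub_zero]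
    refine (h.shift t).X_pow_dvd_inflection _ fun x hx => ?_
    obtain ⟨M, hM, rfl⟩ := Finset.mem_image.1 hx
    obtain ⟨h1, h2⟩ := hF M hM
    have h3 := hsm M h1
    rw [h2] at h3
    refine (hN M h1).1.aeval_linePoint ?_ ?_
    · exact h3.ge (Submodule.subset_span (by simp))
    · exact h3.ge (Submodule.subset_span (by simp))
  rw [Finset.card_eq_sum_card_image s N]
  calc ∑ t ∈ N.image s, (N.filter fun M => s M = t).card
      ≤ ∑ t ∈ N.image s, V.roots.count t := Finset.sum_le_sum fun t _ => by
        rw [Polynomial.count_roots]; exact hfib t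
    _ ≤ ∑ t ∈ N.image s ∪ V.roots.toFinset, V.roots.count t :=
        Finset.sum_le_sum_of_subset Finset.subset_union_left
    _ = V.roots.card := by
        rw [Multiset.sum_count_eq_card]
        intro t ht
        exact Finset.mem_union_right _ (Multiset.mem_toFinset.2 ht)
    _ ≤ V.natDegree := Polynomial.card_roots' V

end IsLineFrame

lemma IsLineFrame.inflection_ne_zero [IsAlgClosed K] (h : IsLineFrame f d e₀ e₁ w₂ w₃)
    (hg : ¬ GradientsProportional f (flecnodal f) (Submodule.span K {e₀, e₁})) :
    inflection f (linePoint e₀ e₁) (constVec e₁)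
      (tangentVec f (linePoint e₀ e₁) (constVec w₂) (constVec w₃)) ≠ 0 := by
  intro hV
  refine hg fun v hv a b => ?_
  obtain ⟨x, y, rfl⟩ := Submodule.mem_span_pair.1 hv
  have key := fun i j => h.aeval_minor_eq_zero hV i j x y
  simp only [map_sub, map_mul] at key
  simp only [dir1]
  rw [Finset.sum_mul_sum, Finset.sum_mul_sum, Finset.sum_comm, ← Finset.sum_sub_distrib]
  refine Finset.sum_eq_zero fun i _ => ?_
  rw [← Finset.sum_sub_distrib]
  refine Finset.sum_eq_zero fun j _ => ?_
  linear_combination a i * b j * key i j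

/-- A line meets at most `8 d - 14` others, unless the gradients of the surface and of its flecnodal
covariant are proportional along it. -/
theorem card_neighbours_le [IsAlgClosed K] (hd : 3 ≤ d)
    (hc : ∀ k : ℕ, 0 < k → k ≤ d → (k : K) ≠ 0) (hf : IsSmoothSurfaceOfDegree f d)
    {L : Submodule K (Fin 4 → K)} (hL : IsLineInSurface f L)
    (hg : ¬ GradientsProportional f (flecnodal f) L)
    (N : Finset (Submodule K (Fin 4 → K)))
    (hN : ∀ M ∈ N, IsLineInSurface f M ∧ M ≠ L ∧ ¬ Disjoint M L) : N.card ≤ 8 * d - 14 := by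
  obtain ⟨e₀, e₁, he, rfl, hav⟩ := exists_span_pair_notMem hL.1 N
    fun M hM => ⟨(hN M hM).1.1, (hN M hM).2.1⟩
  obtain ⟨w₂, w₃, hw, hdis⟩ := exists_disjoint_span hL.1
  have h := isLineFrame_of_disjoint hd hc hf he hw hdis hL
  exact h.card_le_natDegree_inflection (h.inflection_ne_zero hg) N
    fun M hM => ⟨(hN M hM).1, hav M hM, (hN M hM).2.2⟩

end Neighbours

section Transversals

variable {K : Type*} [Field K] {f : MvPolynomial (Fin 4) K} {d : ℕ} {e₀ e₁ w₂ w₃ : Fin 4 → K}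
  {M : Submodule K (Fin 4 → K)}

lemma card_le_of_roots {R α : Type*} [CommRing R] [IsDomain R] {p : Polynomial R}
    (hp : p ≠ 0) {n : ℕ} (hn : p.natDegree ≤ n)
    (N : Finset α) (s : α → R) (hs : Set.InjOn s N) (hr : ∀ a ∈ N, p.IsRoot (s a)) :
    N.card ≤ n := by
  classical
  refine (Finset.card_le_card_of_injOn (t := p.roots.toFinset) s (fun a ha => ?_) hs).trans
    ((Multiset.toFinset_card_le _).trans ((Polynomial.card_roots' p).trans hn))
  simpa [hp] using hr a ha

namespace IsLineFrame

variable [IsAlgClosed K]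

lemma exists_eq_span_tangentVec (h : IsLineFrame f d e₀ e₁ w₂ w₃) (hM : IsLineInSurface f M)
    (h1 : e₁ ∉ M) (hdis : ¬ Disjoint M (Submodule.span K {e₀, e₁}))
    (hdis' : ¬ Disjoint M (Submodule.span K {w₂, w₃})) :
    ∃ s : K, M = Submodule.span K {e₀ + s • e₁, tangentVec f (e₀ + s • e₁) w₂ w₃} := by
  obtain ⟨s, m, hsm⟩ := h.exists_eq_span hM h1 hdis
  obtain ⟨q, hq1, hq2, hq0⟩ : ∃ q, q ∈ M ∧ q ∈ Submodule.span K {w₂, w₃} ∧ q ≠ 0 := by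
    simpa [Submodule.disjoint_def] using hdis'
  rw [hsm] at hq1
  obtain ⟨x, y, rfl⟩ := Submodule.mem_span_pair.1 hq1
  obtain ⟨a, b, hab⟩ := Submodule.mem_span_pair.1 hq2
  have hi := (Fintype.linearIndependent_iff.1 h.indep)
    ![x, x * s + y * m, y * dir1 f (e₀ + s • e₁) w₃ - a, -y * dir1 f (e₀ + s • e₁) w₂ - b] (by
      rw [← sub_eq_zero, ← neg_eq_zero] at hab
      rw [← hab, Fin.sum_univ_four]
      simp only [Matrix.cons_val, tangentVec]
      module)
  have hx : x = 0 := by simpa using hi 0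
  have hy : x * s + y * m = 0 := by simpa using hi 1
  subst hx
  have hy0 : y ≠ 0 := by rintro rfl; simp at hq0
  have hm : m = 0 := by simpa [hy0] using hy
  refine ⟨s, ?_⟩
  rw [hsm, hm, zero_smul, add_zero]

lemma exists_root_polynomial (h : IsLineFrame f d e₀ e₁ w₂ w₃)
    (hV : inflection f (linePoint e₀ e₁) (constVec e₁)
      (tangentVec f (linePoint e₀ e₁) (constVec w₂) (constVec w₃)) ≠ 0) :
    ∃ p : Polynomial K, p ≠ 0 ∧ p.natDegree ≤ 4 * d - 6 ∧ ∀ s : K,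
      aeval (linePoint (e₀ + s • e₁) (tangentVec f (e₀ + s • e₁) w₂ w₃)) f = 0 → p.IsRoot s := by
  have hd := h.three_le
  have hl := natDegree_tangentVec_le h.smooth.1 (natDegree_linePoint_le e₀ e₁)
    (natDegree_constVec_le w₂) (natDegree_constVec_le w₃)
  have hmap : ∀ s : K, (fun i => Polynomial.aeval s
      (tangentVec f (linePoint e₀ e₁) (constVec w₂) (constVec w₃) i)) =
      tangentVec f (e₀ + s • e₁) w₂ w₃ := fun s => by
    rw [tangentVec_map]
  set l := tangentVec f (linePoint e₀ e₁) (constVec w₂) (constVec w₃)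
  by_cases h2 : dir2 f (linePoint e₀ e₁) l l = 0
  · refine ⟨dir3 f (linePoint e₀ e₁) l l l, fun h3 => hV ?_, ?_, fun s hs => ?_⟩
    · rw [inflection, h2, h3]; ring
    · have := natDegree_dir3_le h.smooth.1 (natDegree_linePoint_le e₀ e₁) hl hl hl
      omega
    · rw [Polynomial.IsRoot, ← Polynomial.coe_aeval_eq_eval, map_dir3, hmap, aeval_linePoint,
        ← (expansion_derivatives f _ _).2.2, expansion_eq_aeval_linePoint, hs]
      simp
  · refine ⟨dir2 f (linePoint e₀ e₁) l l, h2, ?_, fun s hs => ?_⟩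
    · have := natDegree_dir2_le h.smooth.1 (natDegree_linePoint_le e₀ e₁) hl hl
      omega
    · rw [Polynomial.IsRoot, ← Polynomial.coe_aeval_eq_eval, map_dir2, hmap, aeval_linePoint,
        ← (expansion_derivatives f _ _).2.1, expansion_eq_aeval_linePoint, hs]
      simp

end IsLineFrame

/-- Two skew lines have at most `4 d - 6` common transversals on the surface, unless the gradients
of the surface and of its flecnodal covariant are proportional along one of them. -/
theorem card_transversals_le [IsAlgClosed K] (hd : 3 ≤ d)
    (hc : ∀ k : ℕ, 0 < k → k ≤ d → (k : K) ≠ 0) (hf : IsSmoothSurfaceOfDegree f d)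
    {L₁ L₂ : Submodule K (Fin 4 → K)} (hL₁ : IsLineInSurface f L₁) (hL₂ : IsLineInSurface f L₂)
    (hdis : Disjoint L₁ L₂) (hg : ¬ GradientsProportional f (flecnodal f) L₁)
    (N : Finset (Submodule K (Fin 4 → K)))
    (hN : ∀ M ∈ N, IsLineInSurface f M ∧ ¬ Disjoint M L₁ ∧ ¬ Disjoint M L₂) :
    N.card ≤ 4 * d - 6 := by
  obtain ⟨e₀, e₁, he, rfl, hav⟩ := exists_span_pair_notMem hL₁.1 N
    fun M hM => ⟨(hN M hM).1.1, fun hM' => (hN M hM).2.2 (hM' ▸ hdis)⟩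
  obtain ⟨w₂, hw₂, hw0⟩ := exists_mem_ne_zero hL₂.1
  obtain ⟨w₃, hw, rfl⟩ := exists_span_pair hL₂.1 hw₂ hw0
  have h := isLineFrame_of_disjoint hd hc hf he hw hdis.symm hL₁
  obtain ⟨p, hp, hpd, hroot⟩ := h.exists_root_polynomial (h.inflection_ne_zero hg)
  have hex : ∀ M, ∃ s : K, M ∈ N →
      M = Submodule.span K {e₀ + s • e₁, tangentVec f (e₀ + s • e₁) w₂ w₃} := by
    intro M
    by_cases hM : M ∈ N
    · obtain ⟨s, hs⟩ := h.exists_eq_span_tangentVec (hN M hM).1 (hav M hM) (hN M hM).2.1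
        (hN M hM).2.2
      exact ⟨s, fun _ => hs⟩
    · exact ⟨0, fun h => absurd h hM⟩
  choose s hs using hex
  refine card_le_of_roots hp hpd N s (fun M hM M' hM' hmm => ?_) fun M hM => hroot _ ?_
  · rw [hs M hM, hs M' hM', hmm]
  · exact (hN M hM).1.aeval_linePoint ((hs M hM).ge (Submodule.subset_span (by simp)))
      ((hs M hM).ge (Submodule.subset_span (by simp)))

end Transversals

section PlaneSections

variable {K : Type*} [Field K] {f : MvPolynomial (Fin 4) K} {d : ℕ} {e₀ e₁ w₂ w₃ : Fin 4 → K}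
  {L M M' : Submodule K (Fin 4 → K)}

lemma IsLineFrame.dir1_constVec_ne_zero [IsAlgClosed K] (h : IsLineFrame f d e₀ e₁ w₂ w₃)
    {w : Fin 4 → K} (hw : w ∉ Submodule.span K {e₀, e₁}) :
    dir1 f (linePoint e₀ e₁) (constVec w) ≠ 0 := by
  intro h0
  obtain ⟨a, b, c, e, rfl⟩ := exists_coords_of_indep h.indep w
  have hκ := h.dir2_e₁_tangentVec_ne_zero
  rw [IsLineFrame.dir2_e₁_tangentVec] at hκ
  have hd0 : dir1 f (linePoint e₀ e₁) (constVec e₀) = 0 := by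
    rw [constVec_left_eq e₀ e₁, dir1_add, dir1_smul, h.dir1_linePoint, h.dir1_e₁]; simp
  have hlin : constVec (a • e₀ + b • e₁ + c • w₂ + e • w₃) = Polynomial.C a • constVec e₀ +
      Polynomial.C b • constVec e₁ + Polynomial.C c • constVec w₂ +
      Polynomial.C e • constVec w₃ := by
    funext i; simp [constVec]
  rw [hlin, dir1_add, dir1_add, dir1_add, dir1_smul, dir1_smul, dir1_smul, dir1_smul, hd0,
    h.dir1_e₁, mul_zero, mul_zero, zero_add, zero_add] at h0
  have h0' := congrArg Polynomial.derivative h0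
  simp only [Polynomial.derivative_add, Polynomial.derivative_mul, Polynomial.derivative_C,
    zero_mul, zero_add, Polynomial.derivative_zero] at h0'
  have hc : Polynomial.C c = 0 := by
    refine (mul_eq_zero.1 ?_).resolve_right hκ
    linear_combination dir1 f (linePoint e₀ e₁) (constVec w₃) * h0' -
      Polynomial.derivative (dir1 f (linePoint e₀ e₁) (constVec w₃)) * h0
  have he : Polynomial.C e = 0 := by
    refine (mul_eq_zero.1 ?_).resolve_right hκ
    linear_combination -dir1 f (linePoint e₀ e₁) (constVec w₂) * h0' +
      Polynomial.derivative (dir1 f (linePoint e₀ e₁) (constVec w₂)) * h0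
  rw [Polynomial.C_eq_zero] at hc he
  rw [hc, he, zero_smul, zero_smul, add_zero, add_zero] at hw
  exact hw (Submodule.mem_span_pair.2 ⟨a, b, rfl⟩)

lemma exists_add_smul_mem {F : Submodule K (Fin 4 → K)} (hF : Module.finrank K F ≤ 3)
    (hM : Module.finrank K M = 2) (hMF : M ≤ F) {e : Fin 4 → K} (heF : e ∈ F) (he : e ∉ M)
    {v : Fin 4 → K} (hv : v ∈ F) : ∃ a : K, v + a • e ∈ M := by
  have hlt : M < M ⊔ Submodule.span K {e} := by
    refine lt_of_le_of_ne le_sup_left fun h => he ?_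
    rw [h]
    exact Submodule.mem_sup_right (Submodule.mem_span_singleton_self e)
  have hle : M ⊔ Submodule.span K {e} ≤ F :=
    sup_le hMF ((Submodule.span_singleton_le_iff_mem _ _).2 heF)
  have h1 := Submodule.finrank_lt_finrank_of_lt hlt
  have heq := Submodule.eq_of_le_of_finrank_le hle (by omega)
  rw [← heq, Submodule.mem_sup] at hv
  obtain ⟨m, hm, y, hy, rfl⟩ := hv
  obtain ⟨c, rfl⟩ := Submodule.mem_span_singleton.1 hy
  refine ⟨-c, ?_⟩
  rwa [neg_smul, add_neg_cancel_right]

lemma IsLineFrame.card_le_of_le_plane [IsAlgClosed K] (h : IsLineFrame f d e₀ e₁ w₂ w₃)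
    {w : Fin 4 → K} (hw : w ∉ Submodule.span K {e₀, e₁}) {F : Submodule K (Fin 4 → K)}
    (hF : Module.finrank K F = 3) (h0F : e₀ ∈ F) (h1F : e₁ ∈ F) (hwF : w ∈ F)
    (N : Finset (Submodule K (Fin 4 → K)))
    (hN : ∀ M ∈ N, IsLineInSurface f M ∧ e₁ ∉ M ∧ M ≤ F) : N.card ≤ d := by
  have hex : ∀ M, ∃ a b : K, M ∈ N → e₀ + a • e₁ ∈ M ∧ w + b • e₁ ∈ M := by
    intro M
    by_cases hM : M ∈ N
    · obtain ⟨h1, h2, h3⟩ := hN M hM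
      obtain ⟨a, ha⟩ := exists_add_smul_mem hF.le h1.1 h3 h1F h2 h0F
      obtain ⟨b, hb⟩ := exists_add_smul_mem hF.le h1.1 h3 h1F h2 hwF
      exact ⟨a, b, fun _ => ⟨ha, hb⟩⟩
    · exact ⟨0, 0, fun h => absurd h hM⟩
  choose a b hab using hex
  have hspan : ∀ M ∈ N, Submodule.span K {e₀ + a M • e₁, w + b M • e₁} = M := by
    intro M hM
    refine eq_of_le_of_finrank_two ?_ (hN M hM).1.1 (Submodule.span_le.2 ?_)
    · have hli : LinearIndependent K ![e₀ + a M • e₁, w + b M • e₁] := by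
        rw [LinearIndependent.pair_iff]
        intro s t hst
        have ht : t = 0 := by
          by_contra ht
          refine hw (Submodule.mem_span_pair.2 ⟨-(t⁻¹ * s), -(t⁻¹ * (s * a M) + b M), ?_⟩)
          have : w = t⁻¹ • (t • w) := by rw [smul_smul, inv_mul_cancel₀ ht, one_smul]
          rw [this, show t • w = (s • (e₀ + a M • e₁) + t • (w + b M • e₁)) - s • e₀ -
            (s * a M) • e₁ - (t * b M) • e₁ by module, hst, smul_sub, smul_sub, smul_sub,
            smul_smul, smul_smul, smul_smul, ← mul_assoc t⁻¹ t, inv_mul_cancel₀ ht]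
          module
        subst ht
        rw [zero_smul, add_zero] at hst
        exact ⟨(smul_eq_zero.1 hst).resolve_right (h.point_ne_zero _), rfl⟩
      have := finrank_span_eq_card hli
      rwa [Matrix.range_cons, Matrix.range_cons, Matrix.range_empty, Set.union_empty,
        Fintype.card_fin] at this
    · rintro _ (rfl | rfl)
      exacts [(hab M hM).1, (hab M hM).2]
  refine card_le_of_roots (p := expansion f (linePoint e₀ w) (constVec e₁)) ?_ ?_ N
    (fun M => Polynomial.C (a M) + Polynomial.X * Polynomial.C (b M)) ?_ ?_
  · intro h0
    refine h.dir1_constVec_ne_zero hw (Polynomial.funext fun x => ?_)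
    rw [← Polynomial.coe_aeval_eq_eval, map_dir1, aeval_linePoint, aeval_constVec,
      ← (expansion_derivatives f _ _).1, expansion_eq_aeval_linePoint]
    have hz : aeval (linePoint (e₀ + x • e₁) w) f = 0 := by
      let ψ : Polynomial (Polynomial K) →ₐ[K] Polynomial K :=
        Polynomial.eval₂AlgHom (AlgHom.id K _) (Polynomial.C x) fun _ => Commute.all _ _
      have h1 := map_aeval_point
        (fun i => Polynomial.C (linePoint e₀ w i) + Polynomial.X * Polynomial.C (constVec e₁ i)) ψ f
      have h2 : (fun i => ψ (Polynomial.C (linePoint e₀ w i) +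
          Polynomial.X * Polynomial.C (constVec e₁ i))) = linePoint (e₀ + x • e₁) w := by
        funext i
        change Polynomial.eval₂ _ _ _ = _
        simp [linePoint, constVec]
        ring
      rw [h2] at h1
      rw [← h1]
      change ψ (expansion f (linePoint e₀ w) (constVec e₁)) = 0
      rw [h0, map_zero]
    rw [hz]
    simp
  · have := MvPolynomial.aeval_natDegree_le (map (algebraMap K (Polynomial K)) f)
      (h.smooth.1.map _).totalDegree_le
      (fun i => Polynomial.C (linePoint e₀ w i) + Polynomial.X * Polynomial.C (constVec e₁ i))
      (n := 1) (fun i => by compute_degree)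
    rw [aeval_map_algebraMap, mul_one] at this
    exact this
  · intro M hM M' hM' hmm
    have c0 := congrArg (fun p => p.coeff 0) hmm
    have c1 := congrArg (fun p => p.coeff 1) hmm
    simp at c0 c1
    rw [← hspan M hM, ← hspan M' hM', c0, c1]
  · intro M hM
    let ψ : Polynomial (Polynomial K) →ₐ[K] Polynomial K :=
      Polynomial.eval₂AlgHom (AlgHom.id K _)
        (Polynomial.C (a M) + Polynomial.X * Polynomial.C (b M)) fun _ => Commute.all _ _
    have h1 := map_aeval_point
      (fun i => Polynomial.C (linePoint e₀ w i) + Polynomial.X * Polynomial.C (constVec e₁ i)) ψ f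
    have h2 : (fun i => ψ (Polynomial.C (linePoint e₀ w i) +
        Polynomial.X * Polynomial.C (constVec e₁ i))) =
          linePoint (e₀ + a M • e₁) (w + b M • e₁) := by
      funext i
      change Polynomial.eval₂ _ _ _ = _
      simp [linePoint, constVec]
      ring
    rw [h2, (hN M hM).1.aeval_linePoint (hab M hM).1 (hab M hM).2] at h1
    exact h1

lemma finrank_sup_eq_three (hL : Module.finrank K L = 2) (hM : Module.finrank K M = 2)
    (hne : M ≠ L) (hdis : ¬ Disjoint M L) : Module.finrank K ↥(L ⊔ M) = 3 := by
  have h1 := Submodule.finrank_sup_add_finrank_inf_eq L M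
  have h2 : 0 < Module.finrank K ↥(L ⊓ M) := by
    rw [Module.finrank_pos_iff_exists_ne_zero]
    obtain ⟨q, hq1, hq2, hq0⟩ : ∃ q, q ∈ M ∧ q ∈ L ∧ q ≠ 0 := by
      simpa [Submodule.disjoint_def] using hdis
    exact ⟨⟨q, hq2, hq1⟩, fun h => hq0 (congrArg Subtype.val h)⟩
  have h3 : Module.finrank K ↥(L ⊓ M) < 2 := by
    rw [← hL]
    refine Submodule.finrank_lt_finrank_of_lt (lt_of_le_of_ne inf_le_left fun h => hne ?_)
    exact (eq_of_le_of_finrank_two hL hM (inf_eq_left.1 h)).symm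
  omega

lemma IsLineInSurface.dir1_eq_zero [Infinite K] (hM : IsLineInSurface f M) {p q : Fin 4 → K}
    (hp : p ∈ M) (hq : q ∈ M) : dir1 f p q = 0 := by
  rw [← (expansion_derivatives f p q).1, expansion_eq_aeval_linePoint, hM.aeval_linePoint hp hq,
    Polynomial.coeff_zero]

/-- Two lines that meet, and that both meet `L`, span the same plane together with `L`: otherwise
the three lines are concurrent and they lie in the tangent plane. -/
lemma sup_eq_sup_of_meet [Infinite K]
    (hd : ∀ v : Fin 4 → K, v ≠ 0 → ∃ u, dir1 f v u ≠ 0) (hL : IsLineInSurface f L)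
    (hM : IsLineInSurface f M) (hM' : IsLineInSurface f M') (hne : M ≠ L) (hne' : M' ≠ L)
    (hdis : ¬ Disjoint M L) (hdis' : ¬ Disjoint M' L) (hMM' : ¬ Disjoint M M') :
    L ⊔ M = L ⊔ M' := by
  have h3 := finrank_sup_eq_three hL.1 hM.1 hne hdis
  have hsup' := finrank_sup_eq_three hL.1 hM'.1 hne' hdis'
  obtain ⟨q, hq, hq', hq0⟩ : ∃ q, q ∈ M ∧ q ∈ M' ∧ q ≠ 0 := by
    simpa [Submodule.disjoint_def] using hMM'
  by_cases hqL : q ∈ L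
  · let T : Submodule K (Fin 4 → K) :=
      { carrier := {v | dir1 f q v = 0}
        add_mem' := fun {a b} ha hb => by
          change dir1 f q (a + b) = 0
          rw [dir1_add, show dir1 f q a = 0 from ha, show dir1 f q b = 0 from hb, add_zero]
        zero_mem' := dir1_zero f q
        smul_mem' := fun c a ha => by
          change dir1 f q (c • a) = 0
          rw [dir1_smul, show dir1 f q a = 0 from ha, mul_zero] }
    have hT : T < ⊤ := by
      obtain ⟨u, hu⟩ := hd q hq0
      exact lt_top_iff_ne_top.2 fun h => hu (h.ge (Submodule.mem_top : u ∈ ⊤))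
    have h4 := Submodule.finrank_lt hT.ne
    simp only [Module.finrank_fintype_fun_eq_card, Fintype.card_fin] at h4
    have key : ∀ M, IsLineInSurface f M → q ∈ M → Module.finrank K ↥(L ⊔ M) = 3 → L ⊔ M = T :=
      fun M hM hq h3 => Submodule.eq_of_le_of_finrank_le
        (sup_le (fun v hv => hL.dir1_eq_zero hqL hv) fun v hv => hM.dir1_eq_zero hq hv) (by omega)
    rw [key M hM hq h3, key M' hM' hq' hsup']
  · have hlt : L < L ⊔ Submodule.span K {q} := by
      refine lt_of_le_of_ne le_sup_left fun h => hqL ?_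
      rw [h]
      exact Submodule.mem_sup_right (Submodule.mem_span_singleton_self q)
    have h4 := Submodule.finrank_lt_finrank_of_lt hlt
    rw [hL.1] at h4
    have key : ∀ M : Submodule K (Fin 4 → K), q ∈ M → Module.finrank K ↥(L ⊔ M) = 3 →
        L ⊔ Submodule.span K {q} = L ⊔ M := fun M hq h3 => Submodule.eq_of_le_of_finrank_le
      (sup_le_sup_left ((Submodule.span_singleton_le_iff_mem _ _).2 hq) L) (by omega)
    rw [← key M hq h3, ← key M' hq' hsup']

/-- Pairwise intersecting lines that all meet a given line are coplanar with it, so that there are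
at most `d` of them. -/
theorem card_le_of_pairwise_meet [IsAlgClosed K] (hd : 3 ≤ d)
    (hc : ∀ k : ℕ, 0 < k → k ≤ d → (k : K) ≠ 0) (hf : IsSmoothSurfaceOfDegree f d)
    (hL : IsLineInSurface f L) (N : Finset (Submodule K (Fin 4 → K)))
    (hN : ∀ M ∈ N, IsLineInSurface f M ∧ M ≠ L ∧ ¬ Disjoint M L)
    (hpair : ∀ M ∈ N, ∀ M' ∈ N, ¬ Disjoint M M') : N.card ≤ d := by
  rcases N.eq_empty_or_nonempty with rfl | ⟨M₀, hM₀⟩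
  · simp
  obtain ⟨e₀, e₁, he, rfl, hav⟩ := exists_span_pair_notMem hL.1 N
    fun M hM => ⟨(hN M hM).1.1, (hN M hM).2.1⟩
  obtain ⟨w₂, w₃, hw, hdis⟩ := exists_disjoint_span hL.1
  have h := isLineFrame_of_disjoint hd hc hf he hw hdis hL
  obtain ⟨h1, h2, h3⟩ := hN M₀ hM₀
  obtain ⟨w, hwM, hwL⟩ : ∃ w ∈ M₀, w ∉ Submodule.span K {e₀, e₁} :=
    SetLike.not_le_iff_exists.1 fun hle => h2 (eq_of_le_of_finrank_two h1.1 hL.1 hle)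
  refine h.card_le_of_le_plane hwL (finrank_sup_eq_three hL.1 h1.1 h2 h3)
    (Submodule.mem_sup_left (Submodule.subset_span (by simp)))
    (Submodule.mem_sup_left (Submodule.subset_span (by simp))) (Submodule.mem_sup_right hwM) N
    fun M hM => ⟨(hN M hM).1, hav M hM, ?_⟩
  rw [← sup_eq_sup_of_meet (fun v hv => exists_dir1_ne_zero hf hv) hL (hN M hM).1 h1
    (hN M hM).2.1 h2 (hN M hM).2.2 h3 (hpair M hM M₀ hM₀)]
  exact le_sup_right

end PlaneSections

section Count

variable {K : Type*} [Field K] {f : MvPolynomial (Fin 4) K} {d : ℕ}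
  {L M W : Submodule K (Fin 4 → K)}

lemma IsLineInSurface.exists_isLineFrame [Infinite K] (hd : 3 ≤ d)
    (hc : ∀ k : ℕ, 0 < k → k ≤ d → (k : K) ≠ 0) (hf : IsSmoothSurfaceOfDegree f d)
    (hL : IsLineInSurface f L) :
    ∃ e₀ e₁ w₂ w₃ : Fin 4 → K, IsLineFrame f d e₀ e₁ w₂ w₃ ∧ Submodule.span K {e₀, e₁} = L := by
  obtain ⟨p, hp, hp0⟩ := exists_mem_ne_zero hL.1
  obtain ⟨q, hpq, rfl⟩ := exists_span_pair hL.1 hp hp0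
  obtain ⟨w₂, w₃, hw, hdis⟩ := exists_disjoint_span hL.1
  exact ⟨p, q, w₂, w₃, isLineFrame_of_disjoint hd hc hf hpq hw hdis hL, rfl⟩

lemma IsLineInSurface.aeval_flecnodal_eq_zero [IsAlgClosed K] (hd : 3 ≤ d)
    (hc : ∀ k : ℕ, 0 < k → k ≤ d → (k : K) ≠ 0) (hf : IsSmoothSurfaceOfDegree f d)
    (hL : IsLineInSurface f L) {v : Fin 4 → K} (hv : v ∈ L) : aeval v (flecnodal f) = 0 := by
  have : Infinite K := IsAlgClosed.instInfinite
  obtain ⟨e₀, e₁, w₂, w₃, h, rfl⟩ := hL.exists_isLineFrame hd hc hf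
  obtain ⟨x, y, rfl⟩ := Submodule.mem_span_pair.1 hv
  exact aeval_eq_zero_of_aeval_linePoint_eq_zero (flecnodal_isHomogeneous hd hf.1)
    h.frame_identities.1 x y

/-- A bound for the number of elements satisfying `p` plus the number of those satisfying `q`,
where the elements with and without the property `r` are counted separately. -/
lemma card_filter_add_card_filter_le {α : Type*} [DecidableEq α] (S : Finset α) (p q r : α → Prop)
    [DecidablePred p] [DecidablePred q] [DecidablePred r] {a b c n : ℕ}
    (hp : (S.filter fun x => ¬ r x ∧ p x).card ≤ a) (hq : (S.filter fun x => ¬ r x ∧ q x).card ≤ b)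
    (hpq : (S.filter fun x => p x ∧ q x).card ≤ c) (hr : (S.filter r).card ≤ n) :
    (S.filter p).card + (S.filter q).card ≤ a + b + c + n := by
  have h1 := Finset.card_union_add_card_inter ((S.filter r).filter p) ((S.filter r).filter q)
  have h2 : ((S.filter r).filter p ∪ (S.filter r).filter q).card ≤ n :=
    (Finset.card_le_card (Finset.union_subset (Finset.filter_subset _ _)
      (Finset.filter_subset _ _))).trans hr
  have h3 : ((S.filter r).filter p ∩ (S.filter r).filter q).card ≤ c := by
    refine (Finset.card_le_card fun x hx => ?_).trans hpq
    simp only [Finset.mem_inter, Finset.mem_filter] at hx ⊢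
    exact ⟨hx.1.1.1, hx.1.2, hx.2.2⟩
  have h4 : ∀ (s : α → Prop) [DecidablePred s], (S.filter s).card =
      (S.filter fun x => ¬ r x ∧ s x).card + ((S.filter r).filter s).card := fun s _ => by
    rw [← Finset.card_filter_add_card_filter_not (s := S.filter s) r, add_comm,
      Finset.filter_filter, Finset.filter_filter, Finset.filter_filter]
    simp only [and_comm]
  rw [h4 p, h4 q]
  omega

open Classical in
theorem card_isLineInSurface_le [IsAlgClosed K] (hd : 3 ≤ d)
    (hc : ∀ k : ℕ, 0 < k → k ≤ d → (k : K) ≠ 0) (hf : IsSmoothSurfaceOfDegree f d)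
    (S : Finset (Submodule K (Fin 4 → K))) (hS : ∀ W ∈ S, IsLineInSurface f W) :
    S.card ≤ 11 * d ^ 2 - 30 * d + 18 := by
  have : Infinite K := IsAlgClosed.instInfinite
  by_contra! hcard
  obtain ⟨W₀, hW₀⟩ : S.Nonempty := Finset.card_pos.1 (by omega)
  obtain ⟨_, _, _, _, h₀, -⟩ := (hS W₀ hW₀).exists_isLineFrame hd hc hf
  have hφ := flecnodal_isHomogeneous hd hf.1
  have hS' : ∀ W ∈ S, Module.finrank K W = 2 ∧ (∀ v ∈ W, aeval v f = 0) ∧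
      (∀ v ∈ W, aeval v (flecnodal f) = 0) := fun W hW =>
    ⟨(hS W hW).1, (hS W hW).2, fun v hv => (hS W hW).aeval_flecnodal_eq_zero hd hc hf hv⟩
  have hs : ∀ v : Fin 4 → K, v ≠ 0 → ∃ u, dir1 f v u ≠ 0 := fun v hv => exists_dir1_ne_zero hf hv
  set G := GradientsProportional f (flecnodal f) with hG
  have hA := card_add_card_gradientsProportional_le hf.1 hφ hd (by omega) h₀.irreducible
    h₀.not_dvd_flecnodal hs S hS'
  rw [← hG] at hA
  have hmeet : ∀ L M : Submodule K (Fin 4 → K), ¬ Disjoint L M → ¬ Disjoint M L :=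
    fun L M h h' => h h'.symm
  -- the numerical invariants, written without truncated subtraction
  obtain ⟨k, rfl⟩ : ∃ k, d = k + 3 := ⟨d - 3, by omega⟩
  have hB : 11 * (k + 3) ^ 2 - 30 * (k + 3) + 18 = 11 * k ^ 2 + 36 * k + 27 := by
    rw [show 11 * (k + 3) ^ 2 = 11 * k ^ 2 + 36 * k + 9 + 30 * (k + 3) by ring,
      Nat.add_sub_cancel]
  have he : 11 * (k + 3) - 24 = 11 * k + 9 := by omega
  have hde : (k + 3) * (11 * k + 9) = 11 * k ^ 2 + 42 * k + 27 := by ring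
  have hde' : (k + 3 - 2) * (11 * k + 9) + (11 * k + 9 - 2) * (k + 3) =
      22 * k ^ 2 + 60 * k + 30 := by
    rw [show k + 3 - 2 = k + 1 by omega, show 11 * k + 9 - 2 = 11 * k + 7 by omega]
    ring
  rw [he, hde] at hA
  rw [hB] at hcard
  -- a first kind line has few neighbours
  have hneigh : ∀ L ∈ S, ¬ G L → ((S.erase L).filter fun W => ¬ Disjoint W L).card ≤
      8 * (k + 3) - 14 := fun L hL hGL => by
    refine card_neighbours_le hd hc hf (hS L hL) hGL _ fun M hM => ?_
    rw [Finset.mem_filter, Finset.mem_erase] at hM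
    exact ⟨hS M hM.1.2, hM.1.1, hM.2⟩
  have hchain : ∀ M ∈ S, ∀ L₁ ∈ S, ∀ L₂ ∈ S, ¬ G M → ¬ G L₁ → ¬ G L₂ → L₁ ≠ M → L₂ ≠ M →
      ¬ Disjoint L₁ M → ¬ Disjoint L₂ M → ¬ Disjoint L₁ L₂ := by
    intro M hM L₁ hL₁ L₂ hL₂ gM g₁ g₂ hne₁ hne₂ hd₁ hd₂ hdis
    have hne : L₂ ≠ L₁ := by
      rintro rfl
      have h2 := (hS _ hL₂).1
      rw [disjoint_self.1 hdis] at h2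
      simp at h2
    have hT := two_mul_card_le_of_chain hf.1 hφ hd (by omega) h₀.irreducible
      h₀.not_dvd_flecnodal hs S hS' hL₁ hL₂ hM hdis (hmeet _ _ hd₁) (hmeet _ _ hd₂) hne₁.symm
      hne₂.symm
    rw [he, hde'] at hT
    have k₁ : ((((S.erase L₁).erase L₂).erase M).filter fun W => ¬ Disjoint W L₁).card + 1 ≤
        8 * (k + 3) - 14 := by
      rw [← Finset.card_insert_of_notMem (a := M) (by simp)]
      refine (Finset.card_le_card ?_).trans (hneigh L₁ hL₁ g₁)
      rw [Finset.insert_subset_iff]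
      exact ⟨by simp [hM, hne₁.symm, hmeet _ _ hd₁], Finset.filter_subset_filter _
        ((Finset.erase_subset _ _).trans (Finset.erase_subset _ _))⟩
    have k₂ : ((((S.erase L₁).erase L₂).erase M).filter fun W => ¬ Disjoint W L₂).card + 1 ≤
        8 * (k + 3) - 14 := by
      rw [← Finset.card_insert_of_notMem (a := M) (by simp)]
      refine (Finset.card_le_card ?_).trans (hneigh L₂ hL₂ g₂)
      rw [Finset.insert_subset_iff]
      exact ⟨by simp [hM, hne₂.symm, hmeet _ _ hd₂], Finset.filter_subset_filter _
        ((Finset.erase_subset _ _).trans (Finset.erase_subset_erase _ (Finset.erase_subset _ _)))⟩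
    have k₃ : ((((S.erase L₁).erase L₂).erase M).filter fun W => ¬ Disjoint W M).card + 1 + 1 ≤
        8 * (k + 3) - 14 := by
      rw [← Finset.card_insert_of_notMem (a := L₁) (by simp),
        ← Finset.card_insert_of_notMem (a := L₂) (by simp [hne])]
      refine (Finset.card_le_card ?_).trans (hneigh M hM gM)
      rw [Finset.insert_subset_iff, Finset.insert_subset_iff]
      exact ⟨by simp [hL₂, hne₂, hd₂], by simp [hL₁, hne₁, hd₁], Finset.filter_subset_filter _
        (Finset.erase_subset_erase _ ((Finset.erase_subset _ _).trans (Finset.erase_subset _ _)))⟩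
    omega
  have hfirst : ∀ L ∈ S, ¬ G L →
      ((S.erase L).filter fun W => ¬ G W ∧ ¬ Disjoint W L).card ≤ k + 3 := by
    intro L hL hGL
    refine card_le_of_pairwise_meet hd hc hf (hS L hL) _ (fun M hM => ?_) fun M hM M' hM' => ?_
    · rw [Finset.mem_filter, Finset.mem_erase] at hM
      exact ⟨hS M hM.1.2, hM.1.1, hM.2.2⟩
    · rw [Finset.mem_filter, Finset.mem_erase] at hM hM'
      exact hchain L hL M hM.1.2 M' hM'.1.2 hGL hM.2.1 hM'.2.1 hM.1.1 hM'.1.1 hM.2.2 hM'.2.2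
  have hsum := Finset.card_filter_add_card_filter_not (s := S) G
  obtain ⟨L₁, hL₁, L₂, hL₂, g₁, g₂, hdis⟩ :
      ∃ L₁ ∈ S, ∃ L₂ ∈ S, ¬ G L₁ ∧ ¬ G L₂ ∧ Disjoint L₁ L₂ := by
    by_contra! hno
    obtain ⟨L, hL⟩ : (S.filter fun W => ¬ G W).Nonempty := Finset.card_pos.1 (by omega)
    rw [Finset.mem_filter] at hL
    have h1 := hfirst L hL.1 hL.2
    have h2 : ((S.filter fun W => ¬ G W).erase L).card ≤
        ((S.erase L).filter fun W => ¬ G W ∧ ¬ Disjoint W L).card := by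
      refine Finset.card_le_card fun W hW => ?_
      rw [Finset.mem_erase, Finset.mem_filter] at hW
      rw [Finset.mem_filter, Finset.mem_erase]
      exact ⟨⟨hW.1, hW.2.1⟩, hW.2.2, hno W hW.2.1 L hL.1 hW.2.2 hL.2⟩
    rw [Finset.card_erase_of_mem (Finset.mem_filter.2 hL)] at h2
    omega
  have hT := two_mul_card_le_of_disjoint hf.1 hφ hd (by omega) h₀.irreducible
    h₀.not_dvd_flecnodal hs S hS' hL₁ hL₂ hdis
  rw [he, hde'] at hT
  have h12 : (S.erase L₁).erase L₂ ⊆ S.erase L₁ := Finset.erase_subset _ _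
  have h21 : (S.erase L₁).erase L₂ ⊆ S.erase L₂ :=
    Finset.erase_subset_erase _ (Finset.erase_subset _ _)
  have hk := card_filter_add_card_filter_le ((S.erase L₁).erase L₂)
    (fun W => ¬ Disjoint W L₁) (fun W => ¬ Disjoint W L₂) G
    ((Finset.card_le_card (Finset.filter_subset_filter _ h12)).trans (hfirst L₁ hL₁ g₁))
    ((Finset.card_le_card (Finset.filter_subset_filter _ h21)).trans (hfirst L₂ hL₂ g₂))
    (card_transversals_le hd hc hf (hS L₁ hL₁) (hS L₂ hL₂) hdis g₁ _ fun M hM => by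
      rw [Finset.mem_filter] at hM
      exact ⟨hS M (Finset.mem_of_mem_erase (h12 hM.1)), hM.2⟩)
    (Finset.card_le_card (Finset.filter_subset_filter _ (h12.trans (Finset.erase_subset _ _))))
  omega

end Count

theorem lines_finite_and_bound
    {K : Type*} [Field K] [IsAlgClosed K] (d : ℕ) (hd : 3 ≤ d)
    (hchar : ringChar K = 0 ∨ d < ringChar K)
    (f : MvPolynomial (Fin 4) K) (hf : IsSmoothSurfaceOfDegree f d) :
    {W : Submodule K (Fin 4 → K) | IsLineInSurface f W}.Finite ∧
      {W : Submodule K (Fin 4 → K) | IsLineInSurface f W}.ncard ≤ 11 * d ^ 2 - 30 * d + 18 := by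
  have hc : ∀ k : ℕ, 0 < k → k ≤ d → (k : K) ≠ 0 := fun k hk hkd h0 => by
    have hdvd := (ringChar.spec K k).1 h0
    rcases hchar with h | h
    · rw [h, zero_dvd_iff] at hdvd
      omega
    · have := Nat.le_of_dvd hk hdvd
      omega
  have hfin : {W : Submodule K (Fin 4 → K) | IsLineInSurface f W}.Finite := by
    by_contra hinf
    obtain ⟨S, hS, hcard⟩ := Set.Infinite.exists_subset_card_eq hinf (11 * d ^ 2 - 30 * d + 18 + 1)
    have := card_isLineInSurface_le hd hc hf S fun W hW => hS hW
    omega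
  refine ⟨hfin, ?_⟩
  rw [Set.ncard_eq_toFinset_card _ hfin]
  exact card_isLineInSurface_le hd hc hf _ fun W hW => by simpa using hW
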